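/- Let M be a connected manifold of finite type of odd dimension d. Let V = H_*(M; ℚ) as a graded vector space, let v_0 ∈ V be the class of a point generating H_0(M; ℚ), and let ⟨v_0⟩ ⊆ Sym^k(V) denote the subspace v_0 · Sym^{k−1}(V). Then for every k ≥ 1 there is an isomorphism of graded ℚ-vector spaces H_*(C_k(M); ℚ) ≅ H_*(C_{k−1}(M); ℚ) ⊕ Sym^k(V)/⟨v_0⟩; in particular, for every i ≥ 0, dim_ℚ H_i(C_{k−1}(M); ℚ) ≤ dim_ℚ H_i(C_k(M); ℚ). -/

import Mathlib

open CategoryTheory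

/-- The singular chain complex functor with coefficients in a commutative ring `R`:
the levelwise free `R`-module on the singular simplicial set of a space, turned into
a chain complex via the alternating face map complex. -/
noncomputable def singularChainComplexFunctor (R : Type) [CommRing R] :
    TopCat.{0} ⥤ ChainComplex (ModuleCat.{0} R) ℕ :=
  TopCat.toSSet ⋙ ((SimplicialObject.whiskering _ _).obj (ModuleCat.free R)) ⋙
    AlgebraicTopology.alternatingFaceMapComplex _

/-- The `n`-th singular homology of a topological space, with coefficients in `R`. -/
noncomputable def SingularHomology (R : Type) [CommRing R] (n : ℕ) (X : Type)
    [TopologicalSpace X] : ModuleCat.{0} R :=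
  (singularChainComplexFunctor R ⋙ HomologicalComplex.homologyFunctor _ _ n).obj (TopCat.of X)

/-- The setoid on the ordered configuration space (the space of injective tuples
`Fin k → M`) identifying tuples that differ by a permutation of the coordinates. -/
def configSetoid (M : Type) (k : ℕ) : Setoid {f : Fin k → M // Function.Injective f} where
  r f g := ∃ σ : Equiv.Perm (Fin k), (f : Fin k → M) ∘ σ = g
  iseqv := by
    constructor
    · exact fun f => ⟨Equiv.refl _, rfl⟩
    · rintro f g ⟨σ, h⟩
      exact ⟨σ.symm, by rw [← h]; ext x; simp⟩
    · rintro f g h ⟨σ, hσ⟩ ⟨τ, hτ⟩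
      exact ⟨τ.trans σ, by rw [← hτ, ← hσ]; rfl⟩

/-- The unordered configuration space `C_k(M)` of `k` points in `M`: the quotient of
the space of injective tuples `Fin k → M` (with the subspace topology from the product
topology) by the permutation action of the symmetric group, with the quotient topology. -/
def UnordConfigSpace (M : Type) (k : ℕ) : Type := Quotient (configSetoid M k)

instance (M : Type) [TopologicalSpace M] (k : ℕ) : TopologicalSpace (UnordConfigSpace M k) :=
  instTopologicalSpaceQuotient

open scoped DirectSum

/-- The graded-commutativity relations on the tensor algebra of the direct sum of the
components of a graded vector space `V`: homogeneous elements of degrees `i` and `j`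
commute up to the sign `(-1)^(i*j)`. -/
inductive GradedCommRel (V : ℕ → Type) [∀ i, AddCommGroup (V i)] [∀ i, Module ℚ (V i)] :
    TensorAlgebra ℚ (⨁ i, V i) → TensorAlgebra ℚ (⨁ i, V i) → Prop
  | comm (i j : ℕ) (a : V i) (b : V j) :
      GradedCommRel V
        (TensorAlgebra.ι ℚ (DirectSum.of V i a) * TensorAlgebra.ι ℚ (DirectSum.of V j b))
        ((-1 : ℚ) ^ (i * j) •
          (TensorAlgebra.ι ℚ (DirectSum.of V j b) * TensorAlgebra.ι ℚ (DirectSum.of V i a)))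

/-- The free graded-commutative algebra `Sym(V)` on a graded vector space `V`
(polynomial on the even-degree part, exterior on the odd-degree part), realized as the
quotient of the tensor algebra on `⨁ i, V i` by the graded-commutativity relations. -/
def FreeGCAlg (V : ℕ → Type) [∀ i, AddCommGroup (V i)] [∀ i, Module ℚ (V i)] : Type :=
  RingQuot (GradedCommRel V)

noncomputable instance (V : ℕ → Type) [∀ i, AddCommGroup (V i)] [∀ i, Module ℚ (V i)] :
    Ring (FreeGCAlg V) := inferInstanceAs (Ring (RingQuot (GradedCommRel V)))

noncomputable instance (V : ℕ → Type) [∀ i, AddCommGroup (V i)] [∀ i, Module ℚ (V i)] :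
    Algebra ℚ (FreeGCAlg V) := inferInstanceAs (Algebra ℚ (RingQuot (GradedCommRel V)))

/-- The generator of the free graded-commutative algebra corresponding to a homogeneous
element of the graded vector space `V`. -/
noncomputable def FreeGCAlg.gen (V : ℕ → Type) [∀ i, AddCommGroup (V i)] [∀ i, Module ℚ (V i)]
    (p : Σ j, V j) : FreeGCAlg V :=
  RingQuot.mkAlgHom ℚ (GradedCommRel V) (TensorAlgebra.ι ℚ (DirectSum.of V p.1 p.2))

/-- The internal-degree-`i` component of `Sym^k(V)`: the subspace of the free
graded-commutative algebra on `V` spanned by products of `k` homogeneous elements of `V`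
whose degrees sum to `i` (monomials of length `k` and total degree `i`). -/
noncomputable def SymComponent (V : ℕ → Type) [∀ i, AddCommGroup (V i)] [∀ i, Module ℚ (V i)]
    (k i : ℕ) : Submodule ℚ (FreeGCAlg V) :=
  Submodule.span ℚ { x | ∃ l : List (Σ j, V j), l.length = k ∧
    (l.map Sigma.fst).sum = i ∧ x = (l.map (FreeGCAlg.gen V)).prod }


namespace BCT
open CategoryTheory

abbrev Simp (n : ℕ) := stdSimplex ℝ (Fin (n+1))
abbrev Smp (X : Type) [TopologicalSpace X] := Σ n : ℕ, C(Simp n, X)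
abbrev Ch (X : Type) [TopologicalSpace X] := Smp X →₀ ℚ

noncomputable def face (n : ℕ) (i : Fin (n+2)) : C(Simp n, Simp (n+1)) :=
  ⟨stdSimplex.map (Fin.succAbove i), stdSimplex.continuous_map _⟩

section
variable {X Y Z : Type} [TopologicalSpace X] [TopologicalSpace Y] [TopologicalSpace Z]

noncomputable def sg (σ : Smp X) : Ch X := Finsupp.single σ 1

noncomputable def bdS : Smp X → Ch X
  | ⟨0, _⟩ => 0
  | ⟨n+1, σ⟩ => ∑ i : Fin (n+2), (-1:ℚ)^(i:ℕ) • sg ⟨n, σ.comp (face n i)⟩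

noncomputable def bd : Ch X →ₗ[ℚ] Ch X := Finsupp.linearCombination ℚ bdS

lemma lift_sg {W : Type*} [AddCommGroup W] [Module ℚ W] (f : Smp X → W) (σ : Smp X) :
    Finsupp.linearCombination ℚ f (sg σ) = f σ := by
  simp [sg]

lemma bd_sg (σ : Smp X) : bd (sg σ) = bdS σ := lift_sg _ _

lemma bd_zero (σ : C(Simp 0, X)) : bd (sg ⟨0, σ⟩) = 0 := bd_sg _

lemma bd_succ (n : ℕ) (σ : C(Simp (n+1), X)) :
    bd (sg ⟨n+1, σ⟩) = ∑ i : Fin (n+2), (-1:ℚ)^(i:ℕ) • sg ⟨n, σ.comp (face n i)⟩ := bd_sg _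

lemma Ch.hom_ext {W : Type*} [AddCommGroup W] [Module ℚ W] {f g : Ch X →ₗ[ℚ] W}
    (h : ∀ σ, f (sg σ) = g (sg σ)) : f = g := by
  apply Finsupp.lhom_ext'
  intro σ
  ext
  exact h σ

/-- Induced map of a continuous map. -/
noncomputable def cmap (f : C(X, Y)) : Ch X →ₗ[ℚ] Ch Y :=
  Finsupp.linearCombination ℚ (fun σ => sg ⟨σ.1, f.comp σ.2⟩)

lemma cmap_sg (f : C(X, Y)) (σ : Smp X) : cmap f (sg σ) = sg ⟨σ.1, f.comp σ.2⟩ := lift_sg _ _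

lemma cmap_comp (f : C(X, Y)) (g : C(Y, Z)) : cmap (g.comp f) = cmap g ∘ₗ cmap f := by
  apply Ch.hom_ext; intro σ
  simp only [LinearMap.comp_apply, cmap_sg, ContinuousMap.comp_assoc]

lemma cmap_cmap (f : C(X, Y)) (g : C(Y, Z)) (x : Ch X) :
    cmap g (cmap f x) = cmap (g.comp f) x := by rw [cmap_comp]; rfl

lemma cmap_id : cmap (ContinuousMap.id X) = LinearMap.id := by
  apply Ch.hom_ext; intro σ
  simp [cmap_sg]

lemma bd_cmap (f : C(X, Y)) (x : Ch X) : bd (cmap f x) = cmap f (bd x) := by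
  have : bd ∘ₗ cmap f = cmap f ∘ₗ bd := by
    apply Ch.hom_ext; intro σ
    obtain ⟨n, σ⟩ := σ
    cases n with
    | zero => simp only [LinearMap.comp_apply, cmap_sg, bd_zero, map_zero]
    | succ n =>
      simp only [LinearMap.comp_apply, cmap_sg, bd_succ, map_sum, map_smul,
        ContinuousMap.comp_assoc]
  exact LinearMap.congr_fun this x

/-- augmentation -/
noncomputable def aug : Ch X →ₗ[ℚ] ℚ :=
  Finsupp.linearCombination ℚ (fun σ => if σ.1 = 0 then 1 else 0)

lemma aug_sg (σ : Smp X) : aug (sg σ) = if σ.1 = 0 then 1 else 0 := lift_sg _ _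

lemma aug_cmap (f : C(X, Y)) (x : Ch X) : aug (cmap f x) = aug x := by
  have : aug ∘ₗ cmap f = aug := by
    apply Ch.hom_ext; intro σ
    simp [cmap_sg, aug_sg]
  exact LinearMap.congr_fun this x

lemma aug_bd (x : Ch X) : aug (bd x) = 0 := by
  have : aug ∘ₗ (bd : Ch X →ₗ[ℚ] Ch X) = 0 := by
    apply Ch.hom_ext; intro σ
    obtain ⟨n, σ⟩ := σ
    rcases n with _ | _ | n
    · simp [bd_zero]
    · simp [bd_succ, aug_sg, Fin.sum_univ_two]
    · simp [bd_succ, aug_sg]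
  exact LinearMap.congr_fun this x

/-- sign involution -/
noncomputable def sgn : Ch X →ₗ[ℚ] Ch X :=
  Finsupp.linearCombination ℚ (fun σ => (-1:ℚ)^σ.1 • sg σ)

lemma sgn_sg (σ : Smp X) : sgn (sg σ) = (-1:ℚ)^σ.1 • sg σ := lift_sg _ _

lemma sgn_sgn (x : Ch X) : sgn (sgn x) = x := by
  have : sgn ∘ₗ (sgn : Ch X →ₗ[ℚ] Ch X) = LinearMap.id := by
    apply Ch.hom_ext; intro σ
    simp only [LinearMap.comp_apply, sgn_sg, map_smul, smul_smul, LinearMap.id_apply]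
    rw [← mul_pow]; simp
  exact LinearMap.congr_fun this x

lemma sgn_bd (x : Ch X) : sgn (bd x) = - bd (sgn x) := by
  have : sgn ∘ₗ (bd : Ch X →ₗ[ℚ] Ch X) = - (bd ∘ₗ sgn) := by
    apply Ch.hom_ext; intro σ
    obtain ⟨n, σ⟩ := σ
    cases n with
    | zero => simp [bd_zero, sgn_sg]
    | succ n =>
      simp only [LinearMap.comp_apply, sgn_sg, bd_succ, map_sum, map_smul, LinearMap.neg_apply,
        Finset.smul_sum, ← Finset.sum_neg_distrib]
      refine Finset.sum_congr rfl fun i _ => ?_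
      rw [smul_comm, pow_succ]; simp
  exact LinearMap.congr_fun this x

lemma sgn_cmap (f : C(X, Y)) (x : Ch X) : sgn (cmap f x) = cmap f (sgn x) := by
  have : sgn ∘ₗ cmap f = cmap f ∘ₗ sgn := by
    apply Ch.hom_ext; intro σ
    simp [cmap_sg, sgn_sg]
  exact LinearMap.congr_fun this x

/-- degree n chains supported in W -/
noncomputable def S (n : ℕ) (W : Set X) : Submodule ℚ (Ch X) :=
  Finsupp.supported ℚ ℚ {σ | σ.1 = n ∧ ∀ t, σ.2 t ∈ W}

lemma sg_mem_S {n : ℕ} {W : Set X} (σ : C(Simp n, X)) (h : ∀ t, σ t ∈ W) :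
    sg ⟨n, σ⟩ ∈ S n W := Finsupp.single_mem_supported _ _ ⟨rfl, h⟩

lemma S_eq_span (n : ℕ) (W : Set X) :
    S n W = Submodule.span ℚ {x | ∃ σ : C(Simp n, X), (∀ t, σ t ∈ W) ∧ x = sg ⟨n, σ⟩} := by
  rw [S, Finsupp.supported_eq_span_single]
  congr 1
  ext x; constructor
  · rintro ⟨⟨m, σ⟩, ⟨h1, h2⟩, rfl⟩
    dsimp at h1; subst h1
    exact ⟨σ, h2, rfl⟩
  · rintro ⟨σ, h, rfl⟩
    exact ⟨⟨n, σ⟩, ⟨rfl, h⟩, rfl⟩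

/-- to show a linear map sends S n W into a submodule, check on simplices -/
lemma S_map {n : ℕ} {W : Set X} {Q : Type*} [AddCommGroup Q] [Module ℚ Q] (f : Ch X →ₗ[ℚ] Q)
    (P : Submodule ℚ Q)
    (h : ∀ σ : C(Simp n, X), (∀ t, σ t ∈ W) → f (sg ⟨n, σ⟩) ∈ P) {x : Ch X} (hx : x ∈ S n W) :
    f x ∈ P := by
  have : S n W ≤ P.comap f := by
    rw [S_eq_span, Submodule.span_le]
    rintro _ ⟨σ, h', rfl⟩
    exact h σ h'
  exact this hx

lemma S_congr {n : ℕ} {W : Set X} {Q : Type*} [AddCommGroup Q] [Module ℚ Q] (f g : Ch X →ₗ[ℚ] Q)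
    (h : ∀ σ : C(Simp n, X), (∀ t, σ t ∈ W) → f (sg ⟨n, σ⟩) = g (sg ⟨n, σ⟩)) {x : Ch X}
    (hx : x ∈ S n W) : f x = g x := by
  have := S_map (f - g) ⊥ (fun σ h' => by simp [h σ h']) hx
  simpa [sub_eq_zero] using this

lemma S_mono {n : ℕ} {W W' : Set X} (h : W ⊆ W') : S n W ≤ S n W' :=
  Finsupp.supported_mono fun _ hσ => ⟨hσ.1, fun t => h (hσ.2 t)⟩

lemma S_inter {n : ℕ} {W W' : Set X} {x : Ch X} (h : x ∈ S n W) (h' : x ∈ S n W') :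
    x ∈ S n (W ∩ W') := by
  intro σ hσ
  exact ⟨(h hσ).1, fun t => ⟨(h hσ).2 t, (h' hσ).2 t⟩⟩

lemma bd_mem_S {n : ℕ} {W : Set X} {x : Ch X} (hx : x ∈ S (n+1) W) : bd x ∈ S n W := by
  refine S_map bd _ (fun σ h => ?_) hx
  rw [bd_succ]
  exact Submodule.sum_mem _ fun i _ => Submodule.smul_mem _ _ (sg_mem_S _ fun t => h _)

lemma bd_S_zero {W : Set X} {x : Ch X} (hx : x ∈ S 0 W) : bd x = 0 :=
  S_congr bd 0 (fun σ _ => bd_zero σ) hx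

lemma cmap_mem_S {n : ℕ} {W : Set X} {W' : Set Y} (f : C(X, Y)) (hf : ∀ x ∈ W, f x ∈ W') {x : Ch X}
    (hx : x ∈ S n W) : cmap f x ∈ S n W' := by
  refine S_map (cmap f) _ (fun σ h => ?_) hx
  rw [cmap_sg]
  exact sg_mem_S _ fun t => hf _ (h t)

lemma S_empty {n : ℕ} {x : Ch X} (hx : x ∈ S n (∅ : Set X)) : x = 0 :=
  S_congr LinearMap.id 0 (fun _ h => absurd (h (stdSimplex.vertex 0)) id) hx

/-- degree projection -/
noncomputable def dg (n : ℕ) : Ch X →ₗ[ℚ] Ch X :=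
  Finsupp.linearCombination ℚ (fun σ => if σ.1 = n then sg σ else 0)

lemma dg_sg (n : ℕ) (σ : Smp X) : dg n (sg σ) = if σ.1 = n then sg σ else 0 := lift_sg _ _

lemma sg_mem_S' (σ : Smp X) : sg σ ∈ S σ.1 (Set.univ : Set X) :=
  sg_mem_S σ.2 fun _ => trivial

lemma dg_mem (n : ℕ) (x : Ch X) : dg n x ∈ S n (Set.univ : Set X) := by
  have : LinearMap.range (dg n : Ch X →ₗ[ℚ] Ch X) ≤ S n (Set.univ : Set X) := by
    rw [dg, Finsupp.range_linearCombination, Submodule.span_le]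
    rintro _ ⟨σ, rfl⟩
    dsimp only
    split_ifs with h
    · subst h; exact sg_mem_S' σ
    · exact Submodule.zero_mem _
  exact this ⟨x, rfl⟩

lemma dg_of_mem {n : ℕ} {W : Set X} {x : Ch X} (hx : x ∈ S n W) : dg n x = x :=
  S_congr (dg n) LinearMap.id (fun σ _ => by simp [dg_sg]) hx

lemma dg_of_mem_ne {n m : ℕ} {W : Set X} (h : n ≠ m) {x : Ch X} (hx : x ∈ S n W) : dg m x = 0 :=
  S_congr (dg m) 0 (fun σ _ => by simp [dg_sg, h]) hx

lemma dg_bd (n : ℕ) (x : Ch X) : dg n (bd x) = bd (dg (n+1) x) := by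
  have : dg n ∘ₗ (bd : Ch X →ₗ[ℚ] Ch X) = bd ∘ₗ dg (n+1) := by
    apply Ch.hom_ext; intro σ
    obtain ⟨m, σ⟩ := σ
    cases m with
    | zero => simp [bd_zero, dg_sg]
    | succ m =>
      simp only [LinearMap.comp_apply, dg_sg, bd_succ, map_sum, map_smul]
      by_cases h : m = n
      · simp [h, bd_succ]
      · simp [h]
  exact LinearMap.congr_fun this x

lemma sgn_of_mem {n : ℕ} {W : Set X} {x : Ch X} (hx : x ∈ S n W) : sgn x = (-1:ℚ)^n • x :=
  S_congr sgn ((-1:ℚ)^n • LinearMap.id) (fun σ _ => by simp only [sgn_sg]; rfl) hx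

/-! ### Comparison with the Mathlib complex -/

variable (X) in
noncomputable abbrev cpx : ChainComplex (ModuleCat.{0} ℚ) ℕ :=
  (singularChainComplexFunctor ℚ).obj (TopCat.of X)

variable (X) in
/-- identification of the chains in degree n -/
noncomputable def cpxE (n : ℕ) : (C(Simp n, X) →₀ ℚ) ≃ₗ[ℚ] (cpx X).X n :=
  Finsupp.domLCongr (TopCat.toSSetObjEquiv (TopCat.of X) (Opposite.op (SimplexCategory.mk n))).symm

lemma objD_apply (Y : SimplicialObject (ModuleCat.{0} ℚ)) (n : ℕ)
    (y : Y.obj (Opposite.op (SimplexCategory.mk (n+1)))) :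
    (AlgebraicTopology.AlternatingFaceMapComplex.objD Y n).hom y =
      ∑ i : Fin (n+2), (-1:ℚ)^(i:ℕ) • (Y.δ i).hom y := by
  rw [AlgebraicTopology.AlternatingFaceMapComplex.objD, ModuleCat.hom_sum, LinearMap.sum_apply]
  refine Finset.sum_congr rfl fun i _ => ?_
  rw [ModuleCat.hom_zsmul, LinearMap.smul_apply]
  have h1 : ((-1:ℚ)^(i:ℕ)) = (((-1:ℤ)^(i:ℕ) : ℤ) : ℚ) := by push_cast; rfl
  rw [h1, Int.cast_smul_eq_zsmul]

lemma cpxE_d (n : ℕ) (σ : C(Simp (n+1), X)) :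
    ((cpx X).d (n+1) n).hom (cpxE X (n+1) (Finsupp.single σ 1)) =
      cpxE X n (∑ i : Fin (n+2), (-1:ℚ)^(i:ℕ) • Finsupp.single (σ.comp (face n i)) 1) := by
  have h0 : (cpx X).d (n+1) n = AlgebraicTopology.AlternatingFaceMapComplex.objD
    (((SimplicialObject.whiskering _ _).obj (ModuleCat.free ℚ)).obj
      (TopCat.toSSet.obj (TopCat.of X))) n :=
    AlgebraicTopology.alternatingFaceMapComplex_obj_d _ _
  rw [h0]
  refine (objD_apply _ _ _).trans ?_
  rw [map_sum]
  refine Finset.sum_congr rfl fun i _ => ?_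
  rw [map_smul]
  have h2 : ∀ τ : C(Simp n, X), cpxE X n (Finsupp.single τ 1) = (Finsupp.single
    ((TopCat.toSSetObjEquiv (TopCat.of X) (Opposite.op (SimplexCategory.mk n))).symm τ) (1:ℚ) :) :=
    fun τ => Finsupp.domLCongr_single _ _ _
  have h3 : ∀ τ : C(Simp (n+1), X), cpxE X (n+1) (Finsupp.single τ 1) = (Finsupp.single
    ((TopCat.toSSetObjEquiv (TopCat.of X) (Opposite.op (SimplexCategory.mk (n+1)))).symm τ)
      (1:ℚ) :) :=
    fun τ => Finsupp.domLCongr_single _ _ _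
  rw [h2, h3]
  congr 1
  exact Finsupp.mapDomain_single

/-- chains in degree n, included in total chains -/
noncomputable def inn (n : ℕ) : (C(Simp n, X) →₀ ℚ) →ₗ[ℚ] Ch X :=
  Finsupp.lmapDomain ℚ ℚ (fun σ => (⟨n, σ⟩ : Smp X))

lemma inn_single (n : ℕ) (σ : C(Simp n, X)) : inn n (Finsupp.single σ 1) = sg ⟨n, σ⟩ := by
  simp [inn, sg]

lemma inn_inj (n : ℕ) : Function.Injective (inn n : (C(Simp n, X) →₀ ℚ) →ₗ[ℚ] Ch X) :=
  Finsupp.mapDomain_injective (fun a b h => by simpa using h)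

lemma inn_range (n : ℕ) :
    LinearMap.range (inn n : (C(Simp n, X) →₀ ℚ) →ₗ[ℚ] Ch X) = S n Set.univ := by
  apply le_antisymm
  · rintro _ ⟨x, rfl⟩
    induction x using Finsupp.induction_linear with
    | zero => simp
    | add f g hf hg => rw [map_add]; exact Submodule.add_mem _ hf hg
    | single σ c =>
      rw [← mul_one c, ← smul_eq_mul, ← Finsupp.smul_single, map_smul, inn_single]
      exact Submodule.smul_mem _ _ (sg_mem_S _ fun _ => trivial)
  · rw [S_eq_span, Submodule.span_le]
    rintro _ ⟨σ, _, rfl⟩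
    exact ⟨_, inn_single n σ⟩

/-- cpx chains into total chains -/
noncomputable def tot (n : ℕ) : (cpx X).X n →ₗ[ℚ] Ch X := inn n ∘ₗ (cpxE X n).symm.toLinearMap

lemma tot_inj (n : ℕ) : Function.Injective (tot n : (cpx X).X n →ₗ[ℚ] Ch X) :=
  (inn_inj n).comp (cpxE X n).symm.injective

lemma tot_range (n : ℕ) : LinearMap.range (tot n : (cpx X).X n →ₗ[ℚ] Ch X) = S n Set.univ := by
  rw [tot, LinearMap.range_comp, LinearEquiv.range, Submodule.map_top, inn_range]

lemma tot_d (n : ℕ) (x : (cpx X).X (n+1)) : tot n (((cpx X).d (n+1) n).hom x) = bd (tot (n+1) x) := by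
  obtain ⟨y, rfl⟩ := (cpxE X (n+1)).surjective x
  have : tot n ∘ₗ ((cpx X).d (n+1) n).hom ∘ₗ (cpxE X (n+1)).toLinearMap =
      bd ∘ₗ tot (n+1) ∘ₗ (cpxE X (n+1)).toLinearMap := by
    apply Finsupp.lhom_ext'
    intro σ
    apply LinearMap.ext_ring
    have e := cpxE_d n σ
    simp only [LinearMap.comp_apply, Finsupp.lsingle_apply, LinearEquiv.coe_coe]
    rw [e]
    simp [tot, inn_single, bd_succ, -Finsupp.smul_single]
  exact LinearMap.congr_fun this y

lemma bd_bd (x : Ch X) : bd (bd x) = 0 := by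
  have : bd ∘ₗ (bd : Ch X →ₗ[ℚ] Ch X) = 0 := by
    apply Ch.hom_ext; intro σ
    obtain ⟨n, σ⟩ := σ
    rcases n with _ | _ | n
    · simp [bd_zero]
    · simp [bd_succ, bd_zero]
    · have : sg ⟨n+2, σ⟩ ∈ LinearMap.range (tot (n+2) : (cpx X).X (n+2) →ₗ[ℚ] Ch X) := by
        rw [tot_range]; exact sg_mem_S _ fun _ => trivial
      obtain ⟨y, hy⟩ := this
      simp only [LinearMap.comp_apply, LinearMap.zero_apply]
      rw [← hy, ← tot_d, ← tot_d]
      have : ((cpx X).d (n+2) (n+1) ≫ (cpx X).d (n+1) n) = 0 := by simp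
      have := congrArg (fun f => ModuleCat.Hom.hom f y) this
      simp only [ModuleCat.hom_comp, LinearMap.comp_apply] at this
      rw [this]; simp
  exact LinearMap.congr_fun this x

variable (X) in
/-- cycles of degree n -/
noncomputable def Zc (n : ℕ) : Submodule ℚ (Ch X) := S n Set.univ ⊓ LinearMap.ker bd

lemma exists_cls_aux (K : ChainComplex (ModuleCat.{0} ℚ) ℕ) (n m : ℕ)
    (hm : (ComplexShape.down ℕ).next n = m) :
    ∃ c : LinearMap.ker (K.d n m).hom →ₗ[ℚ] K.homology n,
    Function.Surjective c ∧ ∀ z, c z = 0 ↔ ∃ b, (K.d (n+1) n).hom b = z := by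
  let sc := K.sc' (n+1) n m
  let e1 : K.homology n ≅ sc.homology := K.homologyIsoSc' (n+1) n m (by simp) hm
  let e2 := sc.moduleCatHomologyIso
  let e := (e1 ≪≫ e2).toLinearEquiv
  let q : LinearMap.ker (K.d n m).hom →ₗ[ℚ] sc.moduleCatLeftHomologyData.H :=
    sc.moduleCatLeftHomologyData.π.hom
  refine ⟨e.symm.toLinearMap ∘ₗ q, ?_, ?_⟩
  · refine e.symm.surjective.comp ?_
    exact Submodule.mkQ_surjective _
  · intro z
    rw [LinearMap.comp_apply, LinearEquiv.coe_coe, LinearEquiv.map_eq_zero_iff]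
    have : q z = 0 ↔ z ∈ LinearMap.range sc.moduleCatToCycles :=
      Submodule.Quotient.mk_eq_zero _
    rw [this]
    constructor
    · rintro ⟨b, hb⟩
      exact ⟨b, congrArg Subtype.val hb⟩
    · rintro ⟨b, hb⟩
      exact ⟨b, Subtype.ext hb⟩

lemma exists_cls (n : ℕ) : ∃ c : Zc X n →ₗ[ℚ] SingularHomology ℚ n X,
    Function.Surjective c ∧ ∀ z, c z = 0 ↔ ∃ b ∈ S (n+1) (Set.univ : Set X), bd b = (z : Ch X) := by
  obtain ⟨c, hc, hc'⟩ := exists_cls_aux (cpx X) n _ rfl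
  have hk : ∀ x, ((cpx X).d n ((ComplexShape.down ℕ).next n)).hom x = 0 ↔ bd (tot n x) = 0 := by
    intro x
    cases n with
    | zero =>
      have h1 : (tot 0 x) ∈ S 0 (Set.univ : Set X) := by rw [← tot_range]; exact ⟨x, rfl⟩
      simp [bd_S_zero h1]
    | succ n =>
      rw [ChainComplex.next_nat_succ, ← tot_d]
      exact (map_eq_zero_iff _ (tot_inj n)).symm
  let t : LinearMap.ker ((cpx X).d n ((ComplexShape.down ℕ).next n)).hom ≃ₗ[ℚ] Zc X n :=
    LinearEquiv.ofBijective (((tot n).domRestrict _).codRestrict (Zc X n) (fun x => by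
      refine ⟨by rw [← tot_range]; exact ⟨x, rfl⟩, (hk x).1 x.2⟩)) (by
      constructor
      · intro a b h
        exact Subtype.ext (tot_inj n (congrArg Subtype.val h))
      · rintro ⟨z, hz, hz'⟩
        rw [← tot_range] at hz
        obtain ⟨x, rfl⟩ := hz
        exact ⟨⟨x, (hk x).2 hz'⟩, rfl⟩)
  refine ⟨c ∘ₗ t.symm.toLinearMap, hc.comp t.symm.surjective, fun z => ?_⟩
  obtain ⟨y, rfl⟩ := t.surjective z
  have ht : ((t y : Zc X n) : Ch X) = tot n y := rfl
  have h2 : (c ∘ₗ t.symm.toLinearMap) (t y) = c y := by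
    rw [LinearMap.comp_apply, LinearEquiv.coe_coe, LinearEquiv.symm_apply_apply]
  refine (Eq.congr_left h2).trans ((hc' y).trans ?_)
  rw [ht]
  constructor
  · rintro ⟨b, hb⟩
    exact ⟨tot (n+1) b, by rw [← tot_range]; exact ⟨b, rfl⟩, by rw [← tot_d, hb]⟩
  · rintro ⟨b, hb, hb'⟩
    rw [← tot_range] at hb
    obtain ⟨b, rfl⟩ := hb
    rw [← tot_d] at hb'
    exact ⟨b, tot_inj n hb'⟩

variable (X) in
/-- homology class map -/
noncomputable def cls (n : ℕ) : Zc X n →ₗ[ℚ] SingularHomology ℚ n X := (exists_cls n).choose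

lemma cls_surj (n : ℕ) : Function.Surjective (cls X n) := (exists_cls n).choose_spec.1

lemma cls_eq_zero (n : ℕ) (z : Zc X n) :
    cls X n z = 0 ↔ ∃ b ∈ S (n+1) (Set.univ : Set X), bd b = (z : Ch X) :=
  (exists_cls n).choose_spec.2 z
end
end BCT

namespace BCT
open Topology Filter

lemma map_apply_of_inj {n m : ℕ} (f : Fin (n+1) → Fin (m+1)) (hf : Function.Injective f)
    (t : Simp n) (j : Fin (n+1)) : (stdSimplex.map f t) (f j) = t j := by
  have := stdSimplex.map_coe (S := ℝ) f t
  have h2 := congrFun this (f j)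
  refine h2.trans ?_
  rw [FunOnFinite.linearMap_apply_apply]
  rw [Finset.sum_eq_single j]
  · intro b hb hbj
    simp only [Finset.mem_filter, Finset.mem_univ, true_and] at hb
    exact absurd (hf hb) hbj
  · simp

lemma map_apply_of_notMem {n m : ℕ} (f : Fin (n+1) → Fin (m+1)) 
    (t : Simp n) (j : Fin (m+1)) (hj : ∀ i, f i ≠ j) : (stdSimplex.map f t) j = 0 := by
  have := stdSimplex.map_coe (S := ℝ) f t
  have h2 := congrFun this j
  refine h2.trans ?_
  rw [FunOnFinite.linearMap_apply_apply]
  rw [Finset.filter_false_of_mem (fun i _ => hj i)]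
  simp

lemma face_succAbove (n : ℕ) (i : Fin (n+2)) (t : Simp n) (j : Fin (n+1)) :
    (face n i t) (i.succAbove j) = t j := map_apply_of_inj _ Fin.succAbove_right_injective _ _

lemma face_self (n : ℕ) (i : Fin (n+2)) (t : Simp n) : (face n i t) i = 0 :=
  map_apply_of_notMem _ _ _ fun j => Fin.succAbove_ne i j

lemma simp_ext {n : ℕ} {s t : Simp n} (h : ∀ i, s i = t i) : s = t := stdSimplex.ext (funext h)

lemma sum_face (n : ℕ) (i : Fin (n+2)) (t : Simp n) {E : Type*} [AddCommGroup E] [Module ℝ E]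
    (w : Fin (n+2) → E) : ∑ j, (face n i t) j • w j = ∑ j, t j • w (i.succAbove j) := by
  rw [Fin.sum_univ_succAbove _ i, face_self, zero_smul, zero_add]
  simp only [face_succAbove]

lemma continuous_coord {n : ℕ} (i : Fin (n+1)) : Continuous (fun t : Simp n => t i) :=
  (continuous_apply i).comp continuous_subtype_val

/-- the projection from the initial vertex -/
noncomputable def nu {n : ℕ} (t : Simp (n+1)) : Simp n :=
  if h : t 0 < 1 then ⟨fun i => t i.succ / (1 - t 0), by
    constructor
    · intro i
      exact div_nonneg (t.2.1 _) (by linarith)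
    · rw [← Finset.sum_div]
      have := stdSimplex.sum_eq_one t
      rw [Fin.sum_univ_succ] at this
      rw [div_eq_one_iff_eq (by linarith)]
      linarith⟩ else stdSimplex.vertex 0

lemma nu_apply {n : ℕ} (t : Simp (n+1)) (h : t 0 < 1) (i : Fin (n+1)) :
    nu t i = t i.succ / (1 - t 0) := by
  rw [nu, dif_pos h]; rfl

lemma nu_mul {n : ℕ} (t : Simp (n+1)) (i : Fin (n+1)) :
    (1 - t 0) * nu t i = t i.succ := by
  by_cases h : t 0 < 1
  · rw [nu_apply t h]; field_simp [show (1 - t 0) ≠ 0 by linarith]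
  · have h1 : t 0 = 1 := le_antisymm (stdSimplex.le_one t 0) (not_lt.1 h)
    have := stdSimplex.sum_eq_one t
    rw [Fin.sum_univ_succ, h1] at this
    have h2 : ∑ i : Fin (n+1), t i.succ = 0 := by linarith
    rw [Finset.sum_eq_zero_iff_of_nonneg (fun i _ => stdSimplex.zero_le t _)] at h2
    rw [h1, h2 i (Finset.mem_univ _)]; simp

lemma continuousAt_nu {n : ℕ} (t : Simp (n+1)) (h : t 0 < 1) : ContinuousAt (nu (n := n)) t := by
  rw [Topology.IsInducing.subtypeVal.continuousAt_iff, continuousAt_pi]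
  intro i
  have h1 : ContinuousAt (fun t : Simp (n+1) => t i.succ / (1 - t 0)) t :=
    (continuous_coord _).continuousAt.div
      (continuous_const.sub (continuous_coord 0)).continuousAt (by linarith)
  refine h1.congr ?_
  have : ∀ᶠ s : Simp (n+1) in 𝓝 t, s 0 < 1 :=
    (continuous_coord 0).continuousAt.eventually (eventually_lt_nhds h)
  filter_upwards [this] with s hs
  exact (nu_apply s hs i).symm

section
variable {E : Type} [AddCommGroup E] [Module ℝ E] [TopologicalSpace E] [IsTopologicalAddGroup E]
  [ContinuousSMul ℝ E]

noncomputable def coneS {n : ℕ} (b : E) (σ : C(Simp n, E)) : C(Simp (n+1), E) where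
  toFun t := t 0 • b + (1 - t 0) • σ (nu t)
  continuous_toFun := by
    refine ((continuous_coord 0).smul continuous_const).add ?_
    rw [continuous_iff_continuousAt]
    intro t
    by_cases h : t 0 < 1
    · refine ContinuousAt.smul (continuous_const.sub (continuous_coord 0)).continuousAt ?_
      exact σ.continuous.continuousAt.comp (continuousAt_nu t h)
    · have h1 : t 0 = 1 := le_antisymm (stdSimplex.le_one t 0) (not_lt.1 h)
      have hb : Bornology.IsVonNBounded ℝ (Set.range σ) :=
        (isCompact_range σ.continuous).isVonNBounded ℝ
      unfold ContinuousAt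
      beta_reduce
      rw [h1, sub_self, zero_smul]
      refine hb.smul_tendsto_zero (Eventually.of_forall fun _ => ⟨_, rfl⟩) ?_
      have : Continuous (fun t : Simp (n+1) => 1 - t 0) := continuous_const.sub (continuous_coord 0)
      have := this.tendsto t
      rwa [h1, sub_self] at this



def pt (X : Type) [TopologicalSpace X] (x : X) : C(Simp 0, X) := ContinuousMap.const _ x

lemma coneS_face_zero {n : ℕ} (b : E) (σ : C(Simp n, E)) : (coneS b σ).comp (face n 0) = σ := by
  ext t
  simp only [ContinuousMap.comp_apply, coneS, ContinuousMap.coe_mk, face_self]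
  have : nu (face n 0 t) = t := simp_ext fun i => by
    rw [nu_apply _ (by rw [face_self]; norm_num), face_self]
    have := face_succAbove n 0 t i
    rw [Fin.zero_succAbove] at this
    rw [this]; simp
  rw [this]; simp

lemma face_succ_zero (n : ℕ) (i : Fin (n+2)) (t : Simp (n+1)) : (face (n+1) i.succ t) 0 = t 0 := by
  have := face_succAbove (n+1) i.succ t 0
  rwa [Fin.succ_succAbove_zero] at this

lemma coneS_face_succ {n : ℕ} (b : E) (σ : C(Simp (n+1), E)) (i : Fin (n+2)) :
    (coneS b σ).comp (face (n+1) i.succ) = coneS b (σ.comp (face n i)) := by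
  ext t
  simp only [ContinuousMap.comp_apply, coneS, ContinuousMap.coe_mk, face_succ_zero]
  by_cases h : t 0 < 1
  · congr 3
    apply simp_ext
    have h' : (face (n+1) i.succ t) 0 < 1 := by rwa [face_succ_zero]
    intro j
    rw [nu_apply _ h', face_succ_zero]
    rcases Fin.eq_self_or_eq_succAbove i j with rfl | ⟨j, rfl⟩
    · rw [face_self, face_self]; simp
    · rw [face_succAbove, ← Fin.succ_succAbove_succ, face_succAbove, nu_apply _ h]
  · have h1 : t 0 = 1 := le_antisymm (stdSimplex.le_one t 0) (not_lt.1 h)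
    simp [h1]

lemma coneS_face_one (b : E) (σ : C(Simp 0, E)) : (coneS b σ).comp (face 0 1) = pt E b := by
  ext t
  have h : (face 0 1 t) 0 = 1 := by
    have := face_succAbove 0 1 t 0
    rw [show (1 : Fin 2).succAbove (0 : Fin 1) = 0 from rfl] at this
    rw [this]
    simp
  simp [ContinuousMap.comp_apply, coneS, h, pt]

noncomputable def cone (b : E) : Ch E →ₗ[ℚ] Ch E :=
  Finsupp.linearCombination ℚ (fun σ => sg ⟨σ.1 + 1, coneS b σ.2⟩)

lemma cone_sg (b : E) (σ : Smp E) : cone b (sg σ) = sg ⟨σ.1 + 1, coneS b σ.2⟩ := lift_sg _ _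

lemma bd_cone (b : E) (x : Ch E) :
    bd (cone b x) + cone b (bd x) = x - aug x • sg ⟨0, pt E b⟩ := by
  have : bd ∘ₗ cone b + cone b ∘ₗ bd = LinearMap.id - aug.smulRight (sg ⟨0, pt E b⟩) := by
    apply Ch.hom_ext; rintro ⟨n, σ⟩
    simp only [LinearMap.add_apply, LinearMap.comp_apply, cone_sg, LinearMap.sub_apply,
      LinearMap.id_apply, LinearMap.smulRight_apply, aug_sg, bd_succ]
    cases n with
    | zero =>
      simp [Fin.sum_univ_two, bd_zero, coneS_face_zero, coneS_face_one, sub_eq_add_neg]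
    | succ n =>
      rw [Fin.sum_univ_succ]
      simp only [coneS_face_zero, coneS_face_succ, bd_succ, map_sum, map_smul, cone_sg]
      simp [pow_succ]
  exact LinearMap.congr_fun this x

lemma aug_cone (b : E) (x : Ch E) : aug (cone b x) = 0 := by
  have : aug ∘ₗ cone b = 0 := by
    apply Ch.hom_ext; rintro ⟨n, σ⟩
    simp [cone_sg, aug_sg]
  exact LinearMap.congr_fun this x

lemma cone_mem_S {n : ℕ} {b : E} {W : Set E} (hW : StarConvex ℝ b W) {x : Ch E} (hx : x ∈ S n W) :
    cone b x ∈ S (n+1) W := by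
  refine S_map (cone b) _ (fun σ h => ?_) hx
  rw [cone_sg]
  exact sg_mem_S _ fun t => hW (h _) (stdSimplex.zero_le t 0) (by
    have := stdSimplex.le_one t 0; linarith) (by ring)

/-- affine simplices -/
noncomputable def lin {n : ℕ} (w : Fin (n+1) → E) : C(Simp n, E) where
  toFun t := ∑ i, t i • w i
  continuous_toFun := continuous_finsetSum _ fun i _ => (continuous_coord i).smul continuous_const

lemma lin_apply {n : ℕ} (w : Fin (n+1) → E) (t : Simp n) : lin w t = ∑ i, t i • w i := rfl

lemma lin_face {n : ℕ} (w : Fin (n+2) → E) (i : Fin (n+2)) :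
    (lin w).comp (face n i) = lin (fun j => w (i.succAbove j)) := by
  ext t
  simp only [ContinuousMap.comp_apply, lin_apply, sum_face]

lemma coneS_lin {n : ℕ} (b : E) (w : Fin (n+1) → E) : coneS b (lin w) = lin (Fin.cons b w : Fin (n+2) → E) := by
  ext t
  simp only [lin_apply, coneS, ContinuousMap.coe_mk]
  rw [Fin.sum_univ_succ (f := fun i : Fin (n+2) => _), Finset.smul_sum]
  simp only [smul_smul, nu_mul, Fin.cons_zero, Fin.cons_succ]

end
/-- star-shaped filling of cycles -/
lemma fill {E : Type} [AddCommGroup E] [Module ℝ E] [TopologicalSpace E] [IsTopologicalAddGroup E]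
    [ContinuousSMul ℝ E] {n : ℕ} {b : E} {W : Set E} (hW : StarConvex ℝ b W) {x : Ch E}
    (hx : x ∈ S n W) (hb : bd x = 0) (ha : aug x = 0) : ∃ y ∈ S (n+1) W, bd y = x :=
  ⟨cone b x, cone_mem_S hW hx, by
    have := bd_cone b x
    rw [hb, ha] at this
    simpa using this⟩
end BCT

namespace BCT
open Topology Filter

/-- the model space -/
abbrev EE := ℕ → ℝ

/-- functors to (augmented) complexes, for k-tuples of maps -/
structure Fnc (k : ℕ) where
  C : (X : Type) → [TopologicalSpace X] → Type
  [acg : ∀ X [TopologicalSpace X], AddCommGroup (C X)]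
  [md : ∀ X [TopologicalSpace X], Module ℚ (C X)]
  map : ∀ {X Y : Type} [TopologicalSpace X] [TopologicalSpace Y], (Fin k → C(X, Y)) → C X →ₗ[ℚ] C Y
  map_map : ∀ {X Y Z : Type} [TopologicalSpace X] [TopologicalSpace Y] [TopologicalSpace Z]
    (f : Fin k → C(X, Y)) (g : Fin k → C(Y, Z)) (x : C X),
    map g (map f x) = map (fun j => (g j).comp (f j)) x
  bd : ∀ {X} [TopologicalSpace X], C X →ₗ[ℚ] C X
  aug : ∀ {X} [TopologicalSpace X], C X →ₗ[ℚ] ℚ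
  bd_map : ∀ {X Y : Type} [TopologicalSpace X] [TopologicalSpace Y] (f : Fin k → C(X, Y)) (x : C X),
    bd (map f x) = map f (bd x)
  aug_map : ∀ {X Y : Type} [TopologicalSpace X] [TopologicalSpace Y] (f : Fin k → C(X, Y)) (x : C X),
    aug (map f x) = aug x
  bd_bd : ∀ {X} [TopologicalSpace X] (x : C X), bd (bd x) = 0
  aug_bd : ∀ {X} [TopologicalSpace X] (x : C X), aug (bd x) = 0

attribute [instance] Fnc.acg Fnc.md

/-- functors with models -/
structure Mdl (k : ℕ) extends Fnc k where
  Ty : Type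
  deg : Ty → ℕ
  Cell : (X : Type) → [TopologicalSpace X] → Type
  bs : ∀ {X : Type} [TopologicalSpace X], Module.Basis (Cell X) ℚ (C X)
  ty : ∀ {X : Type} [TopologicalSpace X], Cell X → Ty
  fn : ∀ {X : Type} [TopologicalSpace X], Cell X → Fin k → C(EE, X)
  push : ∀ {X Y : Type} [TopologicalSpace X] [TopologicalSpace Y], (Fin k → C(X, Y)) → Cell X → Cell Y
  push_bs : ∀ {X Y : Type} [TopologicalSpace X] [TopologicalSpace Y] (f : Fin k → C(X, Y)) (c : Cell X),
    map f (bs c) = bs (push f c)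
  push_ty : ∀ {X Y : Type} [TopologicalSpace X] [TopologicalSpace Y] (f : Fin k → C(X, Y)) (c : Cell X),
    ty (push f c) = ty c
  push_fn : ∀ {X Y : Type} [TopologicalSpace X] [TopologicalSpace Y] (f : Fin k → C(X, Y)) (c : Cell X),
    fn (push f c) = fun j => (f j).comp (fn c j)
  uc : Ty → Cell EE
  ty_uc : ∀ t, ty (uc t) = t
  bs_eq : ∀ {X : Type} [TopologicalSpace X] (c : Cell X), push (fn c) (uc (ty c)) = c
  bd_low : ∀ t, bd (bs (uc t)) ∈ Submodule.span ℚ (bs '' {c | deg (ty c) + 1 = deg t})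

namespace Mdl
variable {k : ℕ} (K : Mdl k) (L : Fnc k)

noncomputable def u (t : K.Ty) : K.C EE := K.bs (K.uc t)

lemma bs_eq' {X : Type} [TopologicalSpace X] (c : K.Cell X) :
    K.bs c = K.map (K.fn c) (K.u (K.ty c)) := by
  rw [u, K.push_bs, K.bs_eq]

/-- natural family -/
def Nat (D : ∀ (X : Type) [TopologicalSpace X], K.C X →ₗ[ℚ] L.C X) : Prop :=
  ∀ (X Y : Type) [TopologicalSpace X] [TopologicalSpace Y] (f : Fin k → C(X, Y)) (x : K.C X),
    L.map f (D X x) = D Y (K.map f x)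

noncomputable def ext (d : K.Ty → L.C EE) (X : Type) [TopologicalSpace X] : K.C X →ₗ[ℚ] L.C X :=
  K.bs.constr ℚ (fun c => L.map (K.fn c) (d (K.ty c)))

lemma ext_bs (d : K.Ty → L.C EE) (X : Type) [TopologicalSpace X] (c : K.Cell X) :
    K.ext L d X (K.bs c) = L.map (K.fn c) (d (K.ty c)) := by
  rw [ext, Module.Basis.constr_basis]

lemma ext_nat (d : K.Ty → L.C EE) : K.Nat L (K.ext L d) := by
  intro X Y _ _ f x
  have : L.map f ∘ₗ K.ext L d X = K.ext L d Y ∘ₗ K.map f := by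
    apply K.bs.ext
    intro c
    simp only [LinearMap.comp_apply]
    rw [ext_bs, K.push_bs, ext_bs, L.map_map, K.push_ty, K.push_fn]
  exact LinearMap.congr_fun this x

lemma e_idem (t : K.Ty) : (fun j => (K.fn (K.uc t) j).comp (K.fn (K.uc t) j)) = K.fn (K.uc t) := by
  have h := K.bs_eq (K.uc t)
  rw [K.ty_uc] at h
  have h2 := K.push_fn (K.fn (K.uc t)) (K.uc t)
  rw [h] at h2
  exact h2.symm

lemma map_e (t : K.Ty) : K.map (K.fn (K.uc t)) (K.u t) = K.u t := by
  have h := K.bs_eq' (K.uc t)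
  rw [K.ty_uc] at h
  exact h.symm

/-- two families agreeing in low degrees agree on low-degree elements -/
lemma ext_congr (d d' : K.Ty → L.C EE) (n : ℕ) (h : ∀ t, K.deg t + 1 = n → d t = d' t)
    {x : K.C EE} (hx : x ∈ Submodule.span ℚ (K.bs '' {c | K.deg (K.ty c) + 1 = n})) :
    K.ext L d EE x = K.ext L d' EE x := by
  induction hx using Submodule.span_induction with
  | mem x hx =>
    obtain ⟨c, hc, rfl⟩ := hx
    rw [ext_bs, ext_bs, h _ hc]
  | zero => simp
  | add x y _ _ hx hy => rw [map_add, map_add, hx, hy]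
  | smul a x _ hx => rw [map_smul, map_smul, hx]

noncomputable def fuel (Ψ : ∀ (X : Type) [TopologicalSpace X], K.C X →ₗ[ℚ] L.C X) (ε : ℚ)
    (h : K.Ty → L.C EE →ₗ[ℚ] L.C EE) : ℕ → K.Ty → L.C EE
  | 0 => fun _ => 0
  | n+1 => fun t => L.map (K.fn (K.uc t)) (h t (Ψ EE (K.u t) + ε • K.ext L (fuel Ψ ε h n) EE (K.bd (K.u t))))

lemma fuel_stable (Ψ : ∀ (X : Type) [TopologicalSpace X], K.C X →ₗ[ℚ] L.C X) (ε : ℚ)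
    (h : K.Ty → L.C EE →ₗ[ℚ] L.C EE) (n : ℕ) : ∀ m t, K.deg t < n → n ≤ m →
    K.fuel L Ψ ε h m t = K.fuel L Ψ ε h n t := by
  induction n with
  | zero => intro m t h; omega
  | succ n ih =>
    intro m t ht hm
    obtain ⟨m, rfl⟩ : ∃ m', m = m' + 1 := ⟨m - 1, by omega⟩
    simp only [fuel]
    congr 4
    refine K.ext_congr L _ _ (K.deg t) (fun s hs => ih m s ?_ ?_) (K.bd_low t) <;> omega

theorem exists_nat (Ψ : ∀ (X : Type) [TopologicalSpace X], K.C X →ₗ[ℚ] L.C X)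
    (ε : ℚ) (h : K.Ty → L.C EE →ₗ[ℚ] L.C EE) :
    ∃ D : ∀ (X : Type) [TopologicalSpace X], K.C X →ₗ[ℚ] L.C X, K.Nat L D ∧
      ∀ t, D EE (K.u t) = L.map (K.fn (K.uc t)) (h t (Ψ EE (K.u t) + ε • D EE (K.bd (K.u t)))) := by
  refine ⟨K.ext L (fun t => K.fuel L Ψ ε h (K.deg t + 1) t), K.ext_nat L _, fun t => ?_⟩
  rw [u, ext_bs, K.ty_uc]
  simp only [fuel]
  rw [L.map_map, e_idem]
  congr 4
  refine K.ext_congr L _ _ (K.deg t) (fun s hs => ?_) (K.bd_low t)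
  exact K.fuel_stable L Ψ ε h (K.deg s + 1) (K.deg t) s (by omega) (by omega)


theorem nat_bd {D Ψ : ∀ (X : Type) [TopologicalSpace X], K.C X →ₗ[ℚ] L.C X} (hD : K.Nat L D)
    (hΨ : K.Nat L Ψ) (ε : ℚ) (h : K.Ty → L.C EE →ₗ[ℚ] L.C EE) (η : K.Ty → L.C EE)
    (hf : ∀ t, D EE (K.u t) =
      L.map (K.fn (K.uc t)) (h t (Ψ EE (K.u t) + ε • D EE (K.bd (K.u t)))))
    (h1 : ∀ t x, L.bd (h t x) + h t (L.bd x) = x - L.aug x • η t) (h2 : ∀ t x, L.aug (h t x) = 0)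
    (hΨ1 : ∀ x : K.C EE, L.aug (Ψ EE x) = 0)
    (hΨ2 : ∀ x : K.C EE, L.bd (Ψ EE x) + ε • Ψ EE (K.bd x) = 0)
    (X : Type) [TopologicalSpace X] (x : K.C X) :
    L.bd (D X x) = Ψ X x + ε • D X (K.bd x) := by
  have key : ∀ t, L.bd (D EE (K.u t)) = Ψ EE (K.u t) + ε • D EE (K.bd (K.u t)) →
      ∀ (X : Type) [TopologicalSpace X] (c : K.Cell X), K.ty c = t →
        L.bd (D X (K.bs c)) = Ψ X (K.bs c) + ε • D X (K.bd (K.bs c)) := by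
    rintro t ht X _ c rfl
    rw [K.bs_eq' c, ← hD, L.bd_map, ht, map_add, map_smul, hΨ, hD, K.bd_map]
  have aug0 : ∀ x : K.C EE, L.aug (D EE x) = 0 := by
    intro x
    have : L.aug ∘ₗ D EE = 0 := by
      apply K.bs.ext
      intro c
      rw [LinearMap.comp_apply, K.bs_eq' c, ← hD, L.aug_map, hf, L.aug_map, h2]; rfl
    exact LinearMap.congr_fun this x
  have main : ∀ n t, K.deg t = n →
      L.bd (D EE (K.u t)) = Ψ EE (K.u t) + ε • D EE (K.bd (K.u t)) := by
    intro n
    induction n using Nat.strong_induction_on with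
    | _ n ih =>
      intro t ht
      have low : L.bd (D EE (K.bd (K.u t))) = Ψ EE (K.bd (K.u t)) + ε • D EE (K.bd (K.bd (K.u t))) := by
        have hx := K.bd_low t
        change K.bd (K.u t) ∈ Submodule.span ℚ _ at hx
        generalize K.bd (K.u t) = z at hx
        induction hx using Submodule.span_induction with
        | mem x hx =>
          obtain ⟨c, hc, rfl⟩ := hx
          exact key _ (ih (K.deg (K.ty c)) (by change _ + 1 = _ at hc; omega) _ rfl) _ c rfl
        | zero => simp
        | add x y _ _ hx hy => simp only [map_add, hx, hy, smul_add]; abel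
        | smul a x _ hx => simp only [map_smul, hx, smul_add]; rw [smul_comm a ε]
      rw [K.bd_bd, map_zero, smul_zero, add_zero] at low
      set y := Ψ EE (K.u t) + ε • D EE (K.bd (K.u t)) with hy
      have hby : L.bd y = 0 := by
        rw [hy, map_add, map_smul, low, hΨ2]
      have hay : L.aug y = 0 := by
        rw [hy, map_add, map_smul, aug0, hΨ1]; simp
      have h3 := h1 t y
      rw [hby, hay, map_zero, add_zero, zero_smul, sub_zero] at h3
      rw [hf, ← hy, L.bd_map, h3, hy, map_add, map_smul, hΨ, hD, ← K.bd_map, map_e]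
  have : L.bd ∘ₗ D X = Ψ X + ε • D X ∘ₗ K.bd := by
    apply K.bs.ext
    intro c
    exact key _ (main _ _ rfl) X c rfl
  exact LinearMap.congr_fun this x

theorem nat_deg {D Ψ : ∀ (X : Type) [TopologicalSpace X], K.C X →ₗ[ℚ] L.C X} (hD : K.Nat L D)
    (ε : ℚ) (h : K.Ty → L.C EE →ₗ[ℚ] L.C EE)
    (hf : ∀ t, D EE (K.u t) =
      L.map (K.fn (K.uc t)) (h t (Ψ EE (K.u t) + ε • D EE (K.bd (K.u t)))))
    (P : ℕ → Submodule ℚ (L.C EE)) (s : ℕ)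
    (hP : ∀ n (f : Fin k → C(EE, EE)) x, x ∈ P n → L.map f x ∈ P n)
    (hh : ∀ n t x, x ∈ P n → h t x ∈ P (n+1)) (hΨ : ∀ t, Ψ EE (K.u t) ∈ P (K.deg t + s)) :
    ∀ t, D EE (K.u t) ∈ P (K.deg t + s + 1) := by
  have main : ∀ n t, K.deg t = n → D EE (K.u t) ∈ P (K.deg t + s + 1) := by
    intro n
    induction n using Nat.strong_induction_on with
    | _ n ih =>
      intro t ht
      rw [hf]
      refine hP _ _ _ (hh _ _ _ (Submodule.add_mem _ (hΨ t) (Submodule.smul_mem _ _ ?_)))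
      have : Submodule.span ℚ (K.bs '' {c | K.deg (K.ty c) + 1 = K.deg t}) ≤
          (P (K.deg t + s)).comap (D EE) := by
        rw [Submodule.span_le]
        rintro _ ⟨c, hc, rfl⟩
        change _ + 1 = _ at hc
        change D EE (K.bs c) ∈ P (K.deg t + s)
        rw [K.bs_eq' c, ← hD]
        refine hP _ _ _ ?_
        have := ih (K.deg (K.ty c)) (by omega) (K.ty c) rfl
        rwa [show K.deg t + s = K.deg (K.ty c) + s + 1 by omega]
      exact this (K.bd_low t)
  exact fun t => main _ t rfl

end Mdl
end BCT

namespace BCT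
open Topology Filter
set_option linter.unusedVariables false
set_option linter.unusedSimpArgs false

noncomputable def iot (p : ℕ) : C(Simp p, EE) := lin (fun i => Pi.single (i:ℕ) (1:ℝ))

lemma iot_apply (p : ℕ) (t : Simp p) (i : Fin (p+1)) : iot p t i = t i := by
  rw [iot, lin_apply, Finset.sum_apply, Finset.sum_eq_single i]
  · simp
  · intro b _ hb
    simp [Pi.single_apply, Fin.val_inj, hb.symm]
  · simp

noncomputable def retF (p : ℕ) (x : EE) (i : Fin (p+1)) : ℝ :=
  (max (x i) 0 + max 0 (1 - ∑ j : Fin (p+1), max (x j) 0) / (p+1)) /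
    max 1 (∑ j : Fin (p+1), max (x j) 0)

noncomputable def ret (p : ℕ) : C(EE, Simp p) where
  toFun x := ⟨retF p x, by
    constructor
    · intro i
      unfold retF
      positivity
    · simp only [retF]
      rw [← Finset.sum_div, Finset.sum_add_distrib]
      have h1 : (0:ℝ) < max 1 (∑ j : Fin (p+1), max (x j) 0) := by positivity
      rw [div_eq_one_iff_eq h1.ne']
      simp only [Finset.sum_const, Finset.card_univ, Fintype.card_fin, nsmul_eq_mul]
      push_cast
      rw [mul_div_cancel₀ _ (by positivity)]
      rcases le_total (∑ j : Fin (p+1), max (x j) 0) 1 with h | h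
      · rw [max_eq_right (by linarith), max_eq_left h]; ring
      · rw [max_eq_left (by linarith), max_eq_right h]; ring⟩
  continuous_toFun := by
    refine Continuous.subtype_mk ?_ _
    refine continuous_pi fun i => ?_
    unfold retF
    have hs : Continuous (fun x : EE => ∑ j : Fin (p+1), max (x j) 0) := by fun_prop
    refine Continuous.div ?_ (by fun_prop) (fun x => by positivity)
    fun_prop

lemma ret_iot (p : ℕ) : (ret p).comp (iot p) = ContinuousMap.id _ := by
  ext t : 1
  refine simp_ext fun i => ?_
  change retF p (iot p t) i = t i
  have : ∀ j : Fin (p+1), max (t j) 0 = t j := fun j => max_eq_left (stdSimplex.zero_le t j)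
  simp only [retF, iot_apply, this, stdSimplex.sum_eq_one]
  simp

lemma comp_ret_iot {X : Type} [TopologicalSpace X] (p : ℕ) (σ : C(Simp p, X)) :
    (σ.comp (ret p)).comp (iot p) = σ := by
  rw [ContinuousMap.comp_assoc, ret_iot, ContinuousMap.comp_id]

/-- identification of the kth chain functor on products -/
noncomputable abbrev F1 : Fnc 1 where
  C X _ := Ch X
  map f := cmap (f 0)
  map_map f g x := cmap_cmap _ _ _
  bd := bd
  aug := aug
  bd_map f x := bd_cmap _ _
  aug_map f x := aug_cmap _ _
  bd_bd := bd_bd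
  aug_bd := aug_bd

lemma bs1 {X : Type} [TopologicalSpace X] (c : Smp X) :
    (Finsupp.basisSingleOne : Module.Basis (Smp X) ℚ (Ch X)) c = sg c := by
  rw [Finsupp.coe_basisSingleOne]; rfl

lemma bd_low1 {X : Type} [TopologicalSpace X] (p : ℕ) (σ : C(Simp p, X)) :
    bd ((Finsupp.basisSingleOne : Module.Basis (Smp X) ℚ (Ch X)) ⟨p, σ⟩) ∈
      Submodule.span ℚ ((Finsupp.basisSingleOne : Module.Basis (Smp X) ℚ (Ch X)) ''
        {c | id c.1 + 1 = id p}) := by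
  rw [bs1]
  cases p with
  | zero => rw [bd_zero]; exact Submodule.zero_mem _
  | succ p =>
    rw [bd_succ]
    refine Submodule.sum_mem _ fun i _ => Submodule.smul_mem _ _ (Submodule.subset_span ?_)
    exact ⟨_, rfl, bs1 _⟩

noncomputable abbrev K1 : Mdl 1 where
  toFnc := F1
  Ty := ℕ
  deg := id
  Cell X _ := Smp X
  bs := Finsupp.basisSingleOne
  ty c := c.1
  fn c _ := c.2.comp (ret c.1)
  push f c := ⟨c.1, (f 0).comp c.2⟩
  push_bs f c := (congrArg (cmap (f 0)) (bs1 c)).trans ((cmap_sg _ _).trans (bs1 _).symm)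
  push_ty f c := rfl
  push_fn f c := by funext j; rw [Subsingleton.elim j 0]; rfl
  uc p := ⟨p, iot p⟩
  ty_uc _ := rfl
  bs_eq c := by
    obtain ⟨p, σ⟩ := c
    simp only [comp_ret_iot]
  bd_low p := bd_low1 p _

lemma K1_u (p : ℕ) : K1.u p = sg ⟨p, iot p⟩ := bs1 _

/-- chains on the product with ℝ -/
noncomputable abbrev FR : Fnc 1 where
  C X _ := Ch (X × ℝ)
  map f := cmap ((f 0).prodMap (ContinuousMap.id ℝ))
  map_map f g x := by rw [cmap_cmap]; rfl
  bd := bd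
  aug := aug
  bd_map f x := bd_cmap _ _
  aug_map f x := aug_cmap _ _
  bd_bd := bd_bd
  aug_bd := aug_bd

lemma sg_iot {X : Type} [TopologicalSpace X] {p : ℕ} (σ : C(Simp p, X)) :
    sg ⟨p, σ⟩ = cmap (σ.comp (ret p)) (sg ⟨p, iot p⟩) := by
  rw [cmap_sg]
  simp only [comp_ret_iot]

noncomputable def Psh {X : Type} [TopologicalSpace X] : ℕ → Submodule ℚ (Ch X)
  | 0 => ⊥
  | n+1 => S n Set.univ

lemma Psh_cmap {X Y : Type} [TopologicalSpace X] [TopologicalSpace Y] (f : C(X, Y)) (n : ℕ) (x : Ch X)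
    (hx : x ∈ (Psh n : Submodule ℚ (Ch X))) : cmap f x ∈ (Psh n : Submodule ℚ (Ch Y)) := by
  cases n with
  | zero => rw [Psh, Submodule.mem_bot] at *; rw [hx, map_zero]
  | succ n => exact cmap_mem_S (W' := Set.univ) f (fun _ _ => trivial) hx

lemma Psh_cone {E : Type} [AddCommGroup E] [Module ℝ E] [TopologicalSpace E] [IsTopologicalAddGroup E]
    [ContinuousSMul ℝ E] (b : E) (n : ℕ) (x : Ch E) (hx : x ∈ (Psh n : Submodule ℚ (Ch E))) :
    cone b x ∈ (Psh (n+1) : Submodule ℚ (Ch E)) := by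
  cases n with
  | zero => rw [Psh, Submodule.mem_bot] at hx; rw [hx, map_zero]; exact Submodule.zero_mem _
  | succ n => exact cone_mem_S (W := Set.univ) (fun _ _ _ _ _ _ _ => trivial) hx

lemma Psh_bd {X : Type} [TopologicalSpace X] (n : ℕ) (x : Ch X) (hx : x ∈ S n (Set.univ : Set X)) :
    bd x ∈ (Psh n : Submodule ℚ (Ch X)) := by
  cases n with
  | zero => rw [Psh, bd_S_zero hx]; exact Submodule.zero_mem _
  | succ n => exact bd_mem_S hx

def iR {X : Type} [TopologicalSpace X] (c : ℝ) : C(X, X × ℝ) := ⟨fun y => (y, c), by fun_prop⟩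

noncomputable def psiR (X : Type) [TopologicalSpace X] : Ch X →ₗ[ℚ] Ch (X × ℝ) :=
  cmap (iR 1) - cmap (iR 0)

lemma psiR_nat {X Y : Type} [TopologicalSpace X] [TopologicalSpace Y] (f : C(X, Y)) (x : Ch X) :
    cmap (f.prodMap (ContinuousMap.id ℝ)) (psiR X x) = psiR Y (cmap f x) := by
  simp only [psiR, LinearMap.sub_apply, map_sub, cmap_cmap]
  rfl

lemma aug_psiR {X : Type} [TopologicalSpace X] (x : Ch X) : aug (psiR X x) = 0 := by
  simp only [psiR, LinearMap.sub_apply, map_sub, aug_cmap, sub_self]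

lemma bd_psiR {X : Type} [TopologicalSpace X] (x : Ch X) :
    bd (psiR X x) + (-1:ℚ) • psiR X (bd x) = 0 := by
  simp only [psiR, LinearMap.sub_apply, map_sub, bd_cmap]
  simp

lemma psiR_mem {X : Type} [TopologicalSpace X] (p : ℕ) (σ : C(Simp p, X)) :
    psiR X (sg ⟨p, σ⟩) ∈ S p (Set.univ : Set (X × ℝ)) :=
  Submodule.sub_mem _ (cmap_mem_S (W' := Set.univ) _ (fun _ _ => trivial) (sg_mem_S' ⟨p, σ⟩))
    (cmap_mem_S (W' := Set.univ) _ (fun _ _ => trivial) (sg_mem_S' ⟨p, σ⟩))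

/-- naturality and degree give support control -/
lemma nat_supp {X Y : Type} [TopologicalSpace X] [TopologicalSpace Y] {D : Ch X →ₗ[ℚ] Ch Y}
    {Y₀ : Type} [TopologicalSpace Y₀] {n m : ℕ} (d : Ch Y₀) (hd : d ∈ S m (Set.univ : Set Y₀))
    (W : Set X) (W' : Set Y) (h : ∀ σ : C(Simp n, X), (∀ t, σ t ∈ W) →
      ∃ f : C(Y₀, Y), (∀ y, f y ∈ W') ∧ cmap f d = D (sg ⟨n, σ⟩)) {x : Ch X} (hx : x ∈ S n W) :
    D x ∈ S m W' := by
  refine S_map D _ (fun σ hσ => ?_) hx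
  obtain ⟨f, hf, hf'⟩ := h σ hσ
  rw [← hf']
  exact cmap_mem_S f (fun y _ => hf y) hd

/-- prism operator -/
theorem exists_prism : ∃ P : ∀ (X : Type) [TopologicalSpace X], Ch X →ₗ[ℚ] Ch (X × ℝ),
    (∀ (X : Type) [TopologicalSpace X] (x : Ch X), bd (P X x) + P X (bd x) =
      cmap (iR 1) x - cmap (iR 0) x) ∧
    (∀ (X : Type) [TopologicalSpace X] (n : ℕ) (W : Set X) (x : Ch X), x ∈ S n W →
      P X x ∈ S (n+1) (W ×ˢ (Set.univ : Set ℝ))) := by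
  have hΨ : K1.Nat FR psiR := fun X Y _ _ f x => psiR_nat (f 0) x
  let h : K1.Ty → FR.C EE →ₗ[ℚ] FR.C EE := fun _ => cone (0 : EE × ℝ)
  obtain ⟨D, hD, hf⟩ := K1.exists_nat FR psiR (-1) h
  have hdeg := K1.nat_deg FR hD (-1) h hf (fun n => (Psh n : Submodule ℚ (Ch (EE × ℝ)))) 1
    (fun n f x hx => Psh_cmap _ _ _ hx) (fun n t x hx => Psh_cone _ _ _ hx) (fun t => by
      rw [K1_u]
      exact psiR_mem _ _)
  have hbd := K1.nat_bd FR hD hΨ (-1) h (fun _ => sg ⟨0, pt (EE × ℝ) 0⟩) hf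
    (fun t x => bd_cone _ x) (fun t x => aug_cone _ x) (fun x => aug_psiR x) (fun x => bd_psiR x)
  refine ⟨D, ?_, ?_⟩
  · intro X _ x
    have : bd (D X x) = psiR X x + (-1:ℚ) • D X (bd x) := hbd X x
    rw [this, neg_one_smul, neg_add_cancel_right]
    rfl
  · intro X _ n W x hx
    refine nat_supp (D := D X) (D EE (K1.u n)) (m := n+1) (hdeg n) W (W ×ˢ Set.univ) (fun σ hσ =>
      ⟨(σ.comp (ret n)).prodMap (ContinuousMap.id ℝ), fun y => ⟨hσ _, trivial⟩, ?_⟩) hx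
    refine (hD EE X (fun _ => σ.comp (ret n)) (K1.u n)).trans ?_
    rw [K1_u, sg_iot σ]

/-- homotopy invariance with control of supports -/
theorem exists_htpy {X Y : Type} [TopologicalSpace X] [TopologicalSpace Y] (H : C(X × ℝ, Y))
    (f g : C(X, Y)) (hf : ∀ x, H (x, 0) = f x) (hg : ∀ x, H (x, 1) = g x) :
    ∃ h : Ch X →ₗ[ℚ] Ch Y, (∀ x, bd (h x) + h (bd x) = cmap g x - cmap f x) ∧
      ∀ n (W : Set X) (W' : Set Y), (∀ x ∈ W, ∀ t, H (x, t) ∈ W') → ∀ x ∈ S n W,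
        h x ∈ S (n+1) W' := by
  obtain ⟨P, hP, hP'⟩ := exists_prism
  refine ⟨cmap H ∘ₗ P X, fun x => ?_, fun n W W' hW x hx => ?_⟩
  · simp only [LinearMap.comp_apply]
    rw [bd_cmap, ← map_add, hP, map_sub, cmap_cmap, cmap_cmap]
    congr 2
    · congr 1; ext x; exact hg x
    · congr 1; ext x; exact hf x
  · exact cmap_mem_S H (fun y hy => hW _ hy.1 _) (hP' X n W x hx)

noncomputable def bary {n : ℕ} {E : Type} [AddCommGroup E] [Module ℝ E] (w : Fin (n+1) → E) : E :=
  ((n:ℝ)+1)⁻¹ • ∑ i, w i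

lemma cmap_eq_self {X : Type} [TopologicalSpace X] (f : C(X, X)) {W : Set X} (hf : ∀ x ∈ W, f x = x)
    {n : ℕ} {x : Ch X} (hx : x ∈ S n W) : cmap f x = x :=
  S_congr (cmap f) LinearMap.id (fun σ h => by
    rw [cmap_sg]
    simp only [LinearMap.id_apply]
    congr 2
    ext t; exact hf _ (h t)) hx

lemma bary_mem (p : ℕ) : ∃ t : Simp p, iot p t = bary (fun i : Fin (p+1) => (Pi.single (i:ℕ) (1:ℝ) : EE)) := by
  refine ⟨⟨fun _ => ((p:ℝ)+1)⁻¹, fun _ => by positivity, ?_⟩, ?_⟩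
  · simp only [Finset.sum_const, Finset.card_univ, Fintype.card_fin, nsmul_eq_mul]
    push_cast
    rw [mul_inv_cancel₀ (by positivity)]
  · rw [iot, lin_apply, bary, Finset.smul_sum]
    rfl

lemma iot_convex (p : ℕ) : Convex ℝ (Set.range (iot p)) := by
  have : Set.range (iot p) = (Fintype.linearCombination ℝ (fun i : Fin (p+1) => (Pi.single (i:ℕ) (1:ℝ) : EE))) ''
      stdSimplex ℝ (Fin (p+1)) := by
    ext x; constructor
    · rintro ⟨t, rfl⟩; exact ⟨t.1, t.2, rfl⟩
    · rintro ⟨t, ht, rfl⟩; exact ⟨⟨t, ht⟩, rfl⟩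
  rw [this]
  exact (convex_stdSimplex ℝ _).linear_image _

noncomputable def barE (p : ℕ) : EE := bary (fun i : Fin (p+1) => (Pi.single (i:ℕ) (1:ℝ) : EE))

/-- subdivision -/
theorem exists_sd0 : ∃ sd : ∀ (X : Type) [TopologicalSpace X], Ch X →ₗ[ℚ] Ch X,
    (∀ (X Y : Type) [TopologicalSpace X] [TopologicalSpace Y] (f : C(X, Y)) (x : Ch X),
      cmap f (sd X x) = sd Y (cmap f x)) ∧
    (∀ (X : Type) [TopologicalSpace X] (x : Ch X), bd (sd X x) = sd X (bd x)) ∧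
    (∀ x : Ch EE, aug (sd EE x) = aug x) ∧
    (∀ (X : Type) [TopologicalSpace X] (n : ℕ) (W : Set X) (x : Ch X), x ∈ S n W → sd X x ∈ S n W) ∧
    (∀ (X : Type) [TopologicalSpace X] (x : Ch X), x ∈ S 0 (Set.univ : Set X) → sd X x = x) ∧
    (∀ n, sd EE (sg ⟨n+1, iot (n+1)⟩) =
      cone (barE (n+1)) (sd EE (bd (sg ⟨n+1, iot (n+1)⟩)))) := by
  have dgnat : ∀ (X Y : Type) [TopologicalSpace X] [TopologicalSpace Y] (f : C(X, Y)) (x : Ch X),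
      cmap f (dg 0 x) = dg 0 (cmap f x) := by
    intro X Y _ _ f x
    have : cmap f ∘ₗ dg 0 = dg 0 ∘ₗ cmap f := by
      apply Ch.hom_ext; rintro ⟨n, σ⟩
      simp only [LinearMap.comp_apply, dg_sg, cmap_sg]
      split_ifs <;> simp [cmap_sg]
    exact LinearMap.congr_fun this x
  have augdg : ∀ (X : Type) [TopologicalSpace X] (x : Ch X), aug (dg 0 x) = aug x := by
    intro X _ x
    have : aug ∘ₗ (dg 0 : Ch X →ₗ[ℚ] Ch X) = aug := by
      apply Ch.hom_ext; rintro ⟨n, σ⟩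
      simp only [LinearMap.comp_apply, dg_sg, aug_sg]
      split_ifs with h <;> simp [aug_sg, h]
    exact LinearMap.congr_fun this x
  have bddg : ∀ (X : Type) [TopologicalSpace X] (x : Ch X), bd (dg 0 x) = 0 :=
    fun X _ x => bd_S_zero (dg_mem 0 x)
  let Ψ : ∀ (X : Type) [TopologicalSpace X], Ch X →ₗ[ℚ] Ch X := fun X _ => dg 0 ∘ₗ bd
  have hΨ : K1.Nat F1 Ψ := fun X Y _ _ f x => by
    refine (dgnat X Y (f 0) (bd x)).trans ?_
    rw [← bd_cmap]; rfl
  let h : K1.Ty → F1.C EE →ₗ[ℚ] F1.C EE := fun p => cone (barE p)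
  obtain ⟨D, hD, hf⟩ := K1.exists_nat F1 Ψ 1 h
  have hdeg := K1.nat_deg F1 hD 1 h hf (fun n => (Psh n : Submodule ℚ (Ch EE))) 0
    (fun n f x hx => Psh_cmap _ _ _ hx) (fun n t x hx => Psh_cone _ _ _ hx) (fun t => by
      rw [K1_u]
      change dg 0 (bd (sg ⟨t, iot t⟩)) ∈ (Psh t : Submodule ℚ (Ch EE))
      rw [dg_bd, dg_sg]
      split_ifs with h
      · exact Psh_bd _ _ (sg_mem_S' ⟨t, iot t⟩)
      · rw [map_zero]; exact Submodule.zero_mem _)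
  have hbd : ∀ (X : Type) [TopologicalSpace X] (x : Ch X),
    bd (D X x) = dg 0 (bd x) + (1:ℚ) • D X (bd x) :=
    K1.nat_bd F1 hD hΨ 1 h (fun p => sg ⟨0, pt EE (barE p)⟩) hf
    (fun t x => bd_cone _ x) (fun t x => aug_cone _ x)
    (fun x => (augdg EE (bd x)).trans (aug_bd x)) (fun x => by
      change bd (dg 0 (bd x)) + (1:ℚ) • dg 0 (bd (bd x)) = 0
      rw [bddg, bd_bd]; simp)
  let sd : ∀ (X : Type) [TopologicalSpace X], Ch X →ₗ[ℚ] Ch X := fun X _ => dg 0 + D X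
  have hsd : ∀ (X : Type) [TopologicalSpace X] (x : Ch X), sd X x = dg 0 x + D X x := fun _ _ _ => rfl
  have sdnat : ∀ (X Y : Type) [TopologicalSpace X] [TopologicalSpace Y] (f : C(X, Y)) (x : Ch X),
      cmap f (sd X x) = sd Y (cmap f x) := by
    intro X Y _ _ f x
    have : cmap f (D X x) = D Y (cmap f x) := hD X Y (fun _ => f) x
    rw [hsd, hsd, map_add, dgnat, this]
  have sdbd : ∀ (X : Type) [TopologicalSpace X] (x : Ch X), bd (sd X x) = sd X (bd x) := by
    intro X _ x
    rw [hsd, hsd, map_add, bddg, hbd, zero_add, one_smul]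
  have Dfor : ∀ p, D EE (sg ⟨p, iot p⟩) =
      cmap ((iot p).comp (ret p)) (cone (barE p) (sd EE (bd (sg ⟨p, iot p⟩)))) := by
    intro p
    have := hf p
    rw [K1_u, one_smul] at this
    exact this
  have D0 : D EE (sg ⟨0, iot 0⟩) = 0 := by
    rw [Dfor, bd_zero, map_zero, map_zero, map_zero]
  have sdu : ∀ p, sd EE (sg ⟨p, iot p⟩) ∈ S p (Set.univ : Set EE) := by
    intro p
    rw [hsd]
    refine Submodule.add_mem _ ?_ ?_
    · rw [dg_sg]; split_ifs with h
      · exact sg_mem_S' ⟨p, iot p⟩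
      · exact Submodule.zero_mem _
    · have := hdeg p
      rw [K1_u] at this
      exact this
  have sdS : ∀ (X : Type) [TopologicalSpace X] (n : ℕ) (W : Set X) (x : Ch X), x ∈ S n W →
      sd X x ∈ S n W := fun X _ n W x hx =>
    nat_supp (D := sd X) _ (sdu n) W W (fun σ hσ => ⟨σ.comp (ret n), fun y => hσ _, by
      rw [sdnat, ← sg_iot]⟩) hx
  have sd0 : ∀ (X : Type) [TopologicalSpace X] (x : Ch X), x ∈ S 0 (Set.univ : Set X) → sd X x = x := by
    intro X _ x hx
    refine S_congr (sd X) LinearMap.id (fun σ _ => ?_) hx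
    rw [sg_iot σ, ← sdnat]
    rw [hsd, D0, dg_sg]; simp
  have sdfor : ∀ n, sd EE (sg ⟨n+1, iot (n+1)⟩) =
      cone (barE (n+1)) (sd EE (bd (sg ⟨n+1, iot (n+1)⟩))) := by
    intro n
    have h1 : sd EE (sg ⟨n+1, iot (n+1)⟩) = D EE (sg ⟨n+1, iot (n+1)⟩) := by
      rw [hsd, dg_sg]; simp
    rw [h1, Dfor]
    have hs : sg ⟨n+1, iot (n+1)⟩ ∈ S (n+1) (Set.range (iot (n+1))) := sg_mem_S _ fun t => ⟨t, rfl⟩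
    refine cmap_eq_self (W := Set.range (iot (n+1))) _ ?_
      (cone_mem_S ?_ (sdS _ _ _ _ (bd_mem_S hs)))
    · rintro _ ⟨t, rfl⟩
      exact congrArg (iot (n+1)) (DFunLike.congr_fun (ret_iot (n+1)) t)
    · exact (iot_convex (n+1)).starConvex (bary_mem (n+1))
  have augsd : ∀ x : Ch EE, aug (sd EE x) = aug x := by
    intro x
    have : aug ∘ₗ sd EE = aug := by
      apply Ch.hom_ext; rintro ⟨n, σ⟩
      rw [LinearMap.comp_apply, sg_iot, ← sdnat, aug_cmap, aug_cmap]
      rw [hsd, map_add, augdg, Dfor, aug_cmap, aug_cone, add_zero]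
    exact LinearMap.congr_fun this x
  exact ⟨sd, sdnat, sdbd, augsd, sdS, sd0, sdfor⟩

/-- subdivision -/
theorem exists_sd : ∃ sd T : ∀ (X : Type) [TopologicalSpace X], Ch X →ₗ[ℚ] Ch X,
    (∀ (X Y : Type) [TopologicalSpace X] [TopologicalSpace Y] (f : C(X, Y)) (x : Ch X),
      cmap f (sd X x) = sd Y (cmap f x)) ∧
    (∀ (X : Type) [TopologicalSpace X] (x : Ch X), bd (sd X x) = sd X (bd x)) ∧
    (∀ (X : Type) [TopologicalSpace X] (x : Ch X), bd (T X x) + T X (bd x) = x - sd X x) ∧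
    (∀ (X : Type) [TopologicalSpace X] (n : ℕ) (W : Set X) (x : Ch X), x ∈ S n W → sd X x ∈ S n W) ∧
    (∀ (X : Type) [TopologicalSpace X] (n : ℕ) (W : Set X) (x : Ch X), x ∈ S n W →
      T X x ∈ S (n+1) W) ∧
    (∀ (X : Type) [TopologicalSpace X] (x : Ch X), x ∈ S 0 (Set.univ : Set X) → sd X x = x) ∧
    (∀ n, sd EE (sg ⟨n+1, iot (n+1)⟩) =
      cone (barE (n+1)) (sd EE (bd (sg ⟨n+1, iot (n+1)⟩)))) := by
  obtain ⟨sd, sdnat, sdbd, augsd, sdS, sd0, sdfor⟩ := exists_sd0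
  let h : K1.Ty → F1.C EE →ₗ[ℚ] F1.C EE := fun p => cone (barE p)
  have sdu : ∀ p, sd EE (sg ⟨p, iot p⟩) ∈ S p (Set.univ : Set EE) := fun p => sdS _ _ _ _ (sg_mem_S' ⟨p, iot p⟩)
  -- the homotopy
  let Φ : ∀ (X : Type) [TopologicalSpace X], Ch X →ₗ[ℚ] Ch X := fun X _ => LinearMap.id - sd X
  have hΦ : K1.Nat F1 Φ := fun X Y _ _ f x => by
    change cmap (f 0) (x - sd X x) = cmap (f 0) x - sd Y (cmap (f 0) x)
    rw [map_sub, sdnat]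
  obtain ⟨T, hT, hTf⟩ := K1.exists_nat F1 Φ (-1) h
  have hTdeg := K1.nat_deg F1 hT (-1) h hTf (fun n => (Psh n : Submodule ℚ (Ch EE))) 1
    (fun n f x hx => Psh_cmap _ _ _ hx) (fun n t x hx => Psh_cone _ _ _ hx) (fun t => by
      rw [K1_u]
      exact Submodule.sub_mem (S t (Set.univ : Set EE)) (sg_mem_S' ⟨t, iot t⟩) (sdu t))
  have hTbd : ∀ (X : Type) [TopologicalSpace X] (x : Ch X),
    bd (T X x) = (x - sd X x) + (-1:ℚ) • T X (bd x) :=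
    K1.nat_bd F1 hT hΦ (-1) h (fun p => sg ⟨0, pt EE (barE p)⟩) hTf
    (fun t x => bd_cone _ x) (fun t x => aug_cone _ x)
    (fun x => by
      change aug ((x : Ch EE) - sd EE x) = 0
      rw [map_sub, augsd, sub_self]) (fun x => by
      change bd ((x : Ch EE) - sd EE x) + (-1:ℚ) • (bd x - sd EE (bd x)) = 0
      rw [map_sub, sdbd]; simp)
  refine ⟨sd, T, sdnat, sdbd, fun X _ x => ?_, sdS, ?_, sd0, sdfor⟩
  · rw [hTbd]; simp
  · intro X _ n W x hx
    have h1 := hTdeg n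
    rw [K1_u] at h1
    exact nat_supp (D := T X) _ h1 W W (fun σ hσ => ⟨σ.comp (ret n), fun y => hσ _, by
      refine (hT EE X (fun _ => σ.comp (ret n)) _).trans ?_
      rw [sg_iot σ]⟩) hx
end BCT

namespace BCT
open Topology Filter
set_option linter.unusedVariables false
set_option linter.unusedSimpArgs false
set_option linter.unusedSectionVars false

section small
variable {N : Type} [NormedAddCommGroup N] [NormedSpace ℝ N]

/-- the linear map sending the standard vertices to `w` -/
noncomputable def linE {n : ℕ} (w : Fin (n+1) → N) : C(EE, N) where
  toFun x := ∑ i : Fin (n+1), x i • w i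
  continuous_toFun := by fun_prop

lemma linE_iot {n : ℕ} (w : Fin (n+1) → N) : (linE w).comp (iot n) = lin w := by
  ext t
  change ∑ i : Fin (n+1), iot n t i • w i = _
  simp only [iot_apply]
  rfl

lemma cone_linE {n : ℕ} (w : Fin (n+1) → N) (b : EE) (x : Ch EE) :
    cmap (linE w) (cone b x) = cone (linE w b) (cmap (linE w) x) := by
  have : cmap (linE w) ∘ₗ cone b = cone (linE w b) ∘ₗ cmap (linE w) := by
    apply Ch.hom_ext
    rintro ⟨p, σ⟩
    simp only [LinearMap.comp_apply, cone_sg, cmap_sg]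
    congr 2
    ext t
    simp only [coneS, linE, ContinuousMap.comp_apply, ContinuousMap.coe_mk, Pi.add_apply, Pi.smul_apply,
      smul_eq_mul, add_smul, mul_smul, Finset.sum_add_distrib, Finset.smul_sum]
  exact LinearMap.congr_fun this x

lemma linE_barE {n : ℕ} (w : Fin (n+1) → N) : linE w (barE n) = bary w := by
  simp only [linE, barE, bary, ContinuousMap.coe_mk, Pi.smul_apply, smul_eq_mul, mul_smul, Finset.smul_sum]
  refine Finset.sum_congr rfl fun i _ => ?_
  rw [Finset.sum_apply, Finset.sum_eq_single i]
  · simp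
  · intro b _ hb
    simp [Pi.single_apply, Fin.val_inj, hb.symm]
  · simp

/-- small linear chains -/
noncomputable def Lc (n : ℕ) (δ : ℝ) (K : Set N) : Submodule ℚ (Ch N) :=
  Submodule.span ℚ {x | ∃ w : Fin (n+1) → N, (∀ i, w i ∈ K) ∧ (∀ i j, ‖w i - w j‖ ≤ δ) ∧
    x = sg ⟨n, lin w⟩}

lemma bary_mem_hull {n : ℕ} (w : Fin (n+1) → N) : bary w ∈ convexHull ℝ (Set.range w) := by
  rw [bary, Finset.smul_sum]
  refine (convex_convexHull ℝ _).sum_mem (fun i _ => by positivity) ?_ (fun i _ => subset_convexHull ℝ _ ⟨i, rfl⟩)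
  simp only [Finset.sum_const, Finset.card_univ, Fintype.card_fin, nsmul_eq_mul]
  push_cast
  rw [mul_inv_cancel₀ (by positivity)]

lemma bary_dist {n : ℕ} (w : Fin (n+1) → N) {δ : ℝ} (h : ∀ i j, ‖w i - w j‖ ≤ δ) {v : N}
    (hv : v ∈ convexHull ℝ (Set.range w)) : ‖v - bary w‖ ≤ n / (n+1) * δ := by
  have hc : Convex ℝ (Metric.closedBall (bary w) (n / (n+1) * δ)) := convex_closedBall _ _
  have : convexHull ℝ (Set.range w) ⊆ Metric.closedBall (bary w) (n / (n+1) * δ) := by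
    refine convexHull_min ?_ hc
    rintro _ ⟨i, rfl⟩
    rw [Metric.mem_closedBall, dist_eq_norm]
    have h1 : w i - bary w = ((n:ℝ)+1)⁻¹ • ∑ j ∈ Finset.univ.erase i, (w i - w j) := by
      have h2 : ∑ j ∈ Finset.univ.erase i, (w i - w j) = ∑ j, (w i - w j) := by
        rw [← Finset.add_sum_erase _ _ (Finset.mem_univ i)]; simp
      rw [h2, Finset.sum_sub_distrib, bary, smul_sub]
      simp only [Finset.sum_const, Finset.card_univ, Fintype.card_fin]
      rw [← Nat.cast_smul_eq_nsmul ℝ, smul_smul]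
      push_cast
      rw [inv_mul_cancel₀ (by positivity), one_smul]
    rw [h1, norm_smul, norm_inv, Real.norm_of_nonneg (by positivity)]
    have h3 : ‖∑ j ∈ Finset.univ.erase i, (w i - w j)‖ ≤ n * δ := by
      refine (norm_sum_le_of_le _ (fun j _ => h i j)).trans ?_
      simp
    rw [div_mul_eq_mul_div, div_eq_inv_mul]
    gcongr
  simpa [dist_eq_norm] using this hv

variable {sd : ∀ (X : Type) [TopologicalSpace X], Ch X →ₗ[ℚ] Ch X}
    (sdnat : ∀ (X Y : Type) [TopologicalSpace X] [TopologicalSpace Y] (f : C(X, Y)) (x : Ch X),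
      cmap f (sd X x) = sd Y (cmap f x))
    (sd0 : ∀ (X : Type) [TopologicalSpace X] (x : Ch X), x ∈ S 0 (Set.univ : Set X) → sd X x = x)
    (sdfor : ∀ n, sd EE (sg ⟨n+1, iot (n+1)⟩) =
      cone (barE (n+1)) (sd EE (bd (sg ⟨n+1, iot (n+1)⟩))))
include sdnat sd0 sdfor

lemma sd_lin {n : ℕ} (w : Fin (n+2) → N) : sd N (sg ⟨n+1, lin w⟩) =
    cone (bary w) (sd N (bd (sg ⟨n+1, lin w⟩))) := by
  have h : sg ⟨n+1, lin w⟩ = cmap (linE w) (sg ⟨n+1, iot (n+1)⟩) := by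
    rw [cmap_sg]; simp only [linE_iot]
  rw [h, ← sdnat, sdfor, cone_linE, linE_barE, sdnat, bd_cmap]

lemma sd_small (n : ℕ) : ∀ (w : Fin (n+1) → N) (δ : ℝ), (∀ i j, ‖w i - w j‖ ≤ δ) →
    sd N (sg ⟨n, lin w⟩) ∈ Lc n (n / (n+1) * δ) (convexHull ℝ (Set.range w)) := by
  induction n with
  | zero =>
    intro w δ h
    rw [sd0 _ _ (sg_mem_S' ⟨0, lin w⟩)]
    refine Submodule.subset_span ⟨w, fun i => subset_convexHull ℝ _ ⟨i, rfl⟩, fun i j => ?_, rfl⟩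
    rw [Fin.fin_one_eq_zero i, Fin.fin_one_eq_zero j]; simp
  | succ n ih =>
    intro w δ h
    have hδ : 0 ≤ δ := (norm_nonneg _).trans (h 0 0)
    rw [sd_lin sdnat sd0 sdfor]
    have h1 : sd N (bd (sg ⟨n+1, lin w⟩)) ∈ Lc n (n/(n+1) * δ) (convexHull ℝ (Set.range w)) := by
      rw [bd_succ, map_sum]
      refine Submodule.sum_mem _ fun i _ => ?_
      rw [map_smul]
      refine Submodule.smul_mem _ _ ?_
      rw [lin_face]
      refine (Submodule.span_mono ?_) (ih (fun j => w (i.succAbove j)) δ (fun a b => h _ _))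
      rintro x ⟨v, hv, hv2, rfl⟩
      refine ⟨v, fun j => convexHull_mono ?_ (hv j), hv2, rfl⟩
      rintro _ ⟨j, rfl⟩; exact ⟨_, rfl⟩
    have h2 : Lc n (n/(n+1) * δ) (convexHull ℝ (Set.range w)) ≤
        (Lc (n+1) ((n+1 : ℕ) / ((n+1:ℕ)+1) * δ) (convexHull ℝ (Set.range w))).comap (cone (bary w)) := by
      refine Submodule.span_le.2 ?_
      rintro x ⟨v, hv, hv2, rfl⟩
      rw [SetLike.mem_coe, Submodule.mem_comap]
      rw [cone_sg]
      simp only [coneS_lin]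
      have hd : ∀ j, ‖v j - bary w‖ ≤ (n+1 : ℕ) / ((n+1:ℕ)+1) * δ := fun j => bary_dist w h (hv j)
      have hnn : (n:ℝ)/(n+1) * δ ≤ (n+1 : ℕ) / ((n+1:ℕ)+1) * δ := by
        refine mul_le_mul_of_nonneg_right ?_ hδ
        push_cast
        rw [div_le_div_iff₀ (by positivity) (by positivity)]
        nlinarith
      refine Submodule.subset_span ⟨_, ?_, ?_, rfl⟩
      · intro i
        refine Fin.cases ?_ (fun j => ?_) i
        · exact bary_mem_hull w
        · exact hv j
      · intro i j
        refine Fin.cases ?_ (fun i => ?_) i <;> refine Fin.cases ?_ (fun j => ?_) j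
        · simp; positivity
        · rw [norm_sub_rev]; exact hd j
        · exact hd i
        · exact (hv2 i j).trans hnn
    exact h2 h1

lemma sd_Lc (n : ℕ) (δ : ℝ) {K : Set N} (hK : Convex ℝ K) {x : Ch N} (hx : x ∈ Lc n δ K) :
    sd N x ∈ Lc n (n/(n+1)*δ) K := by
  have : Lc n δ K ≤ (Lc n (n/(n+1)*δ) K).comap (sd N) := by
    refine Submodule.span_le.2 ?_
    rintro x ⟨v, hv, hv2, rfl⟩
    refine (Submodule.span_mono ?_) (sd_small sdnat sd0 sdfor n v δ hv2)
    rintro x ⟨v', hv', hv2', rfl⟩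
    refine ⟨v', fun j => convexHull_min ?_ hK (hv' j), hv2', rfl⟩
    rintro _ ⟨j, rfl⟩; exact hv j
  exact this hx

lemma sd_iter_Lc (n : ℕ) (δ : ℝ) {K : Set N} (hK : Convex ℝ K) {x : Ch N} (hx : x ∈ Lc n δ K) (m : ℕ) :
    (sd N ^ m) x ∈ Lc n ((n/(n+1))^m*δ) K := by
  induction m with
  | zero => simpa using hx
  | succ m ih =>
    rw [pow_succ', pow_succ', mul_assoc]
    exact sd_Lc sdnat sd0 sdfor _ _ hK ih

omit sd0 sdfor in
lemma sd_iter_nat {X Y : Type} [TopologicalSpace X] [TopologicalSpace Y] (f : C(X, Y)) (m : ℕ) (x : Ch X) :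
    cmap f ((sd X ^ m) x) = (sd Y ^ m) (cmap f x) := by
  induction m with
  | zero => rfl
  | succ m ih =>
    rw [pow_succ', pow_succ', Module.End.mul_apply, Module.End.mul_apply, sdnat, ih]

/-- a single simplex becomes small -/
lemma sd_simplex {X : Type} [TopologicalSpace X] {A B : Set X} (hA : IsOpen A) (hB : IsOpen B)
    (n : ℕ) (σ : C(Simp n, X)) (hσ : ∀ t, σ t ∈ A ∪ B) :
    ∃ m, (sd X ^ m) (sg ⟨n, σ⟩) ∈ S n A ⊔ S n B := by
  let e : C(Fin (n+1) → ℝ, EE) := ⟨fun x j => if h : j < n+1 then x ⟨j, h⟩ else 0, by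
    refine continuous_pi fun j => ?_
    by_cases h : j < n+1 <;> simp only [h, dif_pos, dif_neg, not_false_eq_true] <;> fun_prop⟩
  let g : C(Fin (n+1) → ℝ, X) := (σ.comp (ret n)).comp e
  let w : Fin (n+1) → (Fin (n+1) → ℝ) := fun i => Pi.single i 1
  have hw : ∀ t : Simp n, e (lin w t) = iot n t := by
    intro t
    ext j
    have h1 : ∀ i : Fin (n+1), lin w t i = t i := by
      intro i
      rw [lin_apply, Finset.sum_apply, Finset.sum_eq_single i]
      · simp [w]
      · intro b _ hb
        simp [w, Pi.single_apply, hb.symm]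
      · simp
    by_cases h : j < n+1
    · change (if h : j < n+1 then lin w t ⟨j, h⟩ else 0) = _
      rw [dif_pos h, h1]
      exact (iot_apply n t ⟨j, h⟩).symm
    · change (if h : j < n+1 then lin w t ⟨j, h⟩ else 0) = _
      rw [dif_neg h, iot, lin_apply, Finset.sum_apply]
      refine (Finset.sum_eq_zero fun i _ => ?_).symm
      have : j ≠ i := by omega
      simp [Pi.single_apply, this]
  have hg : g.comp (lin w) = σ := by
    ext t
    change σ (ret n (e (lin w t))) = σ t
    rw [hw]
    exact congrArg σ (DFunLike.congr_fun (ret_iot n) t)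
  have hs : sg ⟨n, σ⟩ = cmap g (sg ⟨n, lin w⟩) := by rw [cmap_sg]; simp only [hg]
  have hgAB : ∀ x, g x ∈ A ∪ B := fun x => hσ _
  set K := convexHull ℝ (Set.range w) with hK
  have hKc : IsCompact K := (Set.finite_range w).isCompact_convexHull ℝ
  obtain ⟨δ, hδ, hL⟩ := lebesgue_number_lemma_of_metric (ι := Bool) (c := fun b => if b then g ⁻¹' A else g ⁻¹' B)
    hKc (by
      intro b; cases b
      · exact hB.preimage g.continuous
      · exact hA.preimage g.continuous) (by
      intro x _
      rcases hgAB x with h | h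
      · exact Set.mem_iUnion.2 ⟨true, h⟩
      · exact Set.mem_iUnion.2 ⟨false, h⟩)
  obtain ⟨D, hD⟩ : ∃ D : ℝ, ∀ i j, ‖w i - w j‖ ≤ D := by
    refine ⟨∑ i, ∑ j, ‖w i - w j‖, fun i j => ?_⟩
    refine le_trans ?_ (Finset.single_le_sum (f := fun i => ∑ j, ‖w i - w j‖) (fun i _ => by positivity) (Finset.mem_univ i))
    exact Finset.single_le_sum (f := fun j => ‖w i - w j‖) (fun i _ => by positivity) (Finset.mem_univ j)
  have hD0 : 0 ≤ D := (norm_nonneg _).trans (hD 0 0)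
  obtain ⟨m, hm⟩ : ∃ m : ℕ, ((n:ℝ)/(n+1))^m * D < δ := by
    have : Tendsto (fun m : ℕ => ((n:ℝ)/(n+1))^m * D) atTop (𝓝 (0 * D)) :=
      (tendsto_pow_atTop_nhds_zero_of_lt_one (by positivity) (by
        rw [div_lt_one (by positivity)]; linarith)).mul_const _
    rw [zero_mul] at this
    exact (this.eventually (gt_mem_nhds hδ)).exists
  refine ⟨m, ?_⟩
  rw [hs, ← sd_iter_nat sdnat]
  have h1 : (sd (Fin (n+1) → ℝ) ^ m) (sg ⟨n, lin w⟩) ∈ Lc n (((n:ℝ)/(n+1))^m * D) K :=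
    sd_iter_Lc sdnat sd0 sdfor n D (convex_convexHull ℝ _)
      (Submodule.subset_span (s := {x | ∃ w : Fin (n+1) → (Fin (n+1) → ℝ), (∀ i, w i ∈ K) ∧ (∀ i j, ‖w i - w j‖ ≤ D) ∧ x = sg ⟨n, lin w⟩}) ⟨w, fun i => subset_convexHull ℝ _ ⟨i, rfl⟩, hD, rfl⟩) m
  have h2 : Lc n (((n:ℝ)/(n+1))^m * D) K ≤ (S n A ⊔ S n B).comap (cmap g) := by
    refine Submodule.span_le.2 ?_
    rintro x ⟨v, hv, hv2, rfl⟩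
    rw [SetLike.mem_coe, Submodule.mem_comap, cmap_sg]
    have hb : ∀ t, lin v t ∈ Metric.ball (v 0) δ := by
      intro t
      rw [lin_apply]
      refine (convex_ball _ _).sum_mem (fun i _ => stdSimplex.zero_le t i) (stdSimplex.sum_eq_one t) (fun i _ => ?_)
      rw [Metric.mem_ball, dist_eq_norm]
      exact (hv2 i 0).trans_lt hm
    obtain ⟨b, hb'⟩ := hL (v 0) (hv 0)
    cases b
    · exact Submodule.mem_sup_right (sg_mem_S _ fun t => hb' (hb t))
    · exact Submodule.mem_sup_left (sg_mem_S _ fun t => hb' (hb t))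
  exact h2 h1
end small

theorem exists_subdiv (X : Type) [TopologicalSpace X] : ∃ s T : ℕ → Ch X →ₗ[ℚ] Ch X,
    (∀ m x, bd (s m x) = s m (bd x)) ∧ (∀ m x, bd (T m x) + T m (bd x) = x - s m x) ∧
    (∀ m n W x, x ∈ S n W → s m x ∈ S n W) ∧ (∀ m n W x, x ∈ S n W → T m x ∈ S (n+1) W) ∧
    (∀ m x, x ∈ S 0 (Set.univ : Set X) → s m x = x) ∧
    ∀ n (A B : Set X), IsOpen A → IsOpen B → ∀ z ∈ S n (A ∪ B), ∃ m0, ∀ m ≥ m0, s m z ∈ S n A ⊔ S n B := by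
  obtain ⟨sd, T, sdnat, sdbd, hT, sdS, TS, sd0, sdfor⟩ := exists_sd
  have hS : ∀ m n W x, x ∈ S n W → (sd X ^ m) x ∈ S n W := by
    intro m n W x hx
    induction m with
    | zero => exact hx
    | succ m ih => rw [pow_succ']; exact sdS _ _ _ _ ih
  have hbd : ∀ m x, bd ((sd X ^ m) x) = (sd X ^ m) (bd x) := by
    intro m x
    induction m with
    | zero => rfl
    | succ m ih => rw [pow_succ', Module.End.mul_apply, Module.End.mul_apply, sdbd, ih]
  refine ⟨fun m => sd X ^ m, fun m => ∑ i ∈ Finset.range m, T X ∘ₗ (sd X ^ i), hbd, ?_, hS, ?_, ?_, ?_⟩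
  · intro m x
    simp only [LinearMap.sum_apply, LinearMap.comp_apply, map_sum]
    rw [← Finset.sum_add_distrib]
    have : ∀ i, bd (T X ((sd X ^ i) x)) + T X ((sd X ^ i) (bd x)) = (sd X ^ i) x - (sd X ^ (i+1)) x := by
      intro i
      rw [← hbd, hT, pow_succ']; rfl
    simp only [this]
    rw [Finset.sum_range_sub']
    rfl
  · intro m n W x hx
    simp only [LinearMap.sum_apply, LinearMap.comp_apply]
    exact Submodule.sum_mem _ fun i _ => TS _ _ _ _ (hS _ _ _ _ hx)
  · intro m x hx
    induction m with
    | zero => rfl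
    | succ m ih => simp only at ih ⊢; rw [pow_succ', Module.End.mul_apply, ih, sd0 _ _ hx]
  · intro n A B hA hB z hz
    have mono : ∀ z m0, (sd X ^ m0) z ∈ S n A ⊔ S n B → ∀ m ≥ m0, (sd X ^ m) z ∈ S n A ⊔ S n B := by
      intro z m0 h m hm
      obtain ⟨j, rfl⟩ := Nat.exists_eq_add_of_le hm
      rw [add_comm, pow_add, Module.End.mul_apply]
      obtain ⟨a, ha, b, hb, hab⟩ := Submodule.mem_sup.1 h
      rw [← hab, map_add]
      exact Submodule.add_mem_sup (hS _ _ _ _ ha) (hS _ _ _ _ hb)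
    rw [S_eq_span] at hz
    induction hz using Submodule.span_induction with
    | mem x hx =>
      obtain ⟨σ, hσ, rfl⟩ := hx
      obtain ⟨m, hm⟩ := sd_simplex sdnat sd0 sdfor hA hB n σ hσ
      exact ⟨m, mono _ _ hm⟩
    | zero => exact ⟨0, fun m _ => by simp⟩
    | add x y _ _ hx hy =>
      obtain ⟨m1, h1⟩ := hx
      obtain ⟨m2, h2⟩ := hy
      refine ⟨max m1 m2, fun m hm => ?_⟩
      rw [map_add]
      exact Submodule.add_mem _ (h1 m (le_of_max_le_left hm)) (h2 m (le_of_max_le_right hm))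
    | smul a x _ hx =>
      obtain ⟨m1, h1⟩ := hx
      refine ⟨m1, fun m hm => ?_⟩
      rw [map_smul]
      exact Submodule.smul_mem _ _ (h1 m hm)
end BCT

namespace BCT
open Topology Filter
set_option linter.unusedVariables false
set_option linter.unusedSimpArgs false
set_option linter.unusedSectionVars false

variable {X : Type} [TopologicalSpace X]

/-- chains of degree `n - 1` in `W` -/
noncomputable def Sd (n : ℕ) (W : Set X) : Submodule ℚ (Ch X) :=
  match n with
  | 0 => ⊥
  | n+1 => S n W

lemma Sd_succ (n : ℕ) (W : Set X) : Sd (n+1) W = S n W := rfl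
lemma Sd_zero (W : Set X) : Sd 0 W = ⊥ := rfl

lemma bd_mem_Sd {n : ℕ} {W : Set X} {x : Ch X} (hx : x ∈ S n W) : bd x ∈ Sd n W := by
  cases n with
  | zero => rw [Sd_zero, bd_S_zero hx]; exact Submodule.zero_mem _
  | succ n => exact bd_mem_S hx

lemma Sd_mono {n : ℕ} {W W' : Set X} (h : W ⊆ W') : Sd n W ≤ Sd n W' := by
  cases n with
  | zero => exact le_rfl
  | succ n => exact S_mono h

lemma Sd_inter {n : ℕ} {W W' : Set X} {x : Ch X} (h : x ∈ Sd n W) (h' : x ∈ Sd n W') :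
    x ∈ Sd n (W ∩ W') := by
  cases n with
  | zero => exact h
  | succ n => exact S_inter h h'

lemma Sd_map {Y : Type} [TopologicalSpace Y] {n : ℕ} {W : Set X} {W' : Set Y} (f : Ch X →ₗ[ℚ] Ch Y) (hf : ∀ n x, x ∈ S n W → f x ∈ S n W')
    {x : Ch X} (hx : x ∈ Sd n W) : f x ∈ Sd n W' := by
  cases n with
  | zero => rw [Sd_zero, Submodule.mem_bot] at *; rw [hx, map_zero]
  | succ n => exact hf n x hx

lemma Sd_map_up {Y : Type} [TopologicalSpace Y] {n : ℕ} {W : Set X} {W' : Set Y} (f : Ch X →ₗ[ℚ] Ch Y) (hf : ∀ n x, x ∈ S n W → f x ∈ S (n+1) W')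
    {x : Ch X} (hx : x ∈ Sd n W) : f x ∈ S n W' := by
  cases n with
  | zero => rw [Sd_zero, Submodule.mem_bot] at hx; rw [hx, map_zero]; exact Submodule.zero_mem _
  | succ n => exact hf n x hx

/-- averaging operator data -/
structure NData (X : Type) [TopologicalSpace X] where
  N : Ch X →ₗ[ℚ] Ch X
  c : ℚ
  hc : c ≠ 0
  Inv : Set X → Prop
  NN : ∀ x, N (N x) = c • N x
  Nbd : ∀ x, bd (N x) = N (bd x)
  NS : ∀ n W, Inv W → ∀ x ∈ S n W, N x ∈ S n W
  inter : ∀ A B, Inv A → Inv B → Inv (A ∩ B)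
  union : ∀ A B, Inv A → Inv B → Inv (A ∪ B)
  empty : Inv ∅

namespace NData
variable (𝒩 : NData X)

/-- relative averaged cycles can be pushed into `F` -/
def P (F : Set X) (n : ℕ) (W : Set X) : Prop :=
  ∀ z ∈ S n W, bd z ∈ Sd n (W ∩ F) → ∃ b ∈ S (n+1) W, 𝒩.N z - bd b ∈ S n (W ∩ F)

lemma P_union {F : Set X} (hF : IsOpen F) (iF : 𝒩.Inv F) {A B : Set X} (hA : IsOpen A) (hB : IsOpen B)
    (iA : 𝒩.Inv A) (iB : 𝒩.Inv B) (n : ℕ) (pA : 𝒩.P F n A) (pB : 𝒩.P F n B)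
    (pAB : ∀ m, m < n → 𝒩.P F m (A ∩ B)) : 𝒩.P F n (A ∪ B) := by
  intro z hz hbz
  obtain ⟨s, T, sbd, hT, sS, TS, s0, hsm⟩ := exists_subdiv X
  -- decompose
  obtain ⟨m, hm1, hm2⟩ : ∃ m, s m z ∈ S n A ⊔ S n B ∧ s m (bd z) ∈ Sd n (A ∩ F) ⊔ Sd n (B ∩ F) := by
    obtain ⟨m1, h1⟩ := hsm n A B hA hB z hz
    cases n with
    | zero =>
      refine ⟨m1, h1 m1 le_rfl, ?_⟩
      rw [Sd_zero, Submodule.mem_bot] at hbz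
      rw [hbz, map_zero]; exact Submodule.zero_mem _
    | succ n =>
      rw [Set.union_inter_distrib_right] at hbz
      obtain ⟨m2, h2⟩ := hsm n (A ∩ F) (B ∩ F) (hA.inter hF) (hB.inter hF) _ hbz
      exact ⟨max m1 m2, h1 _ (le_max_left _ _), h2 _ (le_max_right _ _)⟩
  obtain ⟨a, ha, b, hb, hab⟩ := Submodule.mem_sup.1 hm1
  obtain ⟨fA, hfA, fB, hfB, hfab⟩ := Submodule.mem_sup.1 hm2
  have hsum : bd a + bd b = fA + fB := by rw [← map_add, hab, hfab, sbd]
  have hc : bd a - fA = fB - bd b := by rw [sub_eq_sub_iff_add_eq_add, hsum, add_comm]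
  have hcA : bd a - fA ∈ Sd n A :=
    Submodule.sub_mem _ (bd_mem_Sd ha) (Sd_mono Set.inter_subset_left hfA)
  have hcB : bd a - fA ∈ Sd n B := by
    rw [hc]
    exact Submodule.sub_mem _ (Sd_mono Set.inter_subset_left hfB) (bd_mem_Sd hb)
  have hcAB := Sd_inter hcA hcB
  obtain ⟨e, he, hf⟩ : ∃ e ∈ S n (A ∩ B), 𝒩.N (bd a - fA) - bd e ∈ Sd n (A ∩ B ∩ F) := by
    cases n with
    | zero =>
      refine ⟨0, Submodule.zero_mem _, ?_⟩
      rw [Sd_zero, Submodule.mem_bot] at *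
      rw [hcA]; simp
    | succ n =>
      refine pAB n (Nat.lt_succ_self n) _ hcAB ?_
      have h1 : bd (bd a - fA) ∈ Sd n (A ∩ F) := by
        rw [map_sub, bd_bd, zero_sub]; exact Submodule.neg_mem _ (bd_mem_Sd hfA)
      have h2 : bd (bd a - fA) ∈ Sd n (B ∩ F) := by
        rw [hc, map_sub, bd_bd, sub_zero]; exact bd_mem_Sd hfB
      refine Sd_mono ?_ (Sd_inter h1 h2)
      rintro x ⟨⟨h1, h2⟩, ⟨h3, h4⟩⟩; exact ⟨⟨h1, h3⟩, h2⟩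
  have iAF := 𝒩.inter _ _ iA iF
  have iBF := 𝒩.inter _ _ iB iF
  obtain ⟨b1, hb1, hb1'⟩ := pA (𝒩.N a - e) (Submodule.sub_mem _ (𝒩.NS _ _ iA _ ha)
    (S_mono Set.inter_subset_left he)) (by
    have : bd (𝒩.N a - e) = (𝒩.N (bd a - fA) - bd e) + 𝒩.N fA := by
      simp only [map_sub, 𝒩.Nbd]; abel
    rw [this]
    refine Submodule.add_mem _ (Sd_mono ?_ hf) (Sd_map _ (fun n x hx => 𝒩.NS n _ iAF x hx) hfA)
    rintro x ⟨⟨h1, h2⟩, h3⟩; exact ⟨h1, h3⟩)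
  obtain ⟨b2, hb2, hb2'⟩ := pB (𝒩.N b + e) (Submodule.add_mem _ (𝒩.NS _ _ iB _ hb)
    (S_mono Set.inter_subset_right he)) (by
    have : bd (𝒩.N b + e) = - (𝒩.N (bd a - fA) - bd e) + 𝒩.N fB := by
      rw [hc]
      simp only [map_sub, map_add, 𝒩.Nbd]; abel
    rw [this]
    refine Submodule.add_mem _ (Submodule.neg_mem _ (Sd_mono ?_ hf)) (Sd_map _ (fun n x hx => 𝒩.NS n _ iBF x hx) hfB)
    rintro x ⟨⟨h1, h2⟩, h3⟩; exact ⟨h2, h3⟩)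
  have iU := 𝒩.union _ _ iA iB
  have iUF := 𝒩.inter _ _ iU iF
  refine ⟨𝒩.N (T m z) + 𝒩.c⁻¹ • (b1 + b2), Submodule.add_mem _ (𝒩.NS _ _ iU _ (TS _ _ _ _ hz))
    (Submodule.smul_mem _ _ (Submodule.add_mem _ (S_mono Set.subset_union_left hb1)
      (S_mono Set.subset_union_right hb2))), ?_⟩
  have hz' : 𝒩.N z = 𝒩.N (a + b) + 𝒩.N (bd (T m z)) + 𝒩.N (T m (bd z)) := by
    rw [hab, add_assoc, ← map_add, hT, ← map_add]; congr 1; abel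
  have key : 𝒩.N z - bd (𝒩.N (T m z) + 𝒩.c⁻¹ • (b1 + b2)) = 𝒩.N (T m (bd z)) +
      𝒩.c⁻¹ • ((𝒩.N (𝒩.N a - e) - bd b1) + (𝒩.N (𝒩.N b + e) - bd b2)) := by
    have h1 : 𝒩.c⁻¹ • ((𝒩.N (𝒩.N a - e) - bd b1) + (𝒩.N (𝒩.N b + e) - bd b2)) =
        𝒩.N (a + b) - 𝒩.c⁻¹ • bd (b1 + b2) := by
      have : (𝒩.N (𝒩.N a - e) - bd b1) + (𝒩.N (𝒩.N b + e) - bd b2) = 𝒩.c • 𝒩.N (a + b) - bd (b1 + b2) := by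
        simp only [map_add, map_sub, 𝒩.NN, smul_add]; abel
      rw [this, smul_sub, smul_smul, inv_mul_cancel₀ 𝒩.hc, one_smul]
    rw [h1, hz']; simp only [map_add, map_smul, 𝒩.Nbd]; abel
  rw [key]
  refine Submodule.add_mem _ (𝒩.NS _ _ iUF _ (Sd_map_up _ (fun n x hx => TS m n _ x hx) hbz))
    (Submodule.smul_mem _ _ (Submodule.add_mem _ (S_mono ?_ hb1') (S_mono ?_ hb2')))
  · exact Set.inter_subset_inter_left _ Set.subset_union_left
  · exact Set.inter_subset_inter_left _ Set.subset_union_right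

lemma exists_compact {n : ℕ} {W : Set X} {z : Ch X} (hz : z ∈ S n W) :
    ∃ K, IsCompact K ∧ K ⊆ W ∧ z ∈ S n K := by
  refine ⟨⋃ σ ∈ z.support, Set.range σ.2, ?_, ?_, ?_⟩
  · exact z.support.finite_toSet.isCompact_biUnion fun σ _ => isCompact_range σ.2.continuous
  · intro x hx
    simp only [Set.mem_iUnion] at hx
    obtain ⟨σ, hσ, t, rfl⟩ := hx
    exact (hz hσ).2 t
  · intro σ hσ
    refine ⟨(hz hσ).1, fun t => ?_⟩
    simp only [Set.mem_iUnion]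
    exact ⟨σ, hσ, t, rfl⟩

theorem P_all {F : Set X} (hF : IsOpen F) (iF : 𝒩.Inv F) {U : Set X}
    (hloc : ∀ W, IsOpen W → 𝒩.Inv W → W ⊆ U → ∀ y ∈ W, ∃ W', IsOpen W' ∧ 𝒩.Inv W' ∧ y ∈ W' ∧ W' ⊆ W ∧
      ∀ n, 𝒩.P F n W') (n : ℕ) : ∀ W, IsOpen W → 𝒩.Inv W → W ⊆ U → 𝒩.P F n W := by
  induction n using Nat.strong_induction_on with
  | _ n ih =>
    intro W hW iW hWU z hz hbz
    obtain ⟨K, hK, hKW, hzK⟩ := exists_compact hz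
    obtain ⟨W0, oW0, iW0, hW0, pW0, hKW0⟩ : ∃ W0, IsOpen W0 ∧ 𝒩.Inv W0 ∧ W0 ⊆ W ∧ 𝒩.P F n W0 ∧ K ⊆ W0 := by
      refine hK.induction_on (p := fun s => ∃ W0, IsOpen W0 ∧ 𝒩.Inv W0 ∧ W0 ⊆ W ∧ 𝒩.P F n W0 ∧ s ⊆ W0) ?_ ?_ ?_ ?_
      · refine ⟨∅, isOpen_empty, 𝒩.empty, Set.empty_subset _, ?_, subset_rfl⟩
        intro z hz _
        rw [S_empty hz]
        exact ⟨0, Submodule.zero_mem _, by simp⟩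
      · rintro s t hst ⟨W0, h1, h2, h3, h4, h5⟩
        exact ⟨W0, h1, h2, h3, h4, hst.trans h5⟩
      · rintro s t ⟨A, h1, h2, h3, h4, h5⟩ ⟨B, k1, k2, k3, k4, k5⟩
        refine ⟨A ∪ B, h1.union k1, 𝒩.union _ _ h2 k2, Set.union_subset h3 k3,
          𝒩.P_union hF iF h1 k1 h2 k2 n h4 k4 (fun m hm => ih m hm _ (h1.inter k1) (𝒩.inter _ _ h2 k2)
            ((Set.inter_subset_left.trans h3).trans hWU)), Set.union_subset_union h5 k5⟩
      · intro x hx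
        obtain ⟨W', h1, h2, h3, h4, h5⟩ := hloc W hW iW hWU x (hKW hx)
        exact ⟨W', mem_nhdsWithin_of_mem_nhds (h1.mem_nhds h3), W', h1, h2, h4, h5 n, subset_rfl⟩
    have hzW0 : z ∈ S n W0 := S_mono hKW0 hzK
    obtain ⟨b, hb, hb'⟩ := pW0 z hzW0 (by
      refine Sd_mono ?_ (Sd_inter (bd_mem_Sd hzW0) hbz)
      rintro x ⟨h1, h2, h3⟩; exact ⟨h1, h3⟩)
    exact ⟨b, S_mono hW0 hb, S_mono (Set.inter_subset_inter_left _ hW0) hb'⟩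

def Q (U V : Set X) : Prop :=
  ∀ n, ∀ z ∈ S n U, bd z ∈ Sd n V → ∃ b ∈ S (n+1) U, 𝒩.N z - bd b ∈ S n V

lemma Q_of_P {U V : Set X} (h : V ⊆ U) (hp : ∀ n, 𝒩.P V n U) : 𝒩.Q U V := by
  intro n z hz hbz
  have := hp n z hz
  rw [Set.inter_eq_self_of_subset_right h] at this
  exact this hbz

lemma Q_refl (U : Set X) (iU : 𝒩.Inv U) : 𝒩.Q U U := fun n z hz _ =>
  ⟨0, Submodule.zero_mem _, by rw [map_zero, sub_zero]; exact 𝒩.NS _ _ iU _ hz⟩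

lemma Q_trans {U V F : Set X} (iU : 𝒩.Inv U) (iF : 𝒩.Inv F) (hVU : V ⊆ U) (hFV : F ⊆ V) (h1 : 𝒩.Q U V) (h2 : 𝒩.Q V F) :
    𝒩.Q U F := by
  intro n z hz hbz
  obtain ⟨b, hb, hb'⟩ := h1 n z hz (Sd_mono hFV hbz)
  obtain ⟨e, he, he'⟩ := h2 n _ hb' (by
    rw [map_sub, bd_bd, sub_zero, 𝒩.Nbd]
    exact Sd_map _ (fun n x hx => 𝒩.NS n _ iF x hx) hbz)
  refine ⟨𝒩.c⁻¹ • (𝒩.N b + e), Submodule.smul_mem _ _ (Submodule.add_mem _ (𝒩.NS _ _ iU _ hb) (S_mono hVU he)), ?_⟩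
  have : 𝒩.N z - bd (𝒩.c⁻¹ • (𝒩.N b + e)) = 𝒩.c⁻¹ • (𝒩.N (𝒩.N z - bd b) - bd e) := by
    simp only [map_sub, map_smul, map_add, 𝒩.NN, smul_sub, smul_add, smul_smul, inv_mul_cancel₀ 𝒩.hc, one_smul, 𝒩.Nbd]
    abel
  rw [this]
  exact Submodule.smul_mem _ _ he'
end NData
end BCT

namespace BCT
open Topology Filter
set_option linter.unusedVariables false
set_option linter.unusedSimpArgs false
set_option linter.unusedSectionVars false

lemma aug_S_succ {X : Type} [TopologicalSpace X] {n : ℕ} {W : Set X} {x : Ch X} (hx : x ∈ S (n+1) W) : aug x = 0 := by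
  have := S_map aug ⊥ (fun σ _ => by rw [aug_sg]; simp) hx
  simpa using this

noncomputable def clamp (t : ℝ) : ℝ := max 0 (min 1 t)
lemma clamp_zero : clamp 0 = 0 := by simp [clamp]
lemma clamp_one : clamp 1 = 1 := by simp [clamp]
lemma clamp_nonneg (t : ℝ) : 0 ≤ clamp t := le_max_left _ _
lemma clamp_le (t : ℝ) : clamp t ≤ 1 := max_le zero_le_one (min_le_left _ _)
lemma continuous_clamp : Continuous clamp := by unfold clamp; fun_prop

section
variable {E : Type} [NormedAddCommGroup E] [NormedSpace ℝ E]

/-- linear homotopy -/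
lemma lin_htpy (f g : C(E, E)) :
    ∃ h : Ch E →ₗ[ℚ] Ch E, (∀ x, bd (h x) + h (bd x) = cmap g x - cmap f x) ∧
      ∀ n (W W' : Set E), (∀ x ∈ W, ∀ t : ℝ, 0 ≤ t → t ≤ 1 → (1 - t) • f x + t • g x ∈ W') → ∀ x ∈ S n W,
        h x ∈ S (n+1) W' := by
  obtain ⟨h, h1, h2⟩ := exists_htpy (X := E) (Y := E)
    ⟨fun x => (1 - clamp x.2) • f x.1 + clamp x.2 • g x.1, by
      have := continuous_clamp
      fun_prop⟩ f g (fun x => by simp [clamp_zero]) (fun x => by simp [clamp_one])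
  exact ⟨h, h1, fun n W W' hW x hx => h2 n W W' (fun x hx t => hW x hx _ (clamp_nonneg _) (clamp_le _)) x hx⟩

variable {W : Type} [NormedAddCommGroup W] [NormedSpace ℝ W]

lemma refl_lemma {Q : Set E} (hQ : IsOpen Q) (cQ : Convex ℝ Q) (Λ : E →L[ℝ] W) (ℓ : E →L[ℝ] ℝ) (v p : E)
    (hv : ℓ v = 2) (ρ : C(E, E)) (hρ : ∀ x, ρ x = x - ℓ x • v) (hρQ : ∀ x ∈ Q, ρ x ∈ Q)
    (hΛℓ : ∀ x, Λ x = 0 → ℓ x = 0) (hp : Λ p = 0) (ε : ℝ) (hε : 0 < ε) (hpv : p + ε • v ∈ Q) (hpv' : p - ε • v ∈ Q)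
    (n : ℕ) (z : Ch E) (hz : z ∈ S n Q) (hbz : bd z ∈ Sd n {x | x ∈ Q ∧ Λ x ≠ 0}) :
    ∃ b ∈ S (n+1) Q, z + cmap ρ z - bd b ∈ S n {x | x ∈ Q ∧ Λ x ≠ 0} := by
  have hℓp : ℓ p = 0 := hΛℓ p hp
  have hLv : ∀ x : E, ℓ x = 0 → ∀ t : ℝ, Λ (x + t • v) = 0 → t = 0 := by
    intro x hx t ht
    have := hΛℓ _ ht
    rw [map_add, map_smul, hx, hv] at this
    simpa using this
  have hqL : Λ (p + ε • v) ≠ 0 := fun h => hε.ne' (hLv p hℓp ε h)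
  obtain ⟨s, T, sbd, hT, sS, TS, s0, hsm⟩ := exists_subdiv E
  cases n with
  | zero =>
    have hw : aug z • sg ⟨0, pt E (p + ε • v)⟩ ∈ S 0 {x | x ∈ Q ∧ Λ x ≠ 0} :=
      Submodule.smul_mem _ _ (sg_mem_S _ fun t => ⟨hpv, hqL⟩)
    set w := aug z • sg ⟨0, pt E (p + ε • v)⟩ with hwd
    have haw : aug w = aug z := by rw [hwd, map_smul, aug_sg]; simp
    have hρz : cmap ρ z ∈ S 0 Q := cmap_mem_S ρ hρQ hz
    have hwQ : w ∈ S 0 Q := S_mono (fun x hx => hx.1) hw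
    have hm : z + cmap ρ z - (w + w) ∈ S 0 Q :=
      Submodule.sub_mem _ (Submodule.add_mem _ hz hρz) (Submodule.add_mem _ hwQ hwQ)
    obtain ⟨b, hb, hb'⟩ := fill (cQ.starConvex hpv) hm (bd_S_zero hm) (by
      simp only [map_sub, map_add, aug_cmap, haw, sub_self])
    refine ⟨b, hb, ?_⟩
    rw [hb', sub_sub_cancel]
    exact Submodule.add_mem _ hw hw
  | succ n =>
    set π : E → E := fun x => x - (2⁻¹ * ℓ x) • v with hπ
    have hπc : Continuous π := by fun_prop
    set Up : Set E := {x | x ∈ Q ∧ (0 < ℓ x ∨ Λ (π x) ≠ 0)} with hUp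
    set Um : Set E := {x | x ∈ Q ∧ (ℓ x < 0 ∨ Λ (π x) ≠ 0)} with hUm
    have hℓρ : ∀ x, ℓ (ρ x) = - ℓ x := by
      intro x; rw [hρ, map_sub, map_smul, hv, smul_eq_mul]; ring
    have hπρ : ∀ x, π (ρ x) = π x := by
      intro x
      simp only [hπ]
      rw [hℓρ, hρ, sub_sub, ← add_smul]; congr 2; ring
    have hun : ∀ x, x ∈ Q ∧ Λ x ≠ 0 ↔ x ∈ Up ∪ Um := by
      intro x
      constructor
      · rintro ⟨h1, h2⟩
        rcases lt_trichotomy (ℓ x) 0 with h | h | h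
        · exact Or.inr ⟨h1, Or.inl h⟩
        · refine Or.inl ⟨h1, Or.inr ?_⟩
          simpa [hπ, h] using h2
        · exact Or.inl ⟨h1, Or.inl h⟩
      · intro h
        have : x ∈ Q ∧ (ℓ x ≠ 0 ∨ Λ (π x) ≠ 0) := by
          rcases h with ⟨h1, h | h⟩ | ⟨h1, h | h⟩
          exacts [⟨h1, Or.inl h.ne'⟩, ⟨h1, Or.inr h⟩, ⟨h1, Or.inl h.ne⟩, ⟨h1, Or.inr h⟩]
        refine ⟨this.1, fun h0 => ?_⟩
        have hl := hΛℓ x h0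
        rcases this.2 with h' | h'
        · exact h' hl
        · apply h'; simpa [hπ, hl] using h0
    have hun' : {x | x ∈ Q ∧ Λ x ≠ 0} = Up ∪ Um := Set.ext hun
    rw [hun'] at hbz ⊢
    have oUp : IsOpen Up := hQ.inter (by
      refine IsOpen.union (isOpen_lt continuous_const ℓ.continuous) ?_
      exact isOpen_ne_fun (Λ.continuous.comp hπc) continuous_const)
    have oUm : IsOpen Um := hQ.inter (by
      refine IsOpen.union (isOpen_lt ℓ.continuous continuous_const) ?_
      exact isOpen_ne_fun (Λ.continuous.comp hπc) continuous_const)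
    have hseg : ∀ (η : ℝ) (x : E) (a b : ℝ), a + b = 1 → Λ (π (a • (p + η • v) + b • x)) = b • Λ (π x) := by
      intro η x a b hab
      simp only [hπ, map_add, map_sub, map_smul, hℓp, hv, hp, smul_eq_mul]
      simp only [zero_add, smul_sub, smul_smul, ← mul_assoc, smul_add, smul_zero]
      rw [show (2⁻¹ * (a * η * 2 + b * ℓ x)) = a * η + b * 2⁻¹ * ℓ x by ring, add_smul]
      abel
    have sUp : StarConvex ℝ (p + ε • v) Up := by
      intro x hx a b ha hb hab
      refine ⟨cQ.starConvex hpv hx.1 ha hb hab, ?_⟩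
      rw [hseg ε x a b hab]
      have hl : ℓ (a • (p + ε • v) + b • x) = a * (2 * ε) + b * ℓ x := by
        simp only [map_add, map_smul, hℓp, hv, smul_eq_mul]; ring
      rw [hl]
      rcases hb.eq_or_lt with h0 | h0
      · left; rw [← h0, add_zero] at hab; rw [← h0, hab]; linarith
      · rcases hx.2 with h | h
        · left; nlinarith [mul_pos h0 h, mul_nonneg ha hε.le]
        · right; exact smul_ne_zero h0.ne' h
    have sUm : StarConvex ℝ (p - ε • v) Um := by
      intro x hx a b ha hb hab
      refine ⟨cQ.starConvex hpv' hx.1 ha hb hab, ?_⟩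
      rw [sub_eq_add_neg, ← neg_smul, hseg (-ε) x a b hab]
      have hl : ℓ (a • (p + (-ε) • v) + b • x) = - (a * (2 * ε)) + b * ℓ x := by
        simp only [map_add, map_smul, hℓp, hv, smul_eq_mul]; ring
      rw [hl]
      rcases hb.eq_or_lt with h0 | h0
      · left; rw [← h0, add_zero] at hab; rw [← h0, hab]; linarith
      · rcases hx.2 with h | h
        · left; nlinarith [mul_pos h0 (neg_pos.2 h), mul_nonneg ha hε.le]
        · right; exact smul_ne_zero h0.ne' h
    have ρpm : ∀ x ∈ Up, ρ x ∈ Um := fun x hx => ⟨hρQ x hx.1, by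
      rw [hℓρ, hπρ]; rcases hx.2 with h | h
      · left; linarith
      · right; exact h⟩
    have ρmp : ∀ x ∈ Um, ρ x ∈ Up := fun x hx => ⟨hρQ x hx.1, by
      rw [hℓρ, hπρ]; rcases hx.2 with h | h
      · left; linarith
      · right; exact h⟩
    have ρun : ∀ x ∈ Up ∪ Um, ρ x ∈ Up ∪ Um := by
      rintro x (h | h)
      · exact Or.inr (ρpm x h)
      · exact Or.inl (ρmp x h)
    obtain ⟨K, hK, hK'⟩ := lin_htpy (ContinuousMap.id E) ρ
    have KS : ∀ n x, x ∈ S n (Up ∩ Um) → K x ∈ S (n+1) (Up ∩ Um) := by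
      intro n x hx
      refine hK' n _ _ (fun x hx t ht ht' => ?_) x hx
      have hne : Λ (π x) ≠ 0 := by
        rcases hx.1.2 with h | h
        · rcases hx.2.2 with h' | h'
          · exact absurd h' (not_lt.2 h.le)
          · exact h'
        · exact h
      have hmem : (1 - t) • (ContinuousMap.id E) x + t • ρ x ∈ Q :=
        cQ hx.1.1 (hρQ x hx.1.1) (by linarith) ht (by ring)
      have hpi : π ((1 - t) • (ContinuousMap.id E) x + t • ρ x) = π x := by
        have : (1 - t) • (ContinuousMap.id E) x + t • ρ x = x - (t * ℓ x) • v := by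
          rw [hρ, ContinuousMap.id_apply, smul_sub, smul_smul, sub_smul, one_smul]; abel
        rw [this]
        simp only [hπ, map_sub, map_smul, hv, smul_eq_mul]
        rw [sub_sub, ← add_smul]; congr 2; ring
      exact ⟨⟨hmem, Or.inr (by rwa [hpi])⟩, ⟨hmem, Or.inr (by rwa [hpi])⟩⟩
    rw [Sd_succ] at hbz
    obtain ⟨m, hm⟩ := hsm n Up Um oUp oUm _ hbz
    obtain ⟨a, ha, b, hb, hab⟩ := Submodule.mem_sup.1 (hm m le_rfl)
    have hab' : a + b = bd (s m z) := by rw [hab, sbd]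
    have hdab : bd a = - bd b := by
      rw [eq_neg_iff_add_eq_zero, ← map_add, hab', bd_bd]
    have hc : bd a ∈ Sd n (Up ∩ Um) := Sd_inter (bd_mem_Sd ha) (by
      rw [hdab]; exact Submodule.neg_mem _ (bd_mem_Sd hb))
    have hKc : K (bd a) ∈ S n (Up ∩ Um) := Sd_map_up K KS hc
    have hbK : bd (K (bd a)) = cmap ρ (bd a) - bd a := by
      have := hK (bd a)
      rw [bd_bd, map_zero, add_zero, cmap_id] at this
      exact this
    have augK : aug (K (bd a)) = 0 := by
      cases n with
      | zero => rw [bd_S_zero ha, map_zero, map_zero]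
      | succ n => exact aug_S_succ hKc
    have augab : aug a + aug b = 0 := by rw [← map_add, hab', aug_bd]
    have hα : a + cmap ρ b + K (bd a) ∈ S n Up :=
      Submodule.add_mem _ (Submodule.add_mem _ ha (cmap_mem_S ρ ρmp hb)) (S_mono Set.inter_subset_left hKc)
    have hβ : b + cmap ρ a - K (bd a) ∈ S n Um :=
      Submodule.sub_mem _ (Submodule.add_mem _ hb (cmap_mem_S ρ ρpm ha)) (S_mono Set.inter_subset_right hKc)
    obtain ⟨wp, hwp, hwp'⟩ := fill sUp hα (by
      have hbb : bd b = - bd a := by rw [hdab, neg_neg]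
      rw [map_add, map_add, hbK, bd_cmap, hbb, map_neg]; abel) (by
      rw [map_add, map_add, aug_cmap, augK, augab, add_zero])
    obtain ⟨wm, hwm, hwm'⟩ := fill sUm hβ (by
      have hbb : bd b = - bd a := by rw [hdab, neg_neg]
      rw [map_sub, map_add, hbK, bd_cmap, hbb]; abel) (by
      rw [map_sub, map_add, aug_cmap, augK, add_comm, augab, sub_zero])
    have hw : wp + wm ∈ S (n+1) (Up ∪ Um) :=
      Submodule.add_mem _ (S_mono Set.subset_union_left hwp) (S_mono Set.subset_union_right hwm)
    have hUQ : Up ∪ Um ⊆ Q := by rintro x (h | h) <;> exact h.1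
    have hsz : s m z ∈ S (n+1) Q := sS _ _ _ _ hz
    have hm : s m z + cmap ρ (s m z) - (wp + wm) ∈ S (n+1) Q :=
      Submodule.sub_mem _ (Submodule.add_mem _ hsz (cmap_mem_S ρ hρQ hsz)) (S_mono hUQ hw)
    obtain ⟨e, he, he'⟩ := fill (cQ.starConvex hpv) hm (by
      rw [map_sub, map_add, map_add, hwp', hwm', bd_cmap, ← hab', map_add]; abel) (aug_S_succ hm)
    have hTz : T m z ∈ S (n+2) Q := TS _ _ _ _ hz
    refine ⟨e + T m z + cmap ρ (T m z), Submodule.add_mem _ (Submodule.add_mem _ he hTz) (cmap_mem_S ρ hρQ hTz), ?_⟩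
    have key : z + cmap ρ z - bd (e + T m z + cmap ρ (T m z)) =
        (wp + wm) + T m (bd z) + cmap ρ (T m (bd z)) := by
      have h1 : z = s m z + bd (T m z) + T m (bd z) := by rw [add_assoc, hT]; abel
      have h2 : cmap ρ z = cmap ρ (s m z) + cmap ρ (bd (T m z)) + cmap ρ (T m (bd z)) := by
        rw [← map_add, ← map_add, ← h1]
      rw [h2, map_add, map_add, he', bd_cmap]
      nth_rewrite 1 [h1]
      abel
    rw [key]
    have hTb : T m (bd z) ∈ S (n+1) (Up ∪ Um) := TS _ _ _ _ hbz
    exact Submodule.add_mem _ (Submodule.add_mem _ hw hTb) (cmap_mem_S ρ ρun hTb)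
end
end BCT

namespace BCT
open Topology Filter
set_option linter.unusedVariables false
set_option linter.unusedSimpArgs false
set_option linter.unusedSectionVars false

section
variable {k d : ℕ} {ι : Type} (y : Fin k → ι)

abbrev VV (d : ℕ) := EuclideanSpace ℝ (Fin d)

def Lset (A : Type) : Set (Fin k → A) := {x | ∀ i j, y i = y j → x i = x j}

noncomputable def rhoC (i₀ j₀ : Fin k) (C : Finset (Fin d)) : C(Fin k → VV d, Fin k → VV d) where
  toFun x i := WithLp.toLp 2 (fun c => if c ∈ C then x (Equiv.swap i₀ j₀ i) c else x i c)
  continuous_toFun := by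
    refine continuous_pi fun i => ?_
    refine (PiLp.continuous_toLp 2 _).comp (continuous_pi fun c => ?_)
    by_cases h : c ∈ C <;> simp only [h, if_true, if_false] <;> fun_prop

lemma rhoC_apply (i₀ j₀ : Fin k) (C : Finset (Fin d)) (x : Fin k → VV d) (i : Fin k) (c : Fin d) :
    rhoC i₀ j₀ C x i c = if c ∈ C then x (Equiv.swap i₀ j₀ i) c else x i c := rfl

lemma rhoC_invol (i₀ j₀ : Fin k) (C : Finset (Fin d)) (x : Fin k → VV d) :
    rhoC i₀ j₀ C (rhoC i₀ j₀ C x) = x := by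
  ext i c
  simp only [rhoC_apply]
  split_ifs <;> simp

lemma rhoC_empty (i₀ j₀ : Fin k) : rhoC i₀ j₀ (∅ : Finset (Fin d)) = ContinuousMap.id _ := by
  ext x i c
  simp [rhoC_apply]

lemma rhoC_insert (i₀ j₀ : Fin k) (C : Finset (Fin d)) (c : Fin d) (hc : c ∉ C) :
    rhoC i₀ j₀ (insert c C) = (rhoC i₀ j₀ {c}).comp (rhoC i₀ j₀ C) := by
  ext x i e
  simp only [ContinuousMap.comp_apply, rhoC_apply, Finset.mem_insert, Finset.mem_singleton]
  by_cases h : e = c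
  · subst h; simp [hc]
  · simp [h]

variable {y}

lemma swap_lab {i₀ j₀ : Fin k} (h : y i₀ = y j₀) (i : Fin k) : y (Equiv.swap i₀ j₀ i) = y i := by
  rw [Equiv.swap_apply_def]
  split_ifs with h1 h2
  · rw [h1, h]
  · rw [h2, h]
  · rfl

lemma rhoC_L {i₀ j₀ : Fin k} (h : y i₀ = y j₀) (C : Finset (Fin d)) {x : Fin k → VV d}
    (hx : x ∈ Lset y (VV d)) : rhoC i₀ j₀ C x = x := by
  ext i c
  rw [rhoC_apply, hx _ _ (swap_lab h i), ite_self]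

lemma rhoC_notL {i₀ j₀ : Fin k} (h : y i₀ = y j₀) (C : Finset (Fin d)) {x : Fin k → VV d}
    (hx : x ∉ Lset y (VV d)) : rhoC i₀ j₀ C x ∉ Lset y (VV d) := by
  intro h'
  apply hx
  have := rhoC_L h C h'
  rw [rhoC_invol] at this
  rw [this]; exact h'

def Box (p : Fin k → VV d) (r : ℝ) : Set (Fin k → VV d) := {x | ∀ i c, |x i c - p i c| < r}

lemma rhoC_Box {i₀ j₀ : Fin k} (h : y i₀ = y j₀) (C : Finset (Fin d)) {p : Fin k → VV d} (hp : p ∈ Lset y (VV d)) {r : ℝ}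
    {x : Fin k → VV d} (hx : x ∈ Box p r) : rhoC i₀ j₀ C x ∈ Box p r := by
  intro i c
  rw [rhoC_apply]
  split_ifs
  · rw [← hp _ _ (swap_lab h i)]; exact hx _ _
  · exact hx _ _

lemma Box_open (p : Fin k → VV d) (r : ℝ) : IsOpen (Box p r) := by
  have : Box p r = ⋂ i, ⋂ c, {x : Fin k → VV d | |x i c - p i c| < r} := by
    ext x; simp [Box]
  rw [this]
  exact isOpen_iInter_of_finite fun i => isOpen_iInter_of_finite fun c =>
    isOpen_lt (by fun_prop) continuous_const

lemma Box_convex (p : Fin k → VV d) (r : ℝ) : Convex ℝ (Box p r) := by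
  intro x hx z hz a b ha hb hab i c
  have : (a • x + b • z) i c - p i c = a * (x i c - p i c) + b * (z i c - p i c) := by
    simp only [Pi.add_apply, Pi.smul_apply, PiLp.add_apply, PiLp.smul_apply, smul_eq_mul]
    linear_combination (p i c) * hab
  rw [this]
  have h := (convex_ball (0:ℝ) r) (x := x i c - p i c) (by simpa using hx i c) (y := z i c - p i c) (by simpa using hz i c) ha hb hab
  simpa using h

open Classical in
/-- the linear map cutting out `L` -/
noncomputable def Lam (y : Fin k → ι) : (Fin k → VV d) →L[ℝ] (Fin k → Fin k → VV d) :=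
  LinearMap.toContinuousLinearMap
  { toFun := fun x i j => if y i = y j then x i - x j else 0
    map_add' := fun x z => by
      funext i j
      simp only [Pi.add_apply]
      split_ifs
      · abel
      · simp
    map_smul' := fun a x => by
      funext i j
      simp only [Pi.smul_apply, RingHom.id_apply]
      split_ifs
      · rw [smul_sub]
      · simp }

open Classical in
lemma Lam_eq_zero (x : Fin k → VV d) : Lam y x = 0 ↔ x ∈ Lset y (VV d) := by
  constructor
  · intro h i j hij
    have := congrFun (congrFun h i) j
    change (if y i = y j then x i - x j else 0) = 0 at this
    rw [if_pos hij, sub_eq_zero] at this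
    exact this
  · intro h
    funext i j
    change (if y i = y j then x i - x j else 0) = 0
    split_ifs with h1
    · rw [h i j h1, sub_self]
    · rfl

noncomputable def ellC (i₀ j₀ : Fin k) (c : Fin d) : (Fin k → VV d) →L[ℝ] ℝ :=
  LinearMap.toContinuousLinearMap
  { toFun := fun x => x i₀ c - x j₀ c
    map_add' := fun x z => by simp; ring
    map_smul' := fun a x => by simp; ring }

noncomputable def vecC (i₀ j₀ : Fin k) (c : Fin d) : Fin k → VV d :=
  fun i => WithLp.toLp 2 (fun e => if e = c then (if i = i₀ then 1 else if i = j₀ then -1 else 0) else 0)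

lemma vecC_apply (i₀ j₀ : Fin k) (c : Fin d) (i : Fin k) (e : Fin d) :
    vecC i₀ j₀ c i e = if e = c then (if i = i₀ then 1 else if i = j₀ then -1 else 0) else 0 := rfl

lemma refl_box {i₀ j₀ : Fin k} (hne : i₀ ≠ j₀) (h : y i₀ = y j₀) {p : Fin k → VV d} (hp : p ∈ Lset y (VV d))
    {r : ℝ} (hr : 0 < r) (c : Fin d) (n : ℕ) (z : Ch (Fin k → VV d)) (hz : z ∈ S n (Box p r))
    (hbz : bd z ∈ Sd n (Box p r \ Lset y (VV d))) :
    ∃ b ∈ S (n+1) (Box p r), z + cmap (rhoC i₀ j₀ {c}) z - bd b ∈ S n (Box p r \ Lset y (VV d)) := by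
  have hset : Box p r \ Lset y (VV d) = {x | x ∈ Box p r ∧ Lam y x ≠ 0} := by
    ext x; simp only [Set.mem_sdiff, Set.mem_ofPred_eq, ne_eq, Lam_eq_zero]
  rw [hset] at hbz ⊢
  have hell : ∀ x, ellC i₀ j₀ c x = x i₀ c - x j₀ c := fun _ => rfl
  have hvb : ∀ i e, |vecC i₀ j₀ c i e| ≤ 1 := by
    intro i e; rw [vecC_apply]; split_ifs <;> simp
  refine refl_lemma (Box_open p r) (Box_convex p r) (Lam y) (ellC i₀ j₀ c) (vecC i₀ j₀ c) p ?_ _ ?_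
    (fun x hx => rhoC_Box h _ hp hx) ?_ ((Lam_eq_zero p).2 hp) (r/2) (by positivity) ?_ ?_ n z hz hbz
  · rw [hell, vecC_apply, vecC_apply]; simp [hne.symm]; norm_num
  · intro x
    ext i e
    rw [rhoC_apply]
    simp only [Pi.sub_apply, Pi.smul_apply, PiLp.sub_apply, PiLp.smul_apply, smul_eq_mul, hell, vecC_apply, Finset.mem_singleton]
    by_cases he : e = c
    · subst he
      simp only [if_true]
      rw [Equiv.swap_apply_def]
      split_ifs with h1 h2
      · subst h1; ring
      · subst h2; ring
      · ring
    · simp [he]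
  · intro x hx
    rw [Lam_eq_zero] at hx
    rw [hell, hx _ _ h, sub_self]
  · intro i e
    simp only [Pi.add_apply, Pi.smul_apply, PiLp.add_apply, PiLp.smul_apply, smul_eq_mul, add_sub_cancel_left]
    rw [abs_mul, abs_of_pos (by positivity)]
    nlinarith [hvb i e, abs_nonneg (vecC i₀ j₀ c i e)]
  · intro i e
    simp only [Pi.sub_apply, Pi.smul_apply, PiLp.sub_apply, PiLp.smul_apply, smul_eq_mul, sub_sub_cancel_left, abs_neg]
    rw [abs_mul, abs_of_pos (by positivity)]
    nlinarith [hvb i e, abs_nonneg (vecC i₀ j₀ c i e)]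

lemma refl_box_all {i₀ j₀ : Fin k} (hne : i₀ ≠ j₀) (h : y i₀ = y j₀) {p : Fin k → VV d} (hp : p ∈ Lset y (VV d))
    {r : ℝ} (hr : 0 < r) (C : Finset (Fin d)) (n : ℕ) (z : Ch (Fin k → VV d)) (hz : z ∈ S n (Box p r))
    (hbz : bd z ∈ Sd n (Box p r \ Lset y (VV d))) :
    ∃ b ∈ S (n+1) (Box p r), cmap (rhoC i₀ j₀ C) z - (-1:ℚ)^C.card • z - bd b ∈ S n (Box p r \ Lset y (VV d)) := by
  induction C using Finset.induction_on with
  | empty =>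
    refine ⟨0, Submodule.zero_mem _, ?_⟩
    rw [rhoC_empty, cmap_id]; simp
  | insert c C hc ih =>
    obtain ⟨b, hb, hb'⟩ := ih
    have h1 : cmap (rhoC i₀ j₀ C) z ∈ S n (Box p r) := cmap_mem_S _ (fun x hx => rhoC_Box h C hp hx) hz
    obtain ⟨e, he, he'⟩ := refl_box hne h hp hr c n _ h1 (by
      rw [bd_cmap]
      refine Sd_map (cmap (rhoC i₀ j₀ C)) (fun n x hx => cmap_mem_S _ ?_ hx) hbz
      exact fun x hx => ⟨rhoC_Box h C hp hx.1, rhoC_notL h C hx.2⟩)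
    refine ⟨e - b, Submodule.sub_mem _ he hb, ?_⟩
    have : cmap (rhoC i₀ j₀ (insert c C)) z - (-1:ℚ)^(insert c C).card • z - bd (e - b) =
        (cmap (rhoC i₀ j₀ C) z + cmap (rhoC i₀ j₀ {c}) (cmap (rhoC i₀ j₀ C) z) - bd e) -
        (cmap (rhoC i₀ j₀ C) z - (-1:ℚ)^C.card • z - bd b) := by
      rw [rhoC_insert _ _ _ _ hc, ← cmap_cmap, Finset.card_insert_of_notMem hc, pow_succ, map_sub, mul_neg_one, neg_smul]
      abel
    rw [this]
    exact Submodule.sub_mem _ he' hb'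

def permMap {A : Type} [TopologicalSpace A] (g : Equiv.Perm (Fin k)) : C(Fin k → A, Fin k → A) :=
  ⟨fun x => x ∘ g, by fun_prop⟩

/-- the linear local lemma -/
theorem local_lin (hd : Odd d) {i₀ j₀ : Fin k} (hne : i₀ ≠ j₀) (h : y i₀ = y j₀) (K : ι → Set (VV d))
    (hK : ∀ a, Convex ℝ (K a)) (hKi : ∀ a, (interior (K a)).Nonempty)
    (n : ℕ) (z : Ch (Fin k → VV d)) (hz : z ∈ S n {x | ∀ i, x i ∈ K (y i)})
    (hbz : bd z ∈ Sd n ({x | ∀ i, x i ∈ K (y i)} \ Lset y (VV d))) :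
    ∃ b ∈ S (n+1) {x | ∀ i, x i ∈ K (y i)}, z + cmap (permMap (Equiv.swap i₀ j₀)) z - bd b ∈
      S n ({x : Fin k → VV d | ∀ i, x i ∈ K (y i)} \ Lset y (VV d)) := by
  set KK : Set (Fin k → VV d) := {x | ∀ i, x i ∈ K (y i)} with hKK
  have hperm : (permMap (Equiv.swap i₀ j₀) : C(Fin k → VV d, Fin k → VV d)) = rhoC i₀ j₀ Finset.univ := by
    ext x i c
    rw [rhoC_apply]; simp [permMap]
  choose q hq using hKi
  set p : Fin k → VV d := fun i => q (y i) with hp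
  have hpL : p ∈ Lset y (VV d) := fun i j hij => by simp only [hp, hij]
  obtain ⟨r, hr, hrK⟩ : ∃ r > 0, Box p r ⊆ KK := by
    have h1 : KK ∈ 𝓝 p := by
      have : KK = Set.pi Set.univ (fun i => K (y i)) := by ext x; simp [hKK]
      rw [this]
      exact set_pi_mem_nhds Set.finite_univ fun i _ => mem_interior_iff_mem_nhds.1 (hq (y i))
    let e : (Fin k → VV d) ≃L[ℝ] (Fin k → Fin d → ℝ) :=
      ContinuousLinearEquiv.piCongrRight fun _ => EuclideanSpace.equiv (Fin d) ℝ
    have h2 : e.symm ⁻¹' KK ∈ 𝓝 (e p) := e.symm.continuous.continuousAt.preimage_mem_nhds (by simpa using h1)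
    obtain ⟨r, hr, hb⟩ := Metric.mem_nhds_iff.1 h2
    refine ⟨r, hr, fun x hx => ?_⟩
    have : e x ∈ Metric.ball (e p) r := by
      rw [Metric.mem_ball, dist_pi_lt_iff hr]
      intro i
      rw [dist_pi_lt_iff hr]
      intro c
      rw [Real.dist_eq]; exact hx i c
    simpa using hb this
  have hKc : Convex ℝ KK := by
    have : KK = Set.pi Set.univ (fun i => K (y i)) := by ext x; simp [hKK]
    rw [this]; exact convex_pi fun i _ => hK _
  have hpK : p ∈ KK := hrK fun i c => by simpa using hr
  obtain ⟨K0, cK0, hK0, hzK0⟩ := NData.exists_compact hz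
  obtain ⟨D, hD, hDK⟩ : ∃ D : ℝ, 0 < D ∧ ∀ x ∈ K0, ∀ i c, |x i c - p i c| ≤ D := by
    have : ∃ D : ℝ, ∀ x ∈ K0, ∑ i, ∑ c, |x i c - p i c| ≤ D := by
      obtain ⟨D, hD⟩ := (cK0.image (f := fun x : Fin k → VV d => ∑ i, ∑ c, |x i c - p i c|) (by fun_prop)).bddAbove
      exact ⟨D, fun x hx => hD ⟨x, hx, rfl⟩⟩
    obtain ⟨D, hD⟩ := this
    refine ⟨max D 1, by positivity, fun x hx i c => le_trans ?_ ((hD x hx).trans (le_max_left _ _))⟩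
    refine le_trans ?_ (Finset.single_le_sum (f := fun i => ∑ c, |x i c - p i c|) (fun i _ => by positivity) (Finset.mem_univ i))
    exact Finset.single_le_sum (f := fun c => |x i c - p i c|) (fun i _ => by positivity) (Finset.mem_univ c)
  set ε : ℝ := min 1 (r / (2 * D)) with hε
  have hε0 : 0 < ε := by positivity
  have hε1 : ε ≤ 1 := min_le_left _ _
  have hεD : ε * D < r := by
    have : ε * D ≤ r / (2 * D) * D := by gcongr; exact min_le_right _ _
    have h2 : r / (2 * D) * D = r / 2 := by field_simp
    linarith
  let g : C(Fin k → VV d, Fin k → VV d) := ⟨fun x => (1 - ε) • p + ε • x, by fun_prop⟩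
  have hg : ∀ x, g x = (1 - ε) • p + ε • x := fun _ => rfl
  obtain ⟨hh, hh1, hh2⟩ := lin_htpy (ContinuousMap.id _) g
  have hconv : ∀ x ∈ KK, ∀ t : ℝ, 0 ≤ t → t ≤ 1 → (1 - t) • (ContinuousMap.id (Fin k → VV d)) x + t • g x ∈ KK := by
    intro x hx t h0 h1
    refine hKc hx ?_ (by linarith) h0 (by ring)
    exact hKc hpK hx (by linarith) hε0.le (by ring)
  have haff : ∀ (x : Fin k → VV d) (a b : ℝ), b ≠ 0 → x ∉ Lset y (VV d) → a • p + b • x ∉ Lset y (VV d) := by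
    intro x a b hb hx h'
    apply hx
    intro i j hij
    have := h' i j hij
    simp only [Pi.add_apply, Pi.smul_apply, hpL i j hij, add_right_inj] at this
    exact smul_right_injective _ hb this
  have hconv' : ∀ x ∈ KK \ Lset y (VV d), ∀ t : ℝ, 0 ≤ t → t ≤ 1 →
      (1 - t) • (ContinuousMap.id (Fin k → VV d)) x + t • g x ∈ KK \ Lset y (VV d) := by
    intro x hx t h0 h1
    refine ⟨hconv x hx.1 t h0 h1, ?_⟩
    have : (1 - t) • (ContinuousMap.id (Fin k → VV d)) x + t • g x = (t * (1 - ε)) • p + (1 - t + t * ε) • x := by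
      rw [hg, ContinuousMap.id_apply, smul_add, smul_smul, smul_smul, add_smul]; abel
    rw [this]
    exact haff _ _ _ (by nlinarith) hx.2
  have hgK0 : ∀ x ∈ K0, g x ∈ Box p r := by
    intro x hx i c
    have : g x i c - p i c = ε * (x i c - p i c) := by
      rw [hg]; simp only [Pi.add_apply, Pi.smul_apply, PiLp.add_apply, PiLp.smul_apply, smul_eq_mul]; ring
    rw [this, abs_mul, abs_of_pos hε0]
    refine lt_of_le_of_lt ?_ hεD
    gcongr
    exact hDK x hx i c
  have hgz : cmap g z ∈ S n (Box p r) := cmap_mem_S g hgK0 hzK0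
  obtain ⟨b, hb, hb'⟩ := refl_box_all hne h hpL hr Finset.univ n _ hgz (by
    have h1 : bd (cmap g z) ∈ Sd n (KK \ Lset y (VV d)) := by
      rw [bd_cmap]
      refine Sd_map (cmap g) (fun n x hx => cmap_mem_S g (fun x hx => ?_) hx) hbz
      simpa using hconv' x hx 1 zero_le_one le_rfl
    refine Sd_mono ?_ (Sd_inter h1 (bd_mem_Sd hgz))
    rintro x ⟨⟨h1, h2⟩, h3⟩; exact ⟨h3, h2⟩)
  rw [← hperm] at hb'
  rw [Finset.card_univ, Fintype.card_fin, hd.neg_one_pow, neg_one_smul, sub_neg_eq_add] at hb'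
  set τ : C(Fin k → VV d, Fin k → VV d) := permMap (Equiv.swap i₀ j₀) with hτ
  have hτK : ∀ x ∈ KK, τ x ∈ KK := by
    intro x hx i
    have := hx (Equiv.swap i₀ j₀ i)
    rw [swap_lab h] at this
    exact this
  have hτK' : ∀ x ∈ KK \ Lset y (VV d), τ x ∈ KK \ Lset y (VV d) := by
    intro x hx
    refine ⟨hτK x hx.1, ?_⟩
    rw [hperm]; exact rhoC_notL h _ hx.2
  have hhz : hh z ∈ S (n+1) KK := hh2 n KK KK hconv z hz
  have hhb : hh (bd z) ∈ S n (KK \ Lset y (VV d)) := Sd_map_up hh (fun n x hx => hh2 n _ _ hconv' x hx) hbz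
  refine ⟨b - hh z - cmap τ (hh z), Submodule.sub_mem _ (Submodule.sub_mem _ (S_mono hrK hb) hhz) (cmap_mem_S τ hτK hhz), ?_⟩
  have hzz : z = cmap g z - bd (hh z) - hh (bd z) := by
    rw [sub_sub, hh1, cmap_id]; simp
  have h2 : cmap τ z = cmap τ (cmap g z) - bd (cmap τ (hh z)) - cmap τ (hh (bd z)) := by
    rw [bd_cmap, ← map_sub, ← map_sub, ← hzz]
  have key : z + cmap τ z - bd (b - hh z - cmap τ (hh z)) =
      (cmap τ (cmap g z) + cmap g z - bd b) - hh (bd z) - cmap τ (hh (bd z)) := by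
    rw [h2, map_sub, map_sub]
    nth_rewrite 1 [hzz]
    abel
  rw [key]
  refine Submodule.sub_mem _ (Submodule.sub_mem _ (S_mono ?_ hb') hhb) (cmap_mem_S τ hτK' hhb)
  exact Set.sdiff_subset_sdiff_left hrK
end
end BCT

namespace BCT
open Topology Filter
set_option linter.unusedVariables false
set_option linter.unusedSimpArgs false
set_option linter.unusedSectionVars false

section
variable {X Y Z : Type} [TopologicalSpace X] [TopologicalSpace Y] [TopologicalSpace Z]

open Classical in
/-- chain map induced by a partially continuous map -/
noncomputable def pmap (f : X → Y) : Ch X →ₗ[ℚ] Ch Y :=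
  Finsupp.linearCombination ℚ (fun σ : Smp X =>
    if h : Continuous (f ∘ σ.2) then sg ⟨σ.1, ⟨f ∘ σ.2, h⟩⟩ else 0)

lemma pmap_sg (f : X → Y) (σ : Smp X) (h : Continuous (f ∘ σ.2)) :
    pmap f (sg σ) = sg ⟨σ.1, ⟨f ∘ σ.2, h⟩⟩ := by
  rw [pmap, lift_sg, dif_pos h]

lemma pmap_cont {W : Set X} {f : X → Y} (hf : ContinuousOn f W) {n : ℕ} (σ : C(Simp n, X)) (h : ∀ t, σ t ∈ W) :
    Continuous (f ∘ σ) :=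
  hf.comp_continuous σ.continuous h

lemma pmap_mem_S {W : Set X} {W' : Set Y} {f : X → Y} (hf : ContinuousOn f W) (hW : ∀ x ∈ W, f x ∈ W') {n : ℕ} {x : Ch X}
    (hx : x ∈ S n W) : pmap f x ∈ S n W' := by
  refine S_map (pmap f) _ (fun σ h => ?_) hx
  rw [pmap_sg f _ (pmap_cont hf σ h)]
  exact sg_mem_S _ fun t => hW _ (h t)

lemma bd_pmap {W : Set X} {f : X → Y} (hf : ContinuousOn f W) {n : ℕ} {x : Ch X}
    (hx : x ∈ S n W) : bd (pmap f x) = pmap f (bd x) := by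
  refine S_congr (bd ∘ₗ pmap f) (pmap f ∘ₗ bd) (fun σ h => ?_) hx
  simp only [LinearMap.comp_apply]
  rw [pmap_sg f _ (pmap_cont hf σ h)]
  cases n with
  | zero => rw [bd_zero, bd_zero, map_zero]
  | succ n =>
    rw [bd_succ, bd_succ, map_sum]
    refine Finset.sum_congr rfl fun i _ => ?_
    rw [map_smul, pmap_sg f _ (pmap_cont hf (σ.comp (face n i)) (fun t => h _))]
    rfl

lemma pmap_pmap_eq {W : Set X} {f : X → Y} {g : Y → Z} (hf : ContinuousOn f W) {W' : Set Y} (hW : ∀ x ∈ W, f x ∈ W')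
    (hg : ContinuousOn g W') (F : C(X, Z)) (hF : ∀ x ∈ W, g (f x) = F x) {n : ℕ} {x : Ch X}
    (hx : x ∈ S n W) : pmap g (pmap f x) = cmap F x := by
  refine S_congr (pmap g ∘ₗ pmap f) (cmap F) (fun σ h => ?_) hx
  simp only [LinearMap.comp_apply]
  rw [pmap_sg f _ (pmap_cont hf σ h), pmap_sg g _ (pmap_cont hg _ (fun t => hW _ (h t))), cmap_sg]
  congr 2
  ext t
  exact hF _ (h t)

lemma cmap_pmap {W : Set X} {f : X → Y} (G : C(Y, Z)) (hf : ContinuousOn f W) {n : ℕ} {x : Ch X}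
    (hx : x ∈ S n W) : cmap G (pmap f x) = pmap (G ∘ f) x := by
  refine S_congr (cmap G ∘ₗ pmap f) (pmap (G ∘ f)) (fun σ h => ?_) hx
  simp only [LinearMap.comp_apply]
  rw [pmap_sg f _ (pmap_cont hf σ h), pmap_sg (G ∘ f) _ (pmap_cont (G.continuous.comp_continuousOn hf) σ h), cmap_sg]
  rfl
end

section
variable {d : ℕ} {M : Type} [TopologicalSpace M]

lemma exists_chart {H' : Type} [TopologicalSpace H'] (I : ModelWithCorners ℝ (VV d) H') [ChartedSpace H' M] (z : M) (O : Set M) (hO : O ∈ 𝓝 z) : ∃ (φ : M → VV d) (ψ : VV d → M) (B : Set M) (K : Set (VV d)),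
    IsOpen B ∧ z ∈ B ∧ B ⊆ O ∧ Convex ℝ K ∧ (interior K).Nonempty ∧ (∀ x ∈ B, φ x ∈ K) ∧ (∀ x ∈ K, ψ x ∈ B) ∧
    ContinuousOn φ B ∧ ContinuousOn ψ K ∧ (∀ x ∈ B, ψ (φ x) = x) ∧ (∀ x ∈ K, φ (ψ x) = x) := by
  have h1 : (extChartAt I z).symm ⁻¹' O ∩ (extChartAt I z).target ∈ 𝓝[Set.range I] (extChartAt I z z) := by
    refine Filter.inter_mem ?_ (extChartAt_target_mem_nhdsWithin z)
    rw [← map_extChartAt_nhds, Filter.mem_map]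
    filter_upwards [hO, extChartAt_source_mem_nhds (I := I) z] with x hx hx'
    change (extChartAt I z).symm (extChartAt I z x) ∈ O
    rw [(extChartAt I z).left_inv hx']; exact hx
  obtain ⟨r, hr, hr'⟩ := Metric.mem_nhdsWithin_iff.1 h1
  refine ⟨extChartAt I z, (extChartAt I z).symm, (extChartAt I z).source ∩ extChartAt I z ⁻¹' Metric.ball (extChartAt I z z) r,
    Metric.ball (extChartAt I z z) r ∩ Set.range I, isOpen_extChartAt_preimage' z Metric.isOpen_ball,
    ⟨mem_extChartAt_source z, Metric.mem_ball_self hr⟩, ?_, (convex_ball _ _).inter I.convex_range, ?_, ?_, ?_, ?_, ?_, ?_, ?_⟩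
  · rintro x ⟨hx, hx'⟩
    have := (hr' ⟨hx', extChartAt_target_subset_range z ((extChartAt I z).map_source hx)⟩).1
    change (extChartAt I z).symm (extChartAt I z x) ∈ O at this
    rwa [(extChartAt I z).left_inv hx] at this
  · have h2 : extChartAt I z z ∈ closure (interior (Set.range I)) :=
      I.range_subset_closure_interior (extChartAt_target_subset_range z (mem_extChartAt_target z))
    obtain ⟨w, hw, hw'⟩ := mem_closure_iff.1 h2 _ Metric.isOpen_ball (Metric.mem_ball_self hr)
    rw [interior_inter]
    exact ⟨w, by rwa [Metric.isOpen_ball.interior_eq], hw'⟩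
  · rintro x ⟨hx, hx'⟩
    exact ⟨hx', extChartAt_target_subset_range z ((extChartAt I z).map_source hx)⟩
  · intro x hx
    have := (hr' hx).2
    refine ⟨(extChartAt I z).map_target this, ?_⟩
    change extChartAt I z ((extChartAt I z).symm x) ∈ Metric.ball (extChartAt I z z) r
    rw [(extChartAt I z).right_inv this]; exact hx.1
  · exact (continuousOn_extChartAt z).mono Set.inter_subset_left
  · exact (continuousOn_extChartAt_symm z).mono fun x hx => (hr' hx).2
  · intro x hx; exact (extChartAt I z).left_inv hx.1
  · intro x hx; exact (extChartAt I z).right_inv (hr' hx).2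

/-- the local lemma in a manifold -/
theorem local_mfld {k : ℕ} {y : Fin k → M} (hd : Odd d) {i₀ j₀ : Fin k} (hne : i₀ ≠ j₀) (h : y i₀ = y j₀)
    (φ : M → M → VV d) (ψ : M → VV d → M) (B : M → Set M) (K : M → Set (VV d))
    (hK : ∀ a, Convex ℝ (K a)) (hKi : ∀ a, (interior (K a)).Nonempty)
    (hφ : ∀ a, ∀ x ∈ B a, φ a x ∈ K a) (hψ : ∀ a, ∀ x ∈ K a, ψ a x ∈ B a)
    (hφc : ∀ a, ContinuousOn (φ a) (B a)) (hψc : ∀ a, ContinuousOn (ψ a) (K a))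
    (hl : ∀ a, ∀ x ∈ B a, ψ a (φ a x) = x) (hr : ∀ a, ∀ x ∈ K a, φ a (ψ a x) = x)
    (n : ℕ) (z : Ch (Fin k → M)) (hz : z ∈ S n {x | ∀ i, x i ∈ B (y i)})
    (hbz : bd z ∈ Sd n ({x | ∀ i, x i ∈ B (y i)} \ Lset y M)) :
    ∃ b ∈ S (n+1) {x | ∀ i, x i ∈ B (y i)}, z + cmap (permMap (Equiv.swap i₀ j₀)) z - bd b ∈
      S n ({x : Fin k → M | ∀ i, x i ∈ B (y i)} \ Lset y M) := by
  set BB : Set (Fin k → M) := {x | ∀ i, x i ∈ B (y i)} with hBB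
  set KK : Set (Fin k → VV d) := {x | ∀ i, x i ∈ K (y i)} with hKK
  set Φ : (Fin k → M) → (Fin k → VV d) := fun x i => φ (y i) (x i) with hΦ
  set Ψ : (Fin k → VV d) → (Fin k → M) := fun x i => ψ (y i) (x i) with hΨ
  have cΦ : ContinuousOn Φ BB := continuousOn_pi.2 fun i =>
    (hφc (y i)).comp (continuous_apply i).continuousOn fun x hx => hx i
  have cΨ : ContinuousOn Ψ KK := continuousOn_pi.2 fun i =>
    (hψc (y i)).comp (continuous_apply i).continuousOn fun x hx => hx i
  have mΦ : ∀ x ∈ BB, Φ x ∈ KK := fun x hx i => hφ _ _ (hx i)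
  have mΨ : ∀ x ∈ KK, Ψ x ∈ BB := fun x hx i => hψ _ _ (hx i)
  have mΦ' : ∀ x ∈ BB \ Lset y M, Φ x ∈ KK \ Lset y (VV d) := fun x hx => ⟨mΦ x hx.1, fun h' => hx.2 fun i j hij => by
    have := h' i j hij
    simp only [hΦ] at this
    rw [← hl _ _ (hx.1 i), ← hl _ _ (hx.1 j), this, hij]⟩
  have mΨ' : ∀ x ∈ KK \ Lset y (VV d), Ψ x ∈ BB \ Lset y M := fun x hx => ⟨mΨ x hx.1, fun h' => hx.2 fun i j hij => by
    have := h' i j hij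
    simp only [hΨ] at this
    rw [← hr _ _ (hx.1 i), ← hr _ _ (hx.1 j), this, hij]⟩
  obtain ⟨b, hb, hb'⟩ := local_lin hd hne h K hK hKi n (pmap Φ z) (pmap_mem_S cΦ mΦ hz) (by
    rw [bd_pmap cΦ hz]
    exact Sd_map _ (fun n x hx => pmap_mem_S (cΦ.mono Set.sdiff_subset) mΦ' hx) hbz)
  refine ⟨pmap Ψ b, pmap_mem_S cΨ mΨ hb, ?_⟩
  have := pmap_mem_S (cΨ.mono Set.sdiff_subset) mΨ' hb'
  have swl : ∀ i, y (Equiv.swap i₀ j₀ i) = y i := by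
    intro i
    rcases eq_or_ne i i₀ with rfl | h1
    · simp [h]
    rcases eq_or_ne i j₀ with rfl | h2
    · simp [h]
    rw [Equiv.swap_apply_of_ne_of_ne h1 h2]
  have mτ : ∀ x ∈ BB, (permMap (Equiv.swap i₀ j₀) : C(Fin k → M, _)) x ∈ BB := by
    intro x hx i
    have := hx (Equiv.swap i₀ j₀ i)
    rw [swl] at this; exact this
  rw [map_sub, map_add, ← bd_pmap cΨ hb] at this
  have e1 : pmap Ψ (pmap Φ z) = z := by
    rw [pmap_pmap_eq cΦ mΦ cΨ (ContinuousMap.id _) (fun x hx => ?_) hz, cmap_id]; · rfl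
    funext i; exact hl _ _ (hx i)
  have e2 : pmap Ψ (cmap (permMap (Equiv.swap i₀ j₀)) (pmap Φ z)) = cmap (permMap (Equiv.swap i₀ j₀)) z := by
    rw [cmap_pmap _ cΦ hz]
    refine pmap_pmap_eq (((permMap (Equiv.swap i₀ j₀) : C(Fin k → VV d, _)).continuous).comp_continuousOn cΦ) (W' := KK) (fun x hx i => ?_) cΨ _ (fun x hx => ?_) hz
    · have := mΦ x hx (Equiv.swap i₀ j₀ i)
      rw [swl] at this; exact this
    · funext i
      have h1 := hl _ _ (hx (Equiv.swap i₀ j₀ i))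
      have h2 := swl i
      simp only [hΨ, Function.comp, permMap, ContinuousMap.coe_mk, hΦ]
      rw [h2] at h1 ⊢
      exact h1
  rw [e1, e2] at this
  exact this
end
end BCT

namespace BCT
open Topology Filter
set_option linter.unusedVariables false
set_option linter.unusedSimpArgs false
set_option linter.unusedSectionVars false

section
variable {A : Type} [TopologicalSpace A] {k : ℕ}

lemma permMap_comp (g h : Equiv.Perm (Fin k)) :
    (permMap g : C(Fin k → A, Fin k → A)).comp (permMap h) = permMap (h * g) := by
  ext x i; rfl

lemma permMap_one : (permMap 1 : C(Fin k → A, Fin k → A)) = ContinuousMap.id _ := by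
  ext x i; rfl

/-- the norm -/
noncomputable def Nm (A : Type) [TopologicalSpace A] (k : ℕ) : Ch (Fin k → A) →ₗ[ℚ] Ch (Fin k → A) :=
  ∑ g : Equiv.Perm (Fin k), cmap (permMap g)

lemma Nm_apply (x : Ch (Fin k → A)) : Nm A k x = ∑ g : Equiv.Perm (Fin k), cmap (permMap g) x := by
  simp [Nm]

lemma Nm_perm (h : Equiv.Perm (Fin k)) (x : Ch (Fin k → A)) : Nm A k (cmap (permMap h) x) = Nm A k x := by
  simp only [Nm_apply, cmap_cmap, permMap_comp]
  exact Fintype.sum_equiv (Equiv.mulLeft h) _ _ (fun g => rfl)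

lemma perm_Nm (h : Equiv.Perm (Fin k)) (x : Ch (Fin k → A)) : cmap (permMap h) (Nm A k x) = Nm A k x := by
  simp only [Nm_apply, map_sum, cmap_cmap, permMap_comp]
  exact Fintype.sum_equiv (Equiv.mulRight h) _ _ (fun g => rfl)

def PInv (W : Set (Fin k → A)) : Prop := ∀ (g : Equiv.Perm (Fin k)), ∀ x ∈ W, x ∘ g ∈ W

noncomputable def ND (A : Type) [TopologicalSpace A] (k : ℕ) : NData (Fin k → A) where
  N := Nm A k
  c := (k.factorial : ℚ)
  hc := by exact_mod_cast k.factorial_ne_zero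
  Inv := PInv
  NN x := by
    rw [Nm_apply (Nm A k x)]
    simp only [perm_Nm, Finset.sum_const, Finset.card_univ, Fintype.card_perm, Fintype.card_fin]
    rw [Nat.cast_smul_eq_nsmul]
  Nbd x := by simp only [Nm_apply, map_sum, bd_cmap]
  NS n W hW x hx := by
    rw [Nm_apply]
    exact Submodule.sum_mem _ fun g _ => cmap_mem_S _ (fun x hx => hW g x hx) hx
  inter A B hA hB g x hx := ⟨hA g x hx.1, hB g x hx.2⟩
  union A B hA hB g x hx := hx.imp (hA g x) (hB g x)
  empty g x hx := hx

/-- tuples with at least `r` distinct values -/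
def WW (A : Type) (k r : ℕ) : Set (Fin k → A) := {x | r ≤ (Set.range x).ncard}

lemma WW_inv (r : ℕ) : PInv (WW A k r) := by
  intro g x hx
  have : Set.range (x ∘ g) = Set.range x := by simp
  change r ≤ (Set.range (x ∘ g)).ncard
  rw [this]; exact hx

/-- labels -/
lemma ncard_lab {y x : Fin k → A} {B : A → Set A} (hB : (Set.range y).PairwiseDisjoint B) (hx : ∀ i, x i ∈ B (y i)) :
    (Set.range y).ncard ≤ (Set.range x).ncard ∧ ((Set.range x).ncard = (Set.range y).ncard → x ∈ Lset y A) := by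
  classical
  let l : A → A := fun p => if h : ∃ i, p ∈ B (y i) then y h.choose else p
  have hl : ∀ i, l (x i) = y i := by
    intro i
    have h : ∃ j, x i ∈ B (y j) := ⟨i, hx i⟩
    have : l (x i) = y h.choose := dif_pos h
    rw [this]
    by_contra hne
    exact Set.disjoint_left.1 (hB ⟨_, rfl⟩ ⟨_, rfl⟩ hne) h.choose_spec (hx i)
  have e : Set.range y = l '' Set.range x := by
    rw [← Set.range_comp]; congr 1; funext i; exact (hl i).symm
  refine ⟨by rw [e]; exact Set.ncard_image_le (Set.finite_range x), fun h => ?_⟩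
  rw [e] at h
  have hi := (Set.ncard_image_iff (Set.finite_range x)).1 h.symm
  intro i j hij
  exact hi ⟨i, rfl⟩ ⟨j, rfl⟩ (by rw [hl, hl, hij])

lemma ncard_L {y x : Fin k → A} (hx : x ∈ Lset y A) : (Set.range x).ncard ≤ (Set.range y).ncard := by
  classical
  let f : A → A := fun p => if h : ∃ i, y i = p then x h.choose else p
  have e : Set.range x = f '' Set.range y := by
    rw [← Set.range_comp]; congr 1; funext i
    have h : ∃ j, y j = y i := ⟨i, rfl⟩
    have : f (y i) = x h.choose := dif_pos h
    rw [Function.comp, this]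
    exact (hx _ _ h.choose_spec).symm
  rw [e]; exact Set.ncard_image_le (Set.finite_range y)

lemma exists_nbhd [T2Space A] (y : Fin k → A) {W : Set (Fin k → A)} (hW : IsOpen W) (hy : y ∈ W) :
    ∃ O : A → Set A, (∀ a, O a ∈ 𝓝 a) ∧ (Set.range y).PairwiseDisjoint O ∧ ∀ x, (∀ i, x i ∈ O (y i)) → x ∈ W := by
  obtain ⟨U, hU, hd⟩ := (Set.finite_range y).t2_separation
  have h1 : W ∈ 𝓝 y := hW.mem_nhds hy
  rw [nhds_pi, Filter.mem_pi'] at h1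
  obtain ⟨J, t, ht, hJ⟩ := h1
  refine ⟨fun a => U a ∩ {p | ∀ i, y i = a → p ∈ t i}, fun a => ?_, ?_, ?_⟩
  · refine Filter.inter_mem ((hU a).2.mem_nhds (hU a).1) ?_
    have : {p | ∀ i, y i = a → p ∈ t i} = ⋂ i, {p | y i = a → p ∈ t i} := by ext; simp
    rw [this, Filter.iInter_mem]
    intro i
    by_cases h : y i = a
    · subst h; simpa using ht i
    · simp [h]
  · intro a ha b hb hab
    exact (hd ha hb hab).mono Set.inter_subset_left Set.inter_subset_left
  · intro x hx
    exact hJ fun i _ => (hx i).2 i rfl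

lemma WW_open [T2Space A] (r : ℕ) : IsOpen (WW A k r) := by
  rw [isOpen_iff_mem_nhds]
  intro y hy
  obtain ⟨O, hO, hd, -⟩ := exists_nbhd y isOpen_univ trivial
  have : Set.pi Set.univ (fun i => O (y i)) ∈ 𝓝 y := set_pi_mem_nhds Set.finite_univ fun i _ => hO _
  filter_upwards [this] with x hx
  exact le_trans hy (ncard_lab hd fun i => hx i trivial).1

instance simp_conn (n : ℕ) : PreconnectedSpace (Simp n) :=
  Subtype.preconnectedSpace (convex_stdSimplex ℝ (Fin (n+1))).isPreconnected

/-- Orbit assembly -/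
lemma exists_theta (y : Fin k → A) (B : A → Set A) (hBo : ∀ a, IsOpen (B a)) (hd : (Set.range y).PairwiseDisjoint B) :
    ∃ γ : (Fin k → A) → Equiv.Perm (Fin k),
      ContinuousOn (fun x => x ∘ γ x) {x : Fin k → A | ∃ g : Equiv.Perm (Fin k), ∀ i, x (g i) ∈ B (y i)} ∧
      (∀ x ∈ {x : Fin k → A | ∃ g : Equiv.Perm (Fin k), ∀ i, x (g i) ∈ B (y i)}, ∀ i, x (γ x i) ∈ B (y i)) ∧
      ∀ n, ∀ z ∈ S n {x : Fin k → A | ∃ g : Equiv.Perm (Fin k), ∀ i, x (g i) ∈ B (y i)},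
        Nm A k (pmap (fun x => x ∘ γ x) z) = Nm A k z := by
  classical
  set W : Set (Fin k → A) := {x | ∃ g : Equiv.Perm (Fin k), ∀ i, x (g i) ∈ B (y i)} with hW
  let T : (Fin k → A) → Set (Equiv.Perm (Fin k)) := fun x => {g | ∀ i, x (g i) ∈ B (y i)}
  let G : Set (Equiv.Perm (Fin k)) → Equiv.Perm (Fin k) := fun s => if h : s.Nonempty then h.choose else 1
  have hG : ∀ x ∈ W, G (T x) ∈ T x := by
    intro x hx
    have h : (T x).Nonempty := hx
    have : G (T x) = h.choose := dif_pos h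
    rw [this]; exact h.choose_spec
  have hT : ∀ (g : Equiv.Perm (Fin k)) x, g ∈ T x → T x = {h | ∀ i, y (g⁻¹ (h i)) = y i} := by
    intro g x hg
    ext h
    constructor
    · intro hh i
      by_contra hne
      have h1 := hg (g⁻¹ (h i))
      simp only [Equiv.Perm.inv_def, Equiv.apply_symm_apply] at h1
      exact Set.disjoint_left.1 (hd ⟨_, rfl⟩ ⟨_, rfl⟩ hne) h1 (hh i)
    · intro hh i
      have h1 := hg (g⁻¹ (h i))
      rw [Equiv.Perm.inv_def, Equiv.apply_symm_apply, ← Equiv.Perm.inv_def, hh i] at h1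
      exact h1
  have hloc : ∀ x ∈ W, ∀ᶠ x' in 𝓝 x, T x' = T x := by
    intro x ⟨g, hg⟩
    have : ∀ᶠ x' in 𝓝 x, ∀ i, x' (g i) ∈ B (y i) := by
      rw [Filter.eventually_all]
      intro i
      exact (continuous_apply (g i)).continuousAt.eventually ((hBo _).mem_nhds (hg i))
    filter_upwards [this] with x' hx'
    rw [hT g x hg, hT g x' hx']
  have hc : ContinuousOn (fun x => x ∘ G (T x)) W := by
    intro x hx
    have h1 : ContinuousAt (fun x' : Fin k → A => x' ∘ G (T x)) x := by
      apply Continuous.continuousAt; fun_prop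
    refine (h1.congr ?_).continuousWithinAt
    filter_upwards [hloc x hx] with x' hx'
    rw [hx']
  refine ⟨fun x => G (T x), hc, hG, ?_⟩
  intro n z hz
  refine S_congr (Nm A k ∘ₗ pmap (fun x => x ∘ G (T x))) (Nm A k) (fun σ hσ => ?_) hz
  simp only [LinearMap.comp_apply]
  rw [pmap_sg _ _ (pmap_cont hc σ hσ)]
  have hconst : ∀ t t' : Simp n, T (σ t) = T (σ t') := by
    intro t t'
    have : IsLocallyConstant (fun t => T (σ t)) := by
      rw [IsLocallyConstant.iff_eventually_eq]
      intro t
      exact σ.continuous.continuousAt.eventually (hloc _ (hσ t))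
    exact this.apply_eq_of_preconnectedSpace t t'
  let t0 : Simp n := stdSimplex.vertex 0
  have : (sg ⟨n, ⟨(fun x => x ∘ G (T x)) ∘ σ, pmap_cont hc σ hσ⟩⟩ : Ch (Fin k → A)) =
      cmap (permMap (G (T (σ t0)))) (sg ⟨n, σ⟩) := by
    rw [cmap_sg]
    congr 2
    ext t i
    change σ t (G (T (σ t)) i) = σ t (G (T (σ t0)) i)
    rw [hconst t t0]
  exact (congrArg _ this).trans (Nm_perm _ _)
end

section
variable {d : ℕ} {M : Type} [TopologicalSpace M] {H' : Type} [TopologicalSpace H'] (I : ModelWithCorners ℝ (VV d) H')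
  [ChartedSpace H' M] [T2Space M] {k : ℕ}

include I in
lemma P_local (hd : Odd d) (r : ℕ) (hr : r < k) (W : Set (Fin k → M)) (hW : IsOpen W) (iW : PInv W)
    (hWr : W ⊆ WW M k r) (y : Fin k → M) (hy : y ∈ W) : ∃ W', IsOpen W' ∧ PInv W' ∧ y ∈ W' ∧ W' ⊆ W ∧
      ∀ n, (ND M k).P (WW M k (r+1)) n W' := by
  by_cases hy1 : y ∈ WW M k (r+1)
  · refine ⟨W ∩ WW M k (r+1), hW.inter (WW_open _), (ND M k).inter _ _ iW (WW_inv _), ⟨hy, hy1⟩, Set.inter_subset_left, ?_⟩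
    intro n z hz _
    refine ⟨0, Submodule.zero_mem _, ?_⟩
    rw [map_zero, sub_zero]
    refine S_mono ?_ ((ND M k).NS n _ ((ND M k).inter _ _ iW (WW_inv _)) z hz)
    exact fun x hx => ⟨hx, hx.2⟩
  have hyr : (Set.range y).ncard = r := by
    have h1 : r ≤ (Set.range y).ncard := hWr hy
    have h2 : ¬ (r + 1 ≤ (Set.range y).ncard) := hy1
    omega
  have hni : ¬ Function.Injective y := by
    intro hi
    have := Set.ncard_univ (Fin k) ▸ Set.ncard_image_of_injective Set.univ hi
    rw [Set.image_univ, hyr, Nat.card_eq_fintype_card, Fintype.card_fin] at this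
    omega
  obtain ⟨i₀, j₀, hij, hne⟩ : ∃ i j, y i = y j ∧ i ≠ j := by
    simpa [Function.Injective] using hni
  obtain ⟨O, hO, hOd, hOW⟩ := exists_nbhd y hW hy
  choose φ ψ B K hBo hzB hBO hK hKi hφ hψ hφc hψc hl hrr using fun z => exists_chart I z (O z) (hO z)
  have hBd : (Set.range y).PairwiseDisjoint B := fun a ha b hb hab => (hOd ha hb hab).mono (hBO a) (hBO b)
  obtain ⟨γ, hγc, hγB, hγN⟩ := exists_theta y B hBo hBd
  set W' : Set (Fin k → M) := {x | ∃ g : Equiv.Perm (Fin k), ∀ i, x (g i) ∈ B (y i)} with hW'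
  set BB : Set (Fin k → M) := {x | ∀ i, x i ∈ B (y i)} with hBB
  have hBW' : BB ⊆ W' := fun x hx => ⟨1, hx⟩
  have iW' : PInv W' := by
    rintro h x ⟨g, hg⟩
    refine ⟨h⁻¹ * g, fun i => ?_⟩
    simpa using hg i
  have hBL : BB ∩ WW M k (r+1) = BB \ Lset y M := by
    ext x; constructor
    · rintro ⟨h1, h2⟩
      refine ⟨h1, fun h3 => ?_⟩
      have := ncard_L h3
      have h2 : r + 1 ≤ (Set.range x).ncard := h2
      omega
    · rintro ⟨h1, h2⟩
      refine ⟨h1, ?_⟩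
      have h3 := ncard_lab hBd h1
      change r + 1 ≤ (Set.range x).ncard
      rcases h3.1.lt_or_eq with h4 | h4
      · omega
      · exact absurd (h3.2 h4.symm) h2
  refine ⟨W', ?_, iW', ⟨1, fun i => hzB (y i)⟩, ?_, ?_⟩
  · have : W' = ⋃ g : Equiv.Perm (Fin k), ⋂ i, {x | x (g i) ∈ B (y i)} := by
      ext x; simp [hW']
    rw [this]
    exact isOpen_iUnion fun g => isOpen_iInter_of_finite fun i => (hBo _).preimage (continuous_apply _)
  · rintro x ⟨g, hg⟩
    have := iW g⁻¹ _ (hOW (x ∘ g) fun i => hBO _ (hg i))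
    have e : (x ∘ g) ∘ ⇑g⁻¹ = x := by funext i; simp
    rwa [e] at this
  intro n z hz hbz
  set θ : Ch (Fin k → M) →ₗ[ℚ] Ch (Fin k → M) := pmap (fun x => x ∘ γ x) with hθ
  have hθz : θ z ∈ S n BB := pmap_mem_S (W' := BB) hγc (fun x hx => hγB x hx) hz
  have hθb : bd (θ z) ∈ Sd n (BB \ Lset y M) := by
    rw [hθ, bd_pmap hγc hz, ← hBL]
    refine Sd_map _ (fun n x hx => pmap_mem_S (hγc.mono Set.inter_subset_left) (fun x hx => ?_) hx) hbz
    exact ⟨hγB x hx.1, WW_inv _ _ _ hx.2⟩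
  obtain ⟨b, hb, hb'⟩ := local_mfld hd hne hij φ ψ B K hK hKi hφ hψ hφc hψc hl hrr n (θ z) hθz hθb
  refine ⟨(2⁻¹ : ℚ) • (ND M k).N b, Submodule.smul_mem _ _ ((ND M k).NS _ _ iW' _ (S_mono hBW' hb)), ?_⟩
  have h1 := (ND M k).NS n _ ((ND M k).inter _ _ iW' (WW_inv (r+1))) _ (S_mono (W' := W' ∩ WW M k (r+1)) (by
    rw [← hBL]; exact Set.inter_subset_inter_left _ hBW') hb')
  have h2 : (ND M k).N (cmap (permMap (Equiv.swap i₀ j₀)) (θ z)) = (ND M k).N z := (Nm_perm _ _).trans (hγN n z hz)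
  have h3 : (ND M k).N (θ z) = (ND M k).N z := hγN n z hz
  rw [map_sub, map_add, h2, h3, ← (ND M k).Nbd] at h1
  have h4 := Submodule.smul_mem _ (2⁻¹ : ℚ) h1
  have e : (2⁻¹ : ℚ) • ((ND M k).N z + (ND M k).N z - bd ((ND M k).N b)) = (ND M k).N z - bd ((2⁻¹ : ℚ) • (ND M k).N b) := by
    rw [map_smul]; module
  rwa [e] at h4

include I in
theorem Q_main (hd : Odd d) : (ND M k).Q Set.univ {x | Function.Injective x} := by
  have step : ∀ r, r ≤ k → (ND M k).Q Set.univ (WW M k r) := by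
    intro r
    induction r with
    | zero =>
      intro _
      have : WW M k 0 = Set.univ := by ext x; simp [WW]
      rw [this]
      exact (ND M k).Q_refl _ (fun g x _ => trivial)
    | succ r ih =>
      intro hr
      have hsub : WW M k (r+1) ⊆ WW M k r := fun x hx => le_trans (Nat.le_succ r) hx
      refine (ND M k).Q_trans (fun g x _ => trivial) (WW_inv _) (Set.subset_univ _) hsub (ih (by omega)) ?_
      refine (ND M k).Q_of_P hsub fun n => ?_
      exact (ND M k).P_all (WW_open _) (WW_inv _) (U := WW M k r)
        (fun W hW iW hWU y hy => P_local I hd r (by omega) W hW iW hWU y hy) n _ (WW_open _) (WW_inv _) le_rfl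
  have e : {x : Fin k → M | Function.Injective x} = WW M k k := by
    ext x; constructor
    · intro hi
      have := Set.ncard_univ (Fin k) ▸ Set.ncard_image_of_injective Set.univ hi
      rw [Set.image_univ, Nat.card_eq_fintype_card, Fintype.card_fin] at this
      exact this.ge
    · intro (hx : k ≤ (Set.range x).ncard)
      rw [← Set.image_univ] at hx
      have h1 : (x '' Set.univ).ncard = (Set.univ : Set (Fin k)).ncard := by
        apply le_antisymm (Set.ncard_image_le Set.finite_univ)
        rw [Set.ncard_univ, Nat.card_eq_fintype_card, Fintype.card_fin]; exact hx
      exact Set.injOn_univ.1 ((Set.ncard_image_iff Set.finite_univ).1 h1)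
  rw [e]; exact step k le_rfl
end
end BCT

namespace BCT
open Topology Filter
set_option linter.unusedVariables false
set_option linter.unusedSimpArgs false
set_option linter.unusedSectionVars false

section
variable (M : Type) [TopologicalSpace M] (k : ℕ)

abbrev FC := {f : Fin k → M // Function.Injective f}

variable {M k}

def fcPerm (g : Equiv.Perm (Fin k)) : C(FC M k, FC M k) :=
  ⟨fun x => ⟨x.1 ∘ g, x.2.comp g.injective⟩,
    by
      refine Continuous.subtype_mk ?_ _
      exact (permMap g).continuous.comp continuous_subtype_val⟩

def fcPi : C(FC M k, UnordConfigSpace M k) := ⟨fun x => Quotient.mk _ x, continuous_quotient_mk'⟩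

def fcInc : C(FC M k, Fin k → M) := ⟨fun x => x.1, continuous_subtype_val⟩

@[reducible] def fcAct : MulAction (Equiv.Perm (Fin k)) (FC M k) where
  smul g x := ⟨x.1 ∘ ⇑g⁻¹, x.2.comp (g⁻¹).injective⟩
  one_smul x := rfl
  mul_smul g h x := by
    apply Subtype.ext
    change x.1 ∘ ⇑(g * h)⁻¹ = (x.1 ∘ ⇑h⁻¹) ∘ ⇑g⁻¹
    rw [mul_inv_rev]; rfl

lemma fcPi_perm (g : Equiv.Perm (Fin k)) : (fcPi (M := M) (k := k)).comp (fcPerm g) = fcPi := by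
  ext x
  apply Quotient.sound
  exact ⟨g⁻¹, by funext i; simp [fcPerm]⟩

lemma fc_lift_unique [T2Space M] {n : ℕ} (σ τ : C(Simp n, FC M k)) (h : fcPi.comp σ = fcPi.comp τ) :
    ∃ g, τ = (fcPerm g).comp σ := by
  have h1 : ∀ t, ∃ g : Equiv.Perm (Fin k), (σ t).1 ∘ g = (τ t).1 := fun t =>
    Quotient.exact (DFunLike.congr_fun h t)
  choose γ hγ using h1
  have hu : ∀ t (g : Equiv.Perm (Fin k)), (σ t).1 ∘ g = (τ t).1 → γ t = g := by
    intro t g hg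
    ext i
    rw [← hγ t] at hg
    exact congrArg _ ((σ t).2 (congrFun hg i).symm)
  have hcl : ∀ g, IsClosed (γ ⁻¹' {g}) := by
    intro g
    have : γ ⁻¹' {g} = {t | fcPerm g (σ t) = τ t} := by
      ext t; constructor
      · rintro rfl; exact Subtype.ext (hγ t)
      · intro ht; exact hu t g (congrArg Subtype.val ht)
    rw [this]
    exact isClosed_eq (by fun_prop) (by fun_prop)
  have hlc : IsLocallyConstant γ := by
    rw [IsLocallyConstant.iff_isOpen_fiber]
    intro g
    have : γ ⁻¹' {g} = (⋃ h ∈ {h | h ≠ g}, γ ⁻¹' {h})ᶜ := by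
      ext t
      simp only [Set.mem_preimage, Set.mem_singleton_iff, Set.mem_compl_iff, Set.mem_iUnion, not_exists]
      constructor
      · intro h1 h h2 h3
        exact h2 (h3.symm.trans h1)
      · intro h1
        by_contra h2
        exact h1 _ h2 rfl
    rw [this, isOpen_compl_iff]
    exact (Set.toFinite _).isClosed_biUnion fun h _ => hcl h
  let t0 : Simp n := stdSimplex.vertex 0
  refine ⟨γ t0, ?_⟩
  ext t : 1
  apply Subtype.ext
  rw [← hγ t, hlc.apply_eq_of_preconnectedSpace t t0]
  rfl

lemma fc_covering [T2Space M] : IsCoveringMap (fcPi (M := M) (k := k)) := by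
  let _ := fcAct (M := M) (k := k)
  have : IsQuotientCoveringMap (fcPi (M := M) (k := k)) (Equiv.Perm (Fin k)) := by
    refine { toIsQuotientMap := isQuotientMap_quotient_mk', continuous_const_smul := ?_, apply_eq_iff_mem_orbit := ?_, disjoint := ?_ }
    · intro g
      exact (fcPerm g⁻¹).continuous
    · intro x y
      constructor
      · intro h
        obtain ⟨g, hg⟩ := Quotient.exact h
        refine ⟨g, Subtype.ext ?_⟩
        change y.1 ∘ ⇑g⁻¹ = x.1
        rw [← hg]; funext i; simp
      · rintro ⟨g, rfl⟩
        apply Quotient.sound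
        exact ⟨g, by change (y.1 ∘ ⇑g⁻¹) ∘ g = y.1; funext i; simp⟩
    · intro e
      obtain ⟨O, hO, hd, -⟩ := exists_nbhd e.1 isOpen_univ trivial
      refine ⟨{x | ∀ i, x.1 i ∈ O (e.1 i)}, ?_, ?_⟩
      · have : ∀ᶠ x in 𝓝 e, ∀ i, x.1 i ∈ O (e.1 i) := by
          rw [Filter.eventually_all]
          intro i
          have hc : Continuous (fun x : FC M k => x.1 i) := (continuous_apply i).comp continuous_subtype_val
          exact hc.continuousAt.eventually (hO _)
        exact this
      · rintro g ⟨_, ⟨x, hx, rfl⟩, hx'⟩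
        ext i
        have h1 : x.1 (g⁻¹ i) ∈ O (e.1 i) := hx' i
        have h2 := hx (g⁻¹ i)
        by_contra hne
        have h3 : e.1 i ≠ e.1 (g⁻¹ i) := by
          intro h4
          have := e.2 h4
          apply hne
          have h5 := congrArg g this
          simp only [Equiv.Perm.inv_def, Equiv.apply_symm_apply] at h5
          rw [h5]; rfl
        exact Set.disjoint_left.1 (hd ⟨_, rfl⟩ ⟨_, rfl⟩ h3) h1 h2
  exact this.isCoveringMap

lemma fc_lift [T2Space M] {n : ℕ} (σ : C(Simp n, UnordConfigSpace M k)) : ∃ τ : C(Simp n, FC M k), fcPi.comp τ = σ := by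
  obtain ⟨e₀, he⟩ := Quotient.exists_rep ((σ.comp (ret n)) 0)
  obtain ⟨F, ⟨-, hF⟩, -⟩ := (fc_covering (M := M) (k := k)).existsUnique_continuousMap_lifts (σ.comp (ret n)) 0 e₀ he
  refine ⟨F.comp (iot n), ?_⟩
  rw [← comp_ret_iot n σ]
  ext t
  exact congrFun hF (iot n t)

/-- norm on the ordered configuration space -/
noncomputable def NF (M : Type) [TopologicalSpace M] (k : ℕ) : Ch (FC M k) →ₗ[ℚ] Ch (FC M k) :=
  ∑ g : Equiv.Perm (Fin k), cmap (fcPerm g)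

lemma NF_apply (x : Ch (FC M k)) : NF M k x = ∑ g : Equiv.Perm (Fin k), cmap (fcPerm g) x := by
  simp [NF]

lemma NF_perm (h : Equiv.Perm (Fin k)) (x : Ch (FC M k)) : NF M k (cmap (fcPerm h) x) = NF M k x := by
  simp only [NF_apply, cmap_cmap]
  exact Fintype.sum_equiv (Equiv.mulLeft h) _ _ (fun g => rfl)

lemma inc_NF (x : Ch (FC M k)) : cmap fcInc (NF M k x) = Nm M k (cmap fcInc x) := by
  simp only [NF_apply, Nm_apply, map_sum, cmap_cmap]
  rfl

theorem exists_transfer [T2Space M] : ∃ t : Ch (UnordConfigSpace M k) →ₗ[ℚ] Ch (FC M k),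
    (∀ x, bd (t x) = t (bd x)) ∧ (∀ n, ∀ x ∈ S n Set.univ, t x ∈ S n Set.univ) ∧
    (∀ x, cmap fcPi (t x) = (k.factorial : ℚ) • x) ∧ (∀ x, t (cmap fcPi x) = NF M k x) := by
  choose L hL using fun σ : Smp (UnordConfigSpace M k) => fc_lift σ.2
  let t : Ch (UnordConfigSpace M k) →ₗ[ℚ] Ch (FC M k) := Finsupp.linearCombination ℚ fun σ => NF M k (sg ⟨σ.1, L σ⟩)
  have ht : ∀ n (σ : C(Simp n, FC M k)), t (sg ⟨n, fcPi.comp σ⟩) = NF M k (sg ⟨n, σ⟩) := by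
    intro n σ
    rw [show t (sg ⟨n, fcPi.comp σ⟩) = NF M k (sg ⟨n, L ⟨n, fcPi.comp σ⟩⟩) from lift_sg _ _]
    obtain ⟨g, hg⟩ := fc_lift_unique σ (L ⟨n, fcPi.comp σ⟩) (hL ⟨n, fcPi.comp σ⟩).symm
    rw [hg, ← NF_perm g (sg ⟨n, σ⟩), cmap_sg]
  have hrep : ∀ σ : Smp (UnordConfigSpace M k), ∃ τ : C(Simp σ.1, FC M k), σ = ⟨σ.1, fcPi.comp τ⟩ :=
    fun σ => ⟨L σ, by rw [hL σ]⟩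
  have hNFbd : ∀ x, bd (NF M k x) = NF M k (bd x) := by
    intro x; simp only [NF_apply, map_sum, bd_cmap]
  have h4 : ∀ x, t (cmap fcPi x) = NF M k x := by
    intro x
    have : t ∘ₗ cmap fcPi = NF M k := Ch.hom_ext fun σ => by
      rw [LinearMap.comp_apply, cmap_sg, ht]
    exact LinearMap.congr_fun this x
  refine ⟨t, ?_, ?_, ?_, h4⟩
  · intro x
    have : bd ∘ₗ t = t ∘ₗ bd := Ch.hom_ext fun σ => by
      obtain ⟨τ, hτ⟩ := hrep σ
      rw [hτ]
      simp only [LinearMap.comp_apply]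
      have e : (sg ⟨σ.1, fcPi.comp τ⟩ : Ch (UnordConfigSpace M k)) = cmap fcPi (sg ⟨σ.1, τ⟩) := by rw [cmap_sg]
      rw [e, bd_cmap, h4, h4, hNFbd]
    exact LinearMap.congr_fun this x
  · intro n x hx
    refine S_map t _ (fun σ _ => ?_) hx
    rw [show t (sg ⟨n, σ⟩) = NF M k (sg ⟨n, L ⟨n, σ⟩⟩) from lift_sg _ _, NF_apply]
    exact Submodule.sum_mem _ fun g _ => cmap_mem_S (W := Set.univ) (W' := Set.univ) _ (fun x hx => trivial) (sg_mem_S' _)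
  · intro x
    have : cmap fcPi ∘ₗ t = (k.factorial : ℚ) • LinearMap.id := Ch.hom_ext fun σ => by
      obtain ⟨τ, hτ⟩ := hrep σ
      rw [hτ]
      simp only [LinearMap.comp_apply, LinearMap.smul_apply, LinearMap.id_apply]
      rw [ht, NF_apply, map_sum]
      simp only [cmap_cmap, fcPi_perm]
      simp only [cmap_sg, Finset.sum_const, Finset.card_univ, Fintype.card_perm, Fintype.card_fin]
      rw [Nat.cast_smul_eq_nsmul]
    exact LinearMap.congr_fun this x

lemma inc_inj : Function.Injective (cmap (fcInc (M := M) (k := k))) := by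
  have : (cmap (fcInc (M := M) (k := k)) : Ch (FC M k) → Ch (Fin k → M)) = Finsupp.mapDomain (fun σ : Smp (FC M k) => (⟨σ.1, fcInc.comp σ.2⟩ : Smp (Fin k → M))) := by
    funext x
    have : cmap (fcInc (M := M) (k := k)) = Finsupp.lmapDomain ℚ ℚ (fun σ : Smp (FC M k) => (⟨σ.1, fcInc.comp σ.2⟩ : Smp (Fin k → M))) :=
      Ch.hom_ext fun σ => by rw [cmap_sg]; simp [sg]
    rw [this]; rfl
  rw [this]
  apply Finsupp.mapDomain_injective
  rintro ⟨n, σ⟩ ⟨m, τ⟩ h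
  obtain rfl : n = m := congrArg Sigma.fst h
  simp only [Sigma.mk.injEq, heq_eq_eq, true_and] at h
  congr 1
  ext t : 1
  exact Subtype.ext (DFunLike.congr_fun h t)

lemma inc_surj {n : ℕ} {x : Ch (Fin k → M)} (hx : x ∈ S n {x : Fin k → M | Function.Injective x}) :
    ∃ f ∈ S n (Set.univ : Set (FC M k)), cmap fcInc f = x := by
  have : S n {x : Fin k → M | Function.Injective x} ≤ (S n (Set.univ : Set (FC M k))).map (cmap fcInc) := by
    rw [S_eq_span, Submodule.span_le]
    rintro _ ⟨σ, hσ, rfl⟩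
    refine ⟨sg ⟨n, ⟨fun t => ⟨σ t, hσ t⟩, by fun_prop⟩⟩, sg_mem_S' _, ?_⟩
    rw [cmap_sg]; rfl
  exact this hx
end
end BCT

namespace BCT
open Topology Filter
open scoped TensorProduct
set_option linter.unusedVariables false
set_option linter.unusedSimpArgs false
set_option linter.unusedSectionVars false

/-- k-fold tensor power -/
abbrev TP (k : ℕ) (C : Type) [AddCommGroup C] [Module ℚ C] : Type := ⨂[ℚ] _ : Fin k, C

section
variable {k : ℕ} {C D : Type} [AddCommGroup C] [Module ℚ C] [AddCommGroup D] [Module ℚ D]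

/-- tensor product of linear maps -/
noncomputable def tm (f : Fin k → C →ₗ[ℚ] D) : TP k C →ₗ[ℚ] TP k D := PiTensorProduct.map f

lemma tm_tprod (f : Fin k → C →ₗ[ℚ] D) (x : Fin k → C) :
    tm f (PiTensorProduct.tprod ℚ x) = PiTensorProduct.tprod ℚ (fun l => f l (x l)) :=
  PiTensorProduct.map_tprod _ _

lemma tm_comp {E : Type} [AddCommGroup E] [Module ℚ E] (g : Fin k → D →ₗ[ℚ] E) (f : Fin k → C →ₗ[ℚ] D) :
    tm g ∘ₗ tm f = tm (fun l => g l ∘ₗ f l) := (PiTensorProduct.map_comp _ _).symm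

lemma tm_mul (g f : Fin k → Module.End ℚ C) : tm g * tm f = tm (fun l => g l * f l) := tm_comp g f

lemma tm_one : tm (fun _ : Fin k => (1 : Module.End ℚ C)) = 1 := PiTensorProduct.map_id

lemma tp_ext {f g : TP k C →ₗ[ℚ] D} (h : ∀ x : Fin k → C, f (PiTensorProduct.tprod ℚ x) =
    g (PiTensorProduct.tprod ℚ x)) : f = g := by
  apply PiTensorProduct.ext
  ext x
  exact h x

lemma tm_add_at {f g h : Fin k → C →ₗ[ℚ] D} (j : Fin k) (hj : f j = g j + h j)
    (h1 : ∀ l, l ≠ j → f l = g l) (h2 : ∀ l, l ≠ j → f l = h l) : tm f = tm g + tm h := by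
  have e1 : g = Function.update f j (g j) := by
    funext l
    by_cases hl : l = j
    · subst hl; simp
    · simp [hl, h1 l hl]
  have e2 : h = Function.update f j (h j) := by
    funext l
    by_cases hl : l = j
    · subst hl; simp
    · simp [hl, h2 l hl]
  have e3 : f = Function.update f j (g j + h j) := by rw [← hj]; simp
  have := PiTensorProduct.map_update_add (R := ℚ) f j (g j) (h j)
  rw [← e1, ← e2, ← e3] at this
  exact this

lemma tm_smul_at {f g : Fin k → C →ₗ[ℚ] D} (j : Fin k) (c : ℚ) (hj : f j = c • g j)
    (h1 : ∀ l, l ≠ j → f l = g l) : tm f = c • tm g := by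
  have e1 : g = Function.update f j (g j) := by
    funext l
    by_cases hl : l = j
    · subst hl; simp
    · simp [hl, h1 l hl]
  have e3 : f = Function.update f j (c • g j) := by rw [← hj]; simp
  have := PiTensorProduct.map_update_smul (R := ℚ) f j c (g j)
  rw [← e1, ← e3] at this
  exact this

lemma tm_neg_at {f g : Fin k → C →ₗ[ℚ] D} (j : Fin k) (hj : f j = - g j)
    (h1 : ∀ l, l ≠ j → f l = g l) : tm f = - tm g := by
  rw [tm_smul_at j (-1) (by rw [hj]; module) h1]; module

/-- pattern a..a x 1..1 -/
def Wp (j : Fin k) (a x : Module.End ℚ C) (l : Fin k) : Module.End ℚ C :=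
  if l < j then a else if l = j then x else 1

lemma W_anti {j i : Fin k} (h : j < i) {a x a' x' : Module.End ℚ C} (h1 : a * a' = a' * a)
    (h2 : x * a' = - (a' * x)) :
    tm (Wp j a x) * tm (Wp i a' x') + tm (Wp i a' x') * tm (Wp j a x) = 0 := by
  rw [tm_mul, tm_mul, tm_neg_at (g := fun l => Wp i a' x' l * Wp j a x l) j, neg_add_cancel]
  · simp [Wp, h, h2]
  · intro l hl
    simp only [Wp]
    rcases lt_trichotomy l j with h' | h' | h'
    · simp [h', h'.trans h, h1]
    · exact absurd h' hl
    · simp [not_lt.2 h'.le, h'.ne']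

noncomputable def tbd (s d : Module.End ℚ C) : Module.End ℚ (TP k C) := ∑ j : Fin k, tm (Wp j s d)

lemma tbd_tbd {s d : Module.End ℚ C} (hd : d * d = 0) (hsd : d * s = - (s * d)) :
    (tbd s d : Module.End ℚ (TP k C)) * tbd s d = 0 := by
  have h : (tbd s d : Module.End ℚ (TP k C)) * tbd s d + tbd s d * tbd s d = 0 := by
    simp only [tbd, Finset.sum_mul_sum]
    nth_rewrite 2 [Finset.sum_comm]
    rw [← Finset.sum_add_distrib]
    refine Finset.sum_eq_zero fun i _ => ?_
    rw [← Finset.sum_add_distrib]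
    refine Finset.sum_eq_zero fun j _ => ?_
    rcases lt_trichotomy i j with h | h | h
    · exact W_anti h rfl hsd
    · subst h
      have : tm (Wp i s d) * tm (Wp i s d) = 0 := by
        rw [tm_mul, tm_smul_at (g := fun l => Wp i s d l * Wp i s d l) i 0, zero_smul]
        · simp [Wp, hd]
        · intros; rfl
      rw [this, add_zero]
    · rw [add_comm]; exact W_anti h rfl hsd
  rwa [← two_smul ℚ, smul_eq_zero_iff_right (by norm_num)] at h

lemma tm_chain {s d : Module.End ℚ C} {s' d' : Module.End ℚ D} (g : Fin k → C →ₗ[ℚ] D)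
    (hs : ∀ l, g l ∘ₗ s = s' ∘ₗ g l) (hd : ∀ l, g l ∘ₗ d = d' ∘ₗ g l) :
    tm g ∘ₗ tbd s d = tbd s' d' ∘ₗ tm g := by
  apply tp_ext
  intro x
  simp only [tbd, LinearMap.comp_apply, LinearMap.sum_apply, map_sum]
  refine Finset.sum_congr rfl fun j _ => ?_
  rw [← LinearMap.comp_apply, ← LinearMap.comp_apply, tm_comp, tm_comp]
  congr 2
  funext l
  simp only [Wp]
  split_ifs
  · exact hs l
  · exact hd l
  · rfl

/-- tensor homotopy -/
noncomputable def thom (s f h : Module.End ℚ C) : Module.End ℚ (TP k C) :=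
  ∑ j : Fin k, tm (Wp j (f * s) h)

lemma thom_bd {s d f h : Module.End ℚ C} (hss : s * s = 1) (hsd : d * s = - (s * d))
    (hfs : f * s = s * f) (hfd : d * f = f * d) (hhs : h * s = - (s * h))
    (hh : d * h + h * d = 1 - f) :
    (tbd s d : Module.End ℚ (TP k C)) * thom s f h + thom s f h * tbd s d = 1 - tm (fun _ => f) := by
  have hY : ∀ j : Fin k, tm (Wp j s d) * tm (Wp j (f * s) h) + tm (Wp j (f * s) h) * tm (Wp j s d) =
      tm (fun l : Fin k => if (l:ℕ) < j then f else 1) -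
      tm (fun l : Fin k => if (l:ℕ) < j+1 then f else 1) := by
    intro j
    rw [eq_sub_iff_add_eq, tm_mul, tm_mul]
    have e1 : s * (f * s) = f := by rw [hfs, ← mul_assoc, hss, one_mul]
    have e2 : f * s * s = f := by rw [mul_assoc, hss, mul_one]
    have e0 : tm (fun l => Wp j s d l * Wp j (f * s) h l) + tm (fun l => Wp j (f * s) h l * Wp j s d l)
        = tm (Wp j f (1 - f)) := by
      symm
      apply tm_add_at j
      · simp [Wp, hh]
      · intro l hl; simp only [Wp, if_neg hl]; split_ifs <;> simp [e1]
      · intro l hl; simp only [Wp, if_neg hl]; split_ifs <;> simp [e2]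
    rw [e0]
    symm
    apply tm_add_at j
    · simp [Wp]
    · intro l hl; simp only [Wp, if_neg hl, Fin.lt_def]
    · intro l hl
      have : (l:ℕ) ≠ j := fun h => hl (Fin.ext h)
      have h2 : (l:ℕ) < j ↔ (l:ℕ) < j + 1 := by omega
      simp only [h2]
  have hsum : (tbd s d : Module.End ℚ (TP k C)) * thom s f h + thom s f h * tbd s d =
      ∑ j : Fin k, (tm (Wp j s d) * tm (Wp j (f * s) h) + tm (Wp j (f * s) h) * tm (Wp j s d)) := by
    simp only [tbd, thom, Finset.sum_mul_sum]
    nth_rewrite 2 [Finset.sum_comm]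
    rw [← Finset.sum_add_distrib]
    refine Finset.sum_congr rfl fun i _ => ?_
    rw [← Finset.sum_add_distrib]
    refine Finset.sum_eq_single i (fun j _ hj => ?_) (by simp)
    rcases lt_trichotomy i j with h' | h' | h'
    · refine W_anti h' ?_ ?_
      · rw [hfs, mul_assoc, hfs]
      · rw [← mul_assoc, hfd, mul_assoc, hsd, mul_neg, mul_assoc]
    · exact absurd h'.symm hj
    · rw [add_comm]
      refine W_anti h' ?_ hhs
      rw [hfs, mul_assoc, hfs]
  rw [hsum, Finset.sum_congr rfl (fun j _ => hY j)]
  rw [Fin.sum_univ_eq_sum_range (fun j => tm (fun l : Fin k => if (l:ℕ) < j then f else 1) -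
      tm (fun l : Fin k => if (l:ℕ) < j+1 then f else 1)) k, Finset.sum_range_sub']
  congr 1
  · simp only [Nat.not_lt_zero, if_false]; exact tm_one
  · simp only [Fin.is_lt, if_true]

/-- reindexing -/
noncomputable def rx (g : Equiv.Perm (Fin k)) : TP k C →ₗ[ℚ] TP k C :=
  (PiTensorProduct.reindex ℚ (fun _ : Fin k => C) g).toLinearMap

lemma rx_tprod (g : Equiv.Perm (Fin k)) (x : Fin k → C) :
    rx g (PiTensorProduct.tprod ℚ x) = PiTensorProduct.tprod ℚ (fun l => x (g.symm l)) :=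
  PiTensorProduct.reindex_tprod _ _

lemma tm_rx (g : Equiv.Perm (Fin k)) (f : Fin k → C →ₗ[ℚ] D) :
    tm f ∘ₗ rx g = rx g ∘ₗ tm (fun l => f (g l)) := by
  apply tp_ext
  intro x
  simp only [LinearMap.comp_apply, rx_tprod, tm_tprod, Equiv.apply_symm_apply]

/-- a at i, b at j -/
def Ep (i j : Fin k) (a b : Module.End ℚ C) (l : Fin k) : Module.End ℚ C :=
  if l = i then a else if l = j then b else 1

/-- sign operator -/
noncomputable def sop (s : Module.End ℚ C) (i j : Fin k) : Module.End ℚ (TP k C) :=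
  (2⁻¹ : ℚ) • (1 + tm (Ep i j s 1) + tm (Ep i j 1 s) - tm (Ep i j s 1) * tm (Ep i j 1 s))

/-- signed swap -/
noncomputable def tau (s : Module.End ℚ C) (i j : Fin k) : Module.End ℚ (TP k C) :=
  rx (Equiv.swap i j) ∘ₗ sop s i j

lemma tm_sop {s : Module.End ℚ C} {s' : Module.End ℚ D} (g : Fin k → C →ₗ[ℚ] D)
    (hs : ∀ l, g l ∘ₗ s = s' ∘ₗ g l) (i j : Fin k) :
    tm g ∘ₗ sop s i j = sop s' i j ∘ₗ tm g := by
  have h : ∀ b : Bool, tm g ∘ₗ tm (Ep i j (if b then s else 1) (if b then 1 else s)) =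
      tm (Ep i j (if b then s' else 1) (if b then 1 else s')) ∘ₗ tm g := by
    intro b
    rw [tm_comp, tm_comp]
    congr 1
    funext l
    cases b <;> simp only [Ep] <;> split_ifs <;> first | exact hs l | rfl
  have h1 := h true
  have h2 := h false
  simp only [if_true, Bool.false_eq_true, if_false] at h1 h2
  have h3 : tm g ∘ₗ (tm (Ep i j s 1) * tm (Ep i j 1 s)) =
      (tm (Ep i j s' 1) * tm (Ep i j 1 s')) ∘ₗ tm g := by
    rw [Module.End.mul_eq_comp, ← LinearMap.comp_assoc, h1, LinearMap.comp_assoc, h2]; rfl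
  simp only [sop, LinearMap.comp_smul, LinearMap.smul_comp, LinearMap.comp_sub, LinearMap.sub_comp,
    LinearMap.comp_add, LinearMap.add_comp, h1, h2, h3]
  rfl

lemma tm_tau {s : Module.End ℚ C} {s' : Module.End ℚ D} (g : Fin k → C →ₗ[ℚ] D)
    (hs : ∀ l, g l ∘ₗ s = s' ∘ₗ g l) (i j : Fin k) :
    tm g ∘ₗ tau s i j = tau s' i j ∘ₗ tm (fun l => g (Equiv.swap i j l)) := by
  rw [tau, tau, ← LinearMap.comp_assoc, tm_rx, LinearMap.comp_assoc, tm_sop _ (fun l => hs _)]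
  rfl

lemma tau_tprod {s : Module.End ℚ C} {i j : Fin k} (hij : i ≠ j) {x : Fin k → C} {a b : ℕ}
    (ha : s (x i) = (-1:ℚ)^a • x i) (hb : s (x j) = (-1:ℚ)^b • x j) :
    tau s i j (PiTensorProduct.tprod ℚ x) =
      (-1:ℚ)^(a*b) • PiTensorProduct.tprod ℚ (fun l => x (Equiv.swap i j l)) := by
  have e : ∀ {y : Fin k → C} {l : Fin k} {c : ℚ}, (y = Function.update x l (c • x l)) →
      PiTensorProduct.tprod ℚ y = c • PiTensorProduct.tprod ℚ x := by
    intro y l c h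
    rw [h, (PiTensorProduct.tprod ℚ).map_update_smul, Function.update_eq_self]
  have e1 : tm (Ep i j s 1) (PiTensorProduct.tprod ℚ x) = (-1:ℚ)^a • PiTensorProduct.tprod ℚ x := by
    rw [tm_tprod]
    refine e (l := i) ?_
    funext l
    by_cases hl : l = i
    · subst hl; simp [Ep, ha]
    · simp [Ep, hl]
  have e2 : tm (Ep i j 1 s) (PiTensorProduct.tprod ℚ x) = (-1:ℚ)^b • PiTensorProduct.tprod ℚ x := by
    rw [tm_tprod]
    refine e (l := j) ?_
    funext l
    by_cases hl : l = j
    · subst hl; simp [Ep, hb, hij.symm]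
    · simp [Ep, hl]
  rw [tau, LinearMap.comp_apply, sop]
  simp only [LinearMap.smul_apply, LinearMap.sub_apply, LinearMap.add_apply, Module.End.mul_apply,
    e1, e2, Module.End.one_apply, LinearMap.map_smul (tm (Ep i j s 1))]
  have : (2⁻¹:ℚ) • (PiTensorProduct.tprod ℚ x + (-1:ℚ)^a • PiTensorProduct.tprod ℚ x +
      (-1:ℚ)^b • PiTensorProduct.tprod ℚ x - (-1:ℚ)^b • (-1:ℚ)^a • PiTensorProduct.tprod ℚ x) =
      (-1:ℚ)^(a*b) • PiTensorProduct.tprod ℚ x := by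
    have : (-1:ℚ)^(a*b) = 2⁻¹ * (1 + (-1)^a + (-1)^b - (-1)^b * (-1)^a) := by
      rcases Nat.even_or_odd a with h | h <;> rcases Nat.even_or_odd b with h' | h' <;>
        simp [pow_mul, h.neg_one_pow, h'.neg_one_pow] <;> norm_num
    rw [this]
    module
  rw [this, map_smul, rx_tprod, Equiv.symm_swap]

lemma ring_a {R : Type} [Ring R] {D p q : R} (hqq : q * q = 1) (hpq : p * q = q * p)
    (dp : D * p = - (p * D)) (dq : D * q = q * D) :
    D * q * (1 + p + q - p * q) = (1 + p + q - p * q) * D := by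
  calc D * q * (1 + p + q - p * q) = (D * q) + (D*q) * p + D * (q * q) - (D*q)*p*q := by noncomm_ring
    _ = q * D + q * (D * p) + D - q * (D * p) * q := by rw [hqq, dq]; noncomm_ring
    _ = q * D - q * p * D + D + q * p * (D * q) := by rw [dp]; noncomm_ring
    _ = q * D - q * p * D + D + p * (q * q) * D := by rw [dq, ← hpq]; noncomm_ring
    _ = (1 + p + q - p * q) * D := by rw [hqq, hpq]; noncomm_ring

lemma ring_b {R : Type} [Ring R] {D p q : R} (hpp : p * p = 1)
    (dp : D * p = p * D) (dq : D * q = - (q * D)) :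
    D * p * (1 + p + q - p * q) = (1 + p + q - p * q) * D := by
  calc D * p * (1 + p + q - p * q) = D * p + D * (p * p) + (D*p) * q - D * (p * p) * q := by noncomm_ring
    _ = p * D + D + p * (D * q) - D * q := by rw [hpp, dp]; noncomm_ring
    _ = (1 + p + q - p * q) * D := by rw [dq]; noncomm_ring

lemma ring_c {R : Type} [Ring R] {D p q : R} (dp : D * p = p * D) (dq : D * q = q * D) :
    D * (1 + p + q - p * q) = (1 + p + q - p * q) * D := by
  calc D * (1 + p + q - p * q) = D + D * p + D * q - (D * p) * q := by noncomm_ring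
    _ = D + p * D + q * D - p * (q * D) := by rw [dp, mul_assoc, dq]
    _ = (1 + p + q - p * q) * D := by noncomm_ring

lemma tau_bd {s d : Module.End ℚ C} (hss : s * s = 1) (hsd : d * s = - (s * d)) {i j : Fin k}
    (hij : (i:ℕ) + 1 = j) : tau s i j * tbd s d = tbd s d * tau s i j := by
  have hne : i ≠ j := fun h => by rw [h] at hij; omega
  set p := tm (Ep i j s 1) with hp
  set q := tm (Ep i j 1 s) with hq
  have hpp : p * p = 1 := by
    rw [hp, tm_mul, ← tm_one]; congr 1; funext l; simp only [Ep]; split_ifs <;> simp [hss]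
  have hqq : q * q = 1 := by
    rw [hq, tm_mul, ← tm_one]; congr 1; funext l; simp only [Ep]; split_ifs <;> simp [hss]
  have hpq : p * q = q * p := by
    rw [hp, hq, tm_mul, tm_mul]; congr 1; funext l; simp only [Ep]; split_ifs <;> simp
  have hlt : i < j := by rw [Fin.lt_def]; omega
  have key : ∀ l : Fin k, tm (Wp (Equiv.swap i j l) s d) * tau s i j = tau s i j * tm (Wp l s d) := by
    intro l
    have : tm (Wp (Equiv.swap i j l) s d) ∘ₗ rx (Equiv.swap i j) =
      rx (Equiv.swap i j) ∘ₗ tm (fun m => Wp (Equiv.swap i j l) s d (Equiv.swap i j m)) := tm_rx _ _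
    change tm (Wp (Equiv.swap i j l) s d) ∘ₗ rx (Equiv.swap i j) ∘ₗ sop s i j =
      rx (Equiv.swap i j) ∘ₗ sop s i j ∘ₗ tm (Wp l s d)
    rw [← LinearMap.comp_assoc, this, LinearMap.comp_assoc]
    congr 1
    change tm (fun m => Wp (Equiv.swap i j l) s d (Equiv.swap i j m)) * sop s i j =
      sop s i j * tm (Wp l s d)
    simp only [sop, mul_smul_comm, smul_mul_assoc]
    congr 1
    rw [← hp, ← hq]
    by_cases hli : l = i
    · subst hli
      set D := tm (Wp l s d) with hD
      have e : tm (fun m => Wp (Equiv.swap l j l) s d (Equiv.swap l j m)) = D * q := by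
        rw [hD, hq, tm_mul]
        congr 1
        funext m
        rw [Equiv.swap_apply_left]
        by_cases hm : m = l
        · subst hm; simp [Wp, Ep]
        by_cases hm' : m = j
        · subst hm'; simp [Wp, Ep, hlt, hne.symm, not_lt.2 hlt.le]
        rw [Equiv.swap_apply_of_ne_of_ne hm hm']
        have : m < j ↔ m < l := by
          have : (m:ℕ) ≠ l := fun h => hm (Fin.ext h)
          rw [Fin.lt_def, Fin.lt_def]; omega
        simp [Wp, Ep, hm, hm', this]
      have dp : D * p = - (p * D) := by
        rw [hD, hp, tm_mul, tm_mul]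
        apply tm_neg_at l
        · simp [Wp, Ep, hsd]
        · intro m hm; simp [Wp, Ep, hm]
      have dq : D * q = q * D := by
        rw [hD, hq, tm_mul, tm_mul]
        congr 1
        funext m
        by_cases hm : m = j
        · subst hm; simp [Wp, Ep, hne.symm, not_lt.2 hlt.le]
        · simp [Wp, Ep, hm]
      rw [e]
      exact ring_a hqq hpq dp dq
    by_cases hlj : l = j
    · subst hlj
      set D := tm (Wp l s d) with hD
      have e : tm (fun m => Wp (Equiv.swap i l l) s d (Equiv.swap i l m)) = D * p := by
        rw [hD, hp, tm_mul]
        congr 1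
        funext m
        rw [Equiv.swap_apply_right]
        by_cases hm : m = i
        · subst hm; simp [Wp, Ep, hlt, hss, hne.symm, not_lt.2 hlt.le]
        by_cases hm' : m = l
        · subst hm'; simp [Wp, Ep, hlt, hne.symm]
        rw [Equiv.swap_apply_of_ne_of_ne hm hm']
        have : m < i ↔ m < l := by
          have : (m:ℕ) ≠ i := fun h => hm (Fin.ext h)
          rw [Fin.lt_def, Fin.lt_def]; omega
        simp [Wp, Ep, hm, hm', this]
      have dq : D * q = - (q * D) := by
        rw [hD, hq, tm_mul, tm_mul]
        apply tm_neg_at l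
        · simp [Wp, Ep, hsd, hne.symm]
        · intro m hm; simp [Wp, Ep, hm]
      have dp : D * p = p * D := by
        rw [hD, hp, tm_mul, tm_mul]
        congr 1
        funext m
        by_cases hm : m = i
        · subst hm; simp [Wp, Ep, hlt]
        · simp [Wp, Ep, hm]
      rw [e]
      exact ring_b hpp dp dq
    · set D := tm (Wp l s d) with hD
      have hs : Equiv.swap i j l = l := Equiv.swap_apply_of_ne_of_ne hli hlj
      have n1 : (i:ℕ) ≠ l := fun h => hli (Fin.ext h.symm)
      have n2 : (j:ℕ) ≠ l := fun h => hlj (Fin.ext h.symm)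
      have e : tm (fun m => Wp (Equiv.swap i j l) s d (Equiv.swap i j m)) = D := by
        rw [hD]
        congr 1
        funext m
        rw [hs]
        have hji : j < l ↔ i < l := by rw [Fin.lt_def, Fin.lt_def]; omega
        by_cases hm : m = i
        · subst hm; simp [Wp, hji, Ne.symm hli, Ne.symm hlj]
        by_cases hm' : m = j
        · subst hm'; simp [Wp, hji, Ne.symm hli, Ne.symm hlj]
        rw [Equiv.swap_apply_of_ne_of_ne hm hm']
      have dp : D * p = p * D := by
        rw [hD, hp, tm_mul, tm_mul]
        congr 1
        funext m
        by_cases hm : m = i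
        · subst hm; simp only [Wp, Ep, if_true, if_neg (Ne.symm hli)]; split_ifs <;> simp
        · simp [Wp, Ep, hm]
      have dq : D * q = q * D := by
        rw [hD, hq, tm_mul, tm_mul]
        congr 1
        funext m
        by_cases hm : m = j
        · subst hm; simp only [Wp, Ep, if_true, if_neg (Ne.symm hlj)]; split_ifs <;> simp
        · simp [Wp, Ep, hm]
      rw [e]
      exact ring_c dp dq
  have h2 := Equiv.sum_comp (Equiv.swap i j) (fun l => (tm (Wp l s d) * tau s i j : Module.End ℚ (TP k C)))
  rw [tbd, Finset.mul_sum, Finset.sum_mul]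
  refine Eq.trans ?_ h2
  exact Finset.sum_congr rfl fun l _ => (key l).symm

end
end BCT

namespace BCT
open Topology Filter
open scoped TensorProduct
set_option linter.unusedVariables false
set_option linter.unusedSimpArgs false
set_option linter.unusedSectionVars false

/-- contraction on the model -/
structure Ctr {k : ℕ} (L : Fnc k) where
  h : L.C EE →ₗ[ℚ] L.C EE
  η : L.C EE
  h1 : ∀ x, L.bd (h x) + h (L.bd x) = x - L.aug x • η
  h2 : ∀ x, L.aug (h x) = 0
  aug_η : L.aug η = 1
  bd_η : L.bd η = 0

theorem Mdl.exists_chain {k : ℕ} (K : Mdl k) (L : Fnc k) (c : Ctr L) (P : ℕ → Submodule ℚ (L.C EE))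
    (hP : ∀ n (f : Fin k → C(EE, EE)) x, x ∈ P n → L.map f x ∈ P n)
    (hh : ∀ n x, x ∈ P n → c.h x ∈ P (n+1)) (hη : c.η ∈ P 1)
    (hd : ∀ t, K.deg t ≠ 0 → K.aug (K.u t) = 0) :
    ∃ T : ∀ (X : Type) [TopologicalSpace X], K.C X →ₗ[ℚ] L.C X, K.Nat L T ∧
      (∀ (X : Type) [TopologicalSpace X] (x : K.C X), L.bd (T X x) = T X (K.bd x)) ∧
      (∀ (X : Type) [TopologicalSpace X] (x : K.C X), L.aug (T X x) = K.aug x) ∧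
      (∀ t, T EE (K.u t) ∈ P (K.deg t + 1)) := by
  let d : K.Ty → L.C EE := fun t => K.aug (K.u t) • c.η
  let T0 := K.ext L d
  have T0n : K.Nat L T0 := K.ext_nat L d
  have T0b : ∀ (X : Type) [TopologicalSpace X] (x : K.C X), L.bd (T0 X x) = 0 := by
    intro X _ x
    have : L.bd ∘ₗ T0 X = 0 := by
      apply K.bs.ext
      intro b
      rw [LinearMap.comp_apply, K.ext_bs, L.bd_map, map_smul, c.bd_η, smul_zero, map_zero]; rfl
    exact LinearMap.congr_fun this x
  have T0a : ∀ (X : Type) [TopologicalSpace X] (x : K.C X), L.aug (T0 X x) = K.aug x := by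
    intro X _ x
    have : L.aug ∘ₗ T0 X = K.aug := by
      apply K.bs.ext
      intro b
      rw [LinearMap.comp_apply, K.ext_bs, L.aug_map, map_smul, c.aug_η, K.bs_eq' b, K.aug_map]
      simp
    exact LinearMap.congr_fun this x
  have dP : ∀ t, d t ∈ P (K.deg t + 1) := by
    intro t
    by_cases h : K.deg t = 0
    · rw [h]; exact Submodule.smul_mem _ _ hη
    · change K.aug (K.u t) • c.η ∈ _
      rw [hd t h, zero_smul]; exact Submodule.zero_mem _
  let Ψ : ∀ (X : Type) [TopologicalSpace X], K.C X →ₗ[ℚ] L.C X := fun X _ => T0 X ∘ₗ K.bd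
  have Ψe : ∀ (X : Type) [TopologicalSpace X] (x : K.C X), Ψ X x = T0 X (K.bd x) := fun _ _ _ => rfl
  have hΨ : K.Nat L Ψ := fun X Y _ _ f x => by
    rw [Ψe, Ψe, T0n, K.bd_map]
  obtain ⟨D, hD, hf⟩ := K.exists_nat L Ψ 1 (fun _ => c.h)
  have hdeg := K.nat_deg L hD 1 (fun _ => c.h) hf P 0 hP (fun n t x hx => hh n x hx) (fun t => by
    have : Submodule.span ℚ (K.bs '' {c | K.deg (K.ty c) + 1 = K.deg t}) ≤
        (P (K.deg t + 0)).comap (T0 EE) := by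
      rw [Submodule.span_le]
      rintro _ ⟨c', hc, rfl⟩
      change _ + 1 = _ at hc
      change T0 EE (K.bs c') ∈ P (K.deg t)
      rw [K.ext_bs, ← hc]
      exact hP _ _ _ (dP _)
    exact this (K.bd_low t))
  have hbd := K.nat_bd L hD hΨ 1 (fun _ => c.h) (fun _ => c.η) hf (fun t x => c.h1 x) (fun t x => c.h2 x)
    (fun x => by rw [Ψe, T0a, K.aug_bd]) (fun x => by rw [Ψe, Ψe, T0b, K.bd_bd]; simp)
  have aug0 : ∀ (X : Type) [TopologicalSpace X] (x : K.C X), L.aug (D X x) = 0 := by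
    intro X _ x
    have : L.aug ∘ₗ D X = 0 := by
      apply K.bs.ext
      intro b
      rw [LinearMap.comp_apply, K.bs_eq' b, ← hD, L.aug_map, hf, L.aug_map, c.h2]; rfl
    exact LinearMap.congr_fun this x
  refine ⟨fun X _ => T0 X + D X, ?_, ?_, ?_, ?_⟩
  · intro X Y _ _ f x
    simp only [LinearMap.add_apply, map_add]
    rw [T0n, hD]
  · intro X _ x
    simp only [LinearMap.add_apply, map_add]
    rw [T0b, hbd, zero_add, one_smul, Ψe]
  · intro X _ x
    simp only [LinearMap.add_apply, map_add]
    rw [T0a, aug0, add_zero]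
  · intro t
    refine Submodule.add_mem _ ?_ (hdeg t)
    change K.ext L d EE (K.bs (K.uc t)) ∈ _
    rw [K.ext_bs, K.ty_uc]
    exact hP _ _ _ (dP _)

theorem Mdl.exists_homotopy {k : ℕ} (K : Mdl k) (L : Fnc k) (c : Ctr L)
    (F G : ∀ (X : Type) [TopologicalSpace X], K.C X →ₗ[ℚ] L.C X) (hF : K.Nat L F) (hG : K.Nat L G)
    (hFb : ∀ x : K.C EE, L.bd (F EE x) = F EE (K.bd x))
    (hGb : ∀ x : K.C EE, L.bd (G EE x) = G EE (K.bd x))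
    (ha : ∀ x : K.C EE, L.aug (F EE x) = L.aug (G EE x)) :
    ∃ D : ∀ (X : Type) [TopologicalSpace X], K.C X →ₗ[ℚ] L.C X, 
      (∀ (X : Type) [TopologicalSpace X] (x : K.C X), L.bd (D X x) + D X (K.bd x) = F X x - G X x) := by
  let Ψ : ∀ (X : Type) [TopologicalSpace X], K.C X →ₗ[ℚ] L.C X := fun X _ => F X - G X
  have Ψe : ∀ (X : Type) [TopologicalSpace X] (x : K.C X), Ψ X x = F X x - G X x := fun _ _ _ => rfl
  have hΨ : K.Nat L Ψ := fun X Y _ _ f x => by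
    rw [Ψe, Ψe, map_sub, hF, hG]
  obtain ⟨D, hD, hf⟩ := K.exists_nat L Ψ (-1) (fun _ => c.h)
  have hbd := K.nat_bd L hD hΨ (-1) (fun _ => c.h) (fun _ => c.η) hf (fun t x => c.h1 x) (fun t x => c.h2 x)
    (fun x => by rw [Ψe, map_sub, ha, sub_self]) (fun x => by rw [Ψe, Ψe, map_sub, hFb, hGb]; simp)
  refine ⟨D, fun X _ x => ?_⟩
  rw [hbd, Ψe]; simp

section
variable {k : ℕ} {X Y Z : Type} [TopologicalSpace X] [TopologicalSpace Y] [TopologicalSpace Z]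

/-- product of maps -/
def pim (f : Fin k → C(X, Y)) : C(Fin k → X, Fin k → Y) :=
  ⟨fun x l => f l (x l), by fun_prop⟩

lemma pim_comp (f : Fin k → C(X, Y)) (g : Fin k → C(Y, Z)) :
    (pim g).comp (pim f) = pim (fun l => (g l).comp (f l)) := rfl

/-- diagonal -/
def diag (f : C(X, Y)) : C(X, Fin k → Y) := ⟨fun x _ => f x, by fun_prop⟩

/-- projection -/
def prj (l : Fin k) : C(Fin k → X, X) := ⟨fun x => x l, by fun_prop⟩
end

noncomputable abbrev FB (k : ℕ) : Fnc k where
  C X _ := Ch (Fin k → X)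
  map f := cmap (pim f)
  map_map f g x := cmap_cmap _ _ _
  bd := bd
  aug := aug
  bd_map f x := bd_cmap _ _
  aug_map f x := aug_cmap _ _
  bd_bd := bd_bd
  aug_bd := aug_bd

noncomputable abbrev KB (k : ℕ) : Mdl k where
  toFnc := FB k
  Ty := ℕ
  deg := id
  Cell X _ := Smp (Fin k → X)
  bs := Finsupp.basisSingleOne
  ty c := c.1
  fn c l := (prj l).comp (c.2.comp (ret c.1))
  push f c := ⟨c.1, (pim f).comp c.2⟩
  push_bs f c := (congrArg (cmap (pim f)) (bs1 c)).trans ((cmap_sg _ _).trans (bs1 _).symm)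
  push_ty f c := rfl
  push_fn f c := by funext j; rfl
  uc p := ⟨p, diag (iot p)⟩
  ty_uc _ := rfl
  bs_eq c := by
    obtain ⟨p, σ⟩ := c
    have : (pim (fun l => (prj l).comp (σ.comp (ret p)))).comp (diag (iot p)) = σ :=
      comp_ret_iot p σ
    simp only [this]
  bd_low p := bd_low1 p _

lemma KB_u (k p : ℕ) : (KB k).u p = sg ⟨p, diag (iot p)⟩ := bs1 _

noncomputable def cB (k : ℕ) : Ctr (FB k) where
  h := cone (0 : Fin k → EE)
  η := sg ⟨0, pt (Fin k → EE) 0⟩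
  h1 := bd_cone _
  h2 := aug_cone _
  aug_η := by
    have : aug (sg ⟨0, pt (Fin k → EE) 0⟩) = 1 := by rw [aug_sg]; simp
    exact this
  bd_η := bd_zero _

section
variable {X Y : Type} [TopologicalSpace X] [TopologicalSpace Y] {k : ℕ}

/-- boundary on the tensor power -/
noncomputable def bdA : Module.End ℚ (TP k (Ch X)) := tbd sgn bd

noncomputable def augA : TP k (Ch X) →ₗ[ℚ] ℚ :=
  PiTensorProduct.lift ((MultilinearMap.mkPiAlgebra ℚ (Fin k) ℚ).compLinearMap (fun _ => aug))

lemma augA_tprod (x : Fin k → Ch X) : augA (PiTensorProduct.tprod ℚ x) = ∏ l, aug (x l) := by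
  rw [augA, PiTensorProduct.lift.tprod]; rfl

lemma sgn_sq : (sgn * sgn : Module.End ℚ (Ch X)) = 1 := LinearMap.ext sgn_sgn

lemma bd_sgn : (bd * sgn : Module.End ℚ (Ch X)) = - (sgn * bd) := by
  refine LinearMap.ext fun x => ?_
  change bd (sgn x) = - (sgn (bd x))
  rw [sgn_bd, neg_neg]

lemma bd_sq : (bd * bd : Module.End ℚ (Ch X)) = 0 := LinearMap.ext bd_bd

lemma bdA_bdA (x : TP k (Ch X)) : bdA (bdA x) = 0 :=
  LinearMap.congr_fun (tbd_tbd (k := k) bd_sq bd_sgn) x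

lemma augA_Wp (j : Fin k) {a d : Module.End ℚ (Ch X)} (hd : ∀ x, aug (d x) = 0) (x : TP k (Ch X)) :
    augA (tm (Wp j a d) x) = 0 := by
  have : augA ∘ₗ tm (Wp j a d) = 0 := by
    apply tp_ext
    intro x
    rw [LinearMap.comp_apply, tm_tprod, augA_tprod, Finset.prod_eq_zero (Finset.mem_univ j)]
    · rfl
    · simp [Wp, hd]
  exact LinearMap.congr_fun this x

lemma augA_bdA (x : TP k (Ch X)) : augA (bdA x) = 0 := by
  simp only [bdA, tbd, LinearMap.sum_apply, map_sum]
  exact Finset.sum_eq_zero fun j _ => augA_Wp j aug_bd x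

noncomputable def mapA (f : Fin k → C(X, Y)) : TP k (Ch X) →ₗ[ℚ] TP k (Ch Y) := tm (fun l => cmap (f l))

lemma bdA_mapA (f : Fin k → C(X, Y)) (x : TP k (Ch X)) : bdA (mapA f x) = mapA f (bdA x) :=
  (LinearMap.congr_fun (tm_chain (s := sgn) (d := bd) (s' := sgn) (d' := bd) (fun l => cmap (f l))
    (fun l => LinearMap.ext fun x => (sgn_cmap (f l) x).symm)
    (fun l => LinearMap.ext fun x => (bd_cmap (f l) x).symm)) x).symm

lemma augA_mapA (f : Fin k → C(X, Y)) (x : TP k (Ch X)) : augA (mapA f x) = augA x := by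
  have : augA ∘ₗ mapA f = augA := by
    apply tp_ext
    intro x
    rw [LinearMap.comp_apply, mapA, tm_tprod, augA_tprod, augA_tprod]
    simp only [aug_cmap]
  exact LinearMap.congr_fun this x

/-- degree n part -/
noncomputable def AS (n : ℕ) : Submodule ℚ (TP k (Ch X)) :=
  Submodule.span ℚ {y | ∃ (m : Fin k → ℕ) (x : Fin k → Ch X), (∀ l, x l ∈ S (m l) (Set.univ : Set X)) ∧
    ∑ l, m l = n ∧ y = PiTensorProduct.tprod ℚ x}

lemma tprod_mem_AS {m : Fin k → ℕ} {x : Fin k → Ch X} (hx : ∀ l, x l ∈ S (m l) (Set.univ : Set X))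
    {n : ℕ} (hn : ∑ l, m l = n) : PiTensorProduct.tprod ℚ x ∈ (AS n : Submodule ℚ (TP k (Ch X))) :=
  Submodule.subset_span ⟨m, x, hx, hn, rfl⟩

lemma apply_of_mem_S {n : ℕ} {x : Ch X} (hx : x ∈ S n (Set.univ : Set X)) {c : Smp X} (hc : x c ≠ 0) :
    c.1 = n := by
  by_contra h
  apply hc
  rw [S_eq_span] at hx
  induction hx using Submodule.span_induction with
  | mem x hx =>
    obtain ⟨σ, _, rfl⟩ := hx
    rw [sg]
    apply Finsupp.single_eq_of_ne
    rintro rfl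
    exact h rfl
  | zero => rfl
  | add x y _ _ hx hy => 
    by_cases h1 : x c = 0
    · by_cases h2 : y c = 0
      · simp [h1, h2]
      · exact absurd (hy h2) h2
    · exact absurd (hx h1) h1
  | smul a x _ hx => 
    by_cases h1 : x c = 0
    · simp [h1]
    · exact absurd (hx h1) h1

noncomputable abbrev bsA : Module.Basis (Fin k → Smp X) ℚ (TP k (Ch X)) :=
  Basis.piTensorProduct (fun _ : Fin k => (Finsupp.basisSingleOne : Module.Basis (Smp X) ℚ (Ch X)))

lemma bsA_apply (c : Fin k → Smp X) : bsA c = PiTensorProduct.tprod ℚ (fun l => sg (c l)) := by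
  rw [bsA, Basis.piTensorProduct_apply]
  simp only [bs1]

lemma AS_le (n : ℕ) : (AS n : Submodule ℚ (TP k (Ch X))) ≤
    Submodule.span ℚ (bsA '' {c : Fin k → Smp X | ∑ l, (c l).1 = n}) := by
  rw [AS, Submodule.span_le]
  rintro _ ⟨m, x, hx, hn, rfl⟩
  rw [SetLike.mem_coe, Module.Basis.mem_span_image]
  intro c hc
  rw [Finset.mem_coe, Finsupp.mem_support_iff, bsA, Basis.piTensorProduct_repr_tprod_apply,
    Finset.prod_ne_zero_iff] at hc
  change ∑ l, (c l).1 = n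
  rw [← hn]
  refine Finset.sum_congr rfl fun l _ => apply_of_mem_S (hx l) ?_
  exact hc l (Finset.mem_univ l)

lemma Wp_tprod_mem (j : Fin k) (s : Module.End ℚ (Ch X)) (hs : ∀ n x, x ∈ S n (Set.univ : Set X) → s x ∈ S n Set.univ)
    (d : Module.End ℚ (Ch X)) {m : Fin k → ℕ} {x : Fin k → Ch X} (hx : ∀ l, x l ∈ S (m l) (Set.univ : Set X))
    {n' n : ℕ} (hd : d (x j) ∈ S n' (Set.univ : Set X)) (hn : ∑ l, m l + n' = n + m j) :
    tm (Wp j s d) (PiTensorProduct.tprod ℚ x) ∈ (AS n : Submodule ℚ (TP k (Ch X))) := by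
  rw [tm_tprod]
  refine tprod_mem_AS (m := Function.update m j n') (fun l => ?_) ?_
  · by_cases hl : l = j
    · subst hl; simpa [Wp] using hd
    · simp only [Wp, if_neg hl, Function.update_of_ne hl]
      split_ifs
      · exact hs _ _ (hx l)
      · exact hx l
  · rw [Finset.sum_update_of_mem (Finset.mem_univ j)]
    have := Finset.add_sum_erase Finset.univ m (Finset.mem_univ j)
    rw [Finset.sdiff_singleton_eq_erase]
    omega

lemma sgn_mem {n : ℕ} {x : Ch X} (hx : x ∈ S n (Set.univ : Set X)) : sgn x ∈ S n (Set.univ : Set X) := by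
  rw [sgn_of_mem hx]; exact Submodule.smul_mem _ _ hx

lemma bdA_mem {n : ℕ} {x : TP k (Ch X)} (hx : x ∈ (AS (n+1) : Submodule ℚ (TP k (Ch X)))) :
    bdA x ∈ (AS n : Submodule ℚ (TP k (Ch X))) := by
  rw [AS] at hx
  induction hx using Submodule.span_induction with
  | mem x hx =>
    obtain ⟨m, x, hx, hn, rfl⟩ := hx
    rw [bdA, tbd, LinearMap.sum_apply]
    refine Submodule.sum_mem _ fun j _ => ?_
    rcases hj : m j with _ | p
    · have h0 : x j ∈ S 0 (Set.univ : Set X) := by rw [← hj]; exact hx j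
      have : tm (Wp j sgn bd) (PiTensorProduct.tprod ℚ x) = 0 := by
        rw [tm_tprod]
        apply (PiTensorProduct.tprod ℚ).map_coord_zero j
        simp [Wp, bd_S_zero h0]
      rw [this]; exact Submodule.zero_mem _
    · have h0 : x j ∈ S (p+1) (Set.univ : Set X) := by rw [← hj]; exact hx j
      exact Wp_tprod_mem j _ (fun n x hx => sgn_mem hx) _ hx (bd_mem_S h0) (by omega)
  | zero => rw [map_zero]; exact Submodule.zero_mem _
  | add x y _ _ hx hy => rw [map_add]; exact Submodule.add_mem _ hx hy
  | smul a x _ hx => rw [map_smul]; exact Submodule.smul_mem _ _ hx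

lemma bdA_mem_zero {x : TP k (Ch X)} (hx : x ∈ (AS 0 : Submodule ℚ (TP k (Ch X)))) : bdA x = 0 := by
  rw [AS] at hx
  induction hx using Submodule.span_induction with
  | mem x hx =>
    obtain ⟨m, x, hx, hn, rfl⟩ := hx
    rw [bdA, tbd, LinearMap.sum_apply]
    refine Finset.sum_eq_zero fun j _ => ?_
    have hj : m j = 0 := (Finset.sum_eq_zero_iff.1 hn) j (Finset.mem_univ j)
    have h0 : x j ∈ S 0 (Set.univ : Set X) := by rw [← hj]; exact hx j
    rw [tm_tprod]
    apply (PiTensorProduct.tprod ℚ).map_coord_zero j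
    simp [Wp, bd_S_zero h0]
  | zero => rw [map_zero]
  | add x y _ _ hx hy => rw [map_add, hx, hy, add_zero]
  | smul a x _ hx => rw [map_smul, hx, smul_zero]

lemma mapA_mem (f : Fin k → C(X, Y)) {n : ℕ} {x : TP k (Ch X)} (hx : x ∈ (AS n : Submodule ℚ (TP k (Ch X)))) :
    mapA f x ∈ (AS n : Submodule ℚ (TP k (Ch Y))) := by
  rw [AS] at hx
  induction hx using Submodule.span_induction with
  | mem x hx =>
    obtain ⟨m, x, hx, hn, rfl⟩ := hx
    rw [mapA, tm_tprod]
    exact tprod_mem_AS (fun l => cmap_mem_S (W' := Set.univ) _ (fun _ _ => trivial) (hx l)) hn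
  | zero => rw [map_zero]; exact Submodule.zero_mem _
  | add x y _ _ hx hy => rw [map_add]; exact Submodule.add_mem _ hx hy
  | smul a x _ hx => rw [map_smul]; exact Submodule.smul_mem _ _ hx
end

noncomputable abbrev FA (k : ℕ) : Fnc k where
  C X _ := TP k (Ch X)
  map f := mapA f
  map_map f g x := by
    refine (LinearMap.congr_fun (tm_comp (fun l => cmap (g l)) (fun l => cmap (f l))) x).trans ?_
    simp only [← cmap_comp]; rfl
  bd := bdA
  aug := augA
  bd_map f x := bdA_mapA _ _
  aug_map f x := augA_mapA _ _
  bd_bd := bdA_bdA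
  aug_bd := augA_bdA

noncomputable abbrev KA (k : ℕ) : Mdl k where
  toFnc := FA k
  Ty := Fin k → ℕ
  deg m := ∑ l, m l
  Cell X _ := Fin k → Smp X
  bs := bsA
  ty c l := (c l).1
  fn c l := (c l).2.comp (ret (c l).1)
  push f c l := ⟨(c l).1, (f l).comp (c l).2⟩
  push_bs f c := by
    rw [bsA_apply, bsA_apply]
    refine (tm_tprod _ _).trans ?_
    simp only [cmap_sg]
  push_ty f c := rfl
  push_fn f c := by funext j; rfl
  uc p l := ⟨p l, iot (p l)⟩
  ty_uc _ := rfl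
  bs_eq c := by
    funext l
    simp only [comp_ret_iot]
  bd_low p := by
    have h0 : bsA (fun l => (⟨p l, iot (p l)⟩ : Smp EE)) ∈ (AS (∑ l, p l) : Submodule ℚ (TP k (Ch EE))) := by
      rw [bsA_apply]
      exact tprod_mem_AS (m := p) (fun l => sg_mem_S' ⟨p l, iot (p l)⟩) rfl
    generalize bsA (fun l => (⟨p l, iot (p l)⟩ : Smp EE)) = y at h0 ⊢
    generalize ∑ l, p l = n at h0 ⊢
    cases n with
    | zero => rw [bdA_mem_zero h0]; exact Submodule.zero_mem _
    | succ n =>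
      have := AS_le n (bdA_mem h0)
      simpa using this

lemma KA_u (k : ℕ) (p : Fin k → ℕ) :
    (KA k).u p = PiTensorProduct.tprod ℚ (fun l => sg ⟨p l, iot (p l)⟩) := bsA_apply _

lemma sgn_cone (b : EE) (x : Ch EE) : cone b (sgn x) = - sgn (cone b x) := by
  have : cone b ∘ₗ sgn = - (sgn ∘ₗ cone b) := by
    apply Ch.hom_ext
    intro σ
    have h : cone b (sg σ) ∈ S (σ.1+1) (Set.univ : Set EE) :=
      cone_mem_S (W := Set.univ) (fun _ _ _ _ _ _ _ => trivial) (sg_mem_S' σ)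
    simp only [LinearMap.comp_apply, LinearMap.neg_apply]
    rw [sgn_of_mem h, sgn_sg, map_smul, pow_succ]
    simp
  exact LinearMap.congr_fun this x

noncomputable def eta0 : Ch EE := sg ⟨0, pt EE 0⟩

noncomputable def eaug : Module.End ℚ (Ch EE) := (aug : Ch EE →ₗ[ℚ] ℚ).smulRight eta0

lemma eaug_apply (x : Ch EE) : eaug x = aug x • eta0 := rfl

lemma eta0_mem : eta0 ∈ S 0 (Set.univ : Set EE) := sg_mem_S' ⟨0, pt EE 0⟩

lemma aug_sgn {X : Type} [TopologicalSpace X] (x : Ch X) : aug (sgn x) = aug x := by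
  have : aug ∘ₗ sgn = (aug : Ch X →ₗ[ℚ] ℚ) := by
    apply Ch.hom_ext
    intro σ
    simp only [LinearMap.comp_apply, sgn_sg, map_smul, aug_sg]
    split_ifs with h
    · simp [h]
    · simp
  exact LinearMap.congr_fun this x

lemma aug_eta0 : aug eta0 = 1 := by rw [eta0, aug_sg]; simp

noncomputable def cA (k : ℕ) : Ctr (FA k) where
  h := thom sgn eaug (cone (0 : EE))
  η := PiTensorProduct.tprod ℚ (fun _ => eta0)
  h1 x := by
    have h := thom_bd (k := k) (s := sgn) (d := bd) (f := eaug) (h := cone (0:EE)) sgn_sq bd_sgn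
      (LinearMap.ext fun x => by
        simp only [Module.End.mul_apply, eaug_apply, map_smul, aug_sgn, sgn_of_mem eta0_mem]; simp)
      (LinearMap.ext fun x => by
        simp only [Module.End.mul_apply, eaug_apply, map_smul, aug_bd, bd_S_zero eta0_mem]; simp)
      (LinearMap.ext fun x => sgn_cone _ x)
      (LinearMap.ext fun x => bd_cone _ x)
    have h' := LinearMap.congr_fun h x
    refine h'.trans ?_
    change x - tm (fun _ => eaug) x = x - augA x • _
    congr 1
    have : tm (fun _ : Fin k => eaug) = augA.smulRight (PiTensorProduct.tprod ℚ (fun _ => eta0)) := by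
      apply tp_ext
      intro x
      rw [tm_tprod, LinearMap.smulRight_apply, augA_tprod]
      simp only [eaug_apply]
      rw [MultilinearMap.map_smul_univ]
    rw [this]; rfl
  h2 x := by
    have : augA (thom sgn eaug (cone (0 : EE)) x : TP k (Ch EE)) = 0 := by
      simp only [thom, LinearMap.sum_apply, map_sum]
      exact Finset.sum_eq_zero fun j _ => augA_Wp j (aug_cone _) x
    exact this
  aug_η := by
    refine (augA_tprod _).trans ?_
    simp [aug_eta0]
  bd_η := bdA_mem_zero (tprod_mem_AS (m := 0) (fun _ => eta0_mem) (by simp))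

end BCT

namespace BCT
open Topology Filter
open scoped TensorProduct
set_option linter.unusedVariables false
set_option linter.unusedSimpArgs false
set_option linter.unusedSectionVars false

/-- shifted degree pieces of the tensor power -/
noncomputable def APsh {k : ℕ} {X : Type} [TopologicalSpace X] : ℕ → Submodule ℚ (TP k (Ch X))
  | 0 => ⊥
  | n+1 => AS n

lemma APsh_map {k : ℕ} {X Y : Type} [TopologicalSpace X] [TopologicalSpace Y] (f : Fin k → C(X, Y)) (n : ℕ)
    (x : TP k (Ch X)) (hx : x ∈ (APsh n : Submodule ℚ (TP k (Ch X)))) :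
    mapA f x ∈ (APsh n : Submodule ℚ (TP k (Ch Y))) := by
  cases n with
  | zero => rw [APsh, Submodule.mem_bot] at *; rw [hx, map_zero]
  | succ n => exact mapA_mem f hx

lemma aug_of_mem {X : Type} [TopologicalSpace X] {n : ℕ} (hn : n ≠ 0) {x : Ch X}
    (hx : x ∈ S n (Set.univ : Set X)) : aug x = 0 := by
  rw [S_eq_span] at hx
  induction hx using Submodule.span_induction with
  | mem x hx =>
    obtain ⟨σ, _, rfl⟩ := hx
    rw [aug_sg, if_neg hn]
  | zero => rw [map_zero]
  | add x y _ _ hx hy => rw [map_add, hx, hy, add_zero]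
  | smul a x _ hx => rw [map_smul, hx, smul_zero]

lemma eaug_mem {n : ℕ} {x : Ch EE} (hx : x ∈ S n (Set.univ : Set EE)) : eaug x ∈ S n (Set.univ : Set EE) := by
  rw [eaug_apply]
  rcases Nat.eq_zero_or_pos n with rfl | hn
  · exact Submodule.smul_mem _ _ eta0_mem
  · rw [aug_of_mem hn.ne' hx, zero_smul]; exact Submodule.zero_mem _

lemma thom_mem {k n : ℕ} {x : TP k (Ch EE)} (hx : x ∈ (AS n : Submodule ℚ (TP k (Ch EE)))) :
    thom sgn eaug (cone (0 : EE)) x ∈ (AS (n+1) : Submodule ℚ (TP k (Ch EE))) := by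
  rw [AS] at hx
  induction hx using Submodule.span_induction with
  | mem x hx =>
    obtain ⟨m, x, hx, hn, rfl⟩ := hx
    rw [thom, LinearMap.sum_apply]
    refine Submodule.sum_mem _ fun j _ => ?_
    exact Wp_tprod_mem j _ (fun n x hx => by first | exact sgn_mem (eaug_mem hx) | exact eaug_mem (sgn_mem hx)) _ hx
      (cone_mem_S (W := Set.univ) (fun _ _ _ _ _ _ _ => trivial) (hx j)) (by omega)
  | zero => rw [map_zero]; exact Submodule.zero_mem _
  | add x y _ _ hx hy => rw [map_add]; exact Submodule.add_mem _ hx hy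
  | smul a x _ hx => rw [map_smul]; exact Submodule.smul_mem _ _ hx

lemma exists_T (k : ℕ) : ∃ T : ∀ (X : Type) [TopologicalSpace X], TP k (Ch X) →ₗ[ℚ] Ch (Fin k → X),
    (KA k).Nat (FB k) T ∧ (∀ (X : Type) [TopologicalSpace X] x, bd (T X x) = T X (bdA x)) ∧
    (∀ (X : Type) [TopologicalSpace X] x, aug (T X x) = augA x) ∧
    (∀ (X : Type) [TopologicalSpace X] n x, x ∈ (AS n : Submodule ℚ (TP k (Ch X))) → T X x ∈ S n (Set.univ : Set (Fin k → X))) := by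
  obtain ⟨T, h1, h2, h3, h4⟩ := (KA k).exists_chain (FB k) (cB k) Psh (fun n f x hx => Psh_cmap _ n x hx)
    (fun n x hx => Psh_cone _ n x hx) (sg_mem_S' ⟨0, pt (Fin k → EE) 0⟩) (by
      intro p hp
      rw [KA_u]
      refine (augA_tprod _).trans ?_
      have : ∃ l ∈ Finset.univ, p l ≠ 0 := Finset.exists_ne_zero_of_sum_ne_zero hp
      obtain ⟨l, _, hl⟩ := this
      refine Finset.prod_eq_zero (Finset.mem_univ l) ?_
      rw [aug_sg, if_neg hl])
  refine ⟨T, h1, h2, h3, fun X _ n x hx => ?_⟩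
  have : Submodule.span ℚ (bsA '' {c : Fin k → Smp X | ∑ l, (c l).1 = n}) ≤
      (S n (Set.univ : Set (Fin k → X))).comap (T X) := by
    rw [Submodule.span_le]
    rintro _ ⟨c, hc, rfl⟩
    change T X (bsA c) ∈ S n (Set.univ : Set (Fin k → X))
    have e := (KA k).bs_eq' c
    have e2 := h1 EE X ((KA k).fn c) ((KA k).u ((KA k).ty c))
    rw [← e] at e2
    rw [← show _ = T X (bsA c) from e2]
    refine cmap_mem_S (W' := Set.univ) _ (fun _ _ => trivial) (W := Set.univ) ?_
    have := h4 ((KA k).ty c)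
    rw [show (KA k).deg ((KA k).ty c) = n from hc] at this
    exact this
  exact this (AS_le n hx)

lemma exists_U (k : ℕ) : ∃ U : ∀ (X : Type) [TopologicalSpace X], Ch (Fin k → X) →ₗ[ℚ] TP k (Ch X),
    (KB k).Nat (FA k) U ∧ (∀ (X : Type) [TopologicalSpace X] x, bdA (U X x) = U X (bd x)) ∧
    (∀ (X : Type) [TopologicalSpace X] x, augA (U X x) = aug x) ∧
    (∀ (X : Type) [TopologicalSpace X] n x, x ∈ S n (Set.univ : Set (Fin k → X)) → U X x ∈ (AS n : Submodule ℚ (TP k (Ch X)))) := by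
  obtain ⟨T, h1, h2, h3, h4⟩ := (KB k).exists_chain (FA k) (cA k) APsh (fun n f x hx => APsh_map _ n x hx)
    (fun n x hx => by
      cases n with
      | zero =>
        rw [APsh, Submodule.mem_bot] at hx
        rw [hx, map_zero]; exact Submodule.zero_mem _
      | succ n => exact thom_mem hx) (tprod_mem_AS (m := 0) (fun _ => eta0_mem) (by simp)) (by
      intro p hp
      rw [KB_u]
      refine (aug_sg _).trans (if_neg hp))
  refine ⟨T, h1, h2, h3, fun X _ n x hx => ?_⟩
  rw [S_eq_span] at hx
  induction hx using Submodule.span_induction with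
  | mem x hx =>
    obtain ⟨σ, _, rfl⟩ := hx
    have e := (KB k).bs_eq' (⟨n, σ⟩ : Smp (Fin k → X))
    rw [show (KB k).bs (⟨n, σ⟩ : Smp (Fin k → X)) = sg ⟨n, σ⟩ from bs1 _] at e
    rw [e, ← h1]
    exact mapA_mem _ (h4 n)
  | zero => rw [map_zero]; exact Submodule.zero_mem _
  | add x y _ _ hx hy => rw [map_add]; exact Submodule.add_mem _ hx hy
  | smul a x _ hx => rw [map_smul]; exact Submodule.smul_mem _ _ hx

lemma augA_tau {X : Type} [TopologicalSpace X] {k : ℕ} {i j : Fin k} (hij : i ≠ j) (x : TP k (Ch X)) :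
    augA (tau sgn i j x) = augA x := by
  have : augA ∘ₗ tau sgn i j = (augA : TP k (Ch X) →ₗ[ℚ] ℚ) := by
    apply bsA.ext
    intro c
    rw [LinearMap.comp_apply, bsA_apply, tau_tprod hij (sgn_sg _) (sgn_sg _), map_smul, augA_tprod, augA_tprod]
    rw [Equiv.prod_comp (Equiv.swap i j) (fun l => aug (sg (c l)))]
    by_cases h : (c i).1 = 0
    · rw [h]; simp
    · rw [Finset.prod_eq_zero (Finset.mem_univ i), smul_zero]
      rw [aug_sg, if_neg h]
  exact LinearMap.congr_fun this x

lemma permMap_pim {k : ℕ} {X Y : Type} [TopologicalSpace X] [TopologicalSpace Y] (f : Fin k → C(X, Y))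
    (g : Equiv.Perm (Fin k)) : (pim f).comp (permMap g) = (permMap g).comp (pim (fun l => f (g.symm l))) := by
  ext x l
  simp [pim, permMap]

theorem EZ (k : ℕ) (X : Type) [TopologicalSpace X] :
    ∃ (T : TP k (Ch X) →ₗ[ℚ] Ch (Fin k → X)) (U : Ch (Fin k → X) →ₗ[ℚ] TP k (Ch X)),
    (∀ x, bd (T x) = T (bdA x)) ∧ (∀ x, bdA (U x) = U (bd x)) ∧
    (∀ n x, x ∈ (AS n : Submodule ℚ (TP k (Ch X))) → T x ∈ S n (Set.univ : Set (Fin k → X))) ∧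
    (∀ n x, x ∈ S n (Set.univ : Set (Fin k → X)) → U x ∈ (AS n : Submodule ℚ (TP k (Ch X)))) ∧
    (∃ D : TP k (Ch X) →ₗ[ℚ] TP k (Ch X), ∀ x, bdA (D x) + D (bdA x) = U (T x) - x) ∧
    (∃ D : Ch (Fin k → X) →ₗ[ℚ] Ch (Fin k → X), ∀ x, bd (D x) + D (bd x) = T (U x) - x) ∧
    (∀ i j : Fin k, (i:ℕ) + 1 = j → ∃ D : TP k (Ch X) →ₗ[ℚ] Ch (Fin k → X), ∀ x,
      bd (D x) + D (bdA x) = cmap (permMap (Equiv.swap i j)) (T (tau sgn i j x)) - T x) := by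
  obtain ⟨T, T1, T2, T3, T4⟩ := exists_T k
  obtain ⟨U, U1, U2, U3, U4⟩ := exists_U k
  refine ⟨T X, U X, T2 X, U2 X, T4 X, U4 X, ?_, ?_, ?_⟩
  · obtain ⟨D, hD⟩ := (KA k).exists_homotopy (FA k) (cA k) (fun X _ => U X ∘ₗ T X) (fun X _ => LinearMap.id)
      (fun X Y _ _ f x => by
        have a := T1 X Y f x
        have b := U1 X Y f (T X x)
        exact b.trans (congrArg (U Y) a)) (fun X Y _ _ f x => rfl)
      (fun x => (U2 EE _).trans (congrArg (U EE) (T2 EE x))) (fun x => rfl)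
      (fun x => (U3 EE _).trans (T3 EE x))
    exact ⟨D X, hD X⟩
  · obtain ⟨D, hD⟩ := (KB k).exists_homotopy (FB k) (cB k) (fun X _ => T X ∘ₗ U X) (fun X _ => LinearMap.id)
      (fun X Y _ _ f x => by
        have a := U1 X Y f x
        have b := T1 X Y f (U X x)
        exact b.trans (congrArg (T Y) a)) (fun X Y _ _ f x => rfl)
      (fun x => (T2 EE _).trans (congrArg (T EE) (U2 EE x))) (fun x => rfl)
      (fun x => (T3 EE _).trans (U3 EE x))
    exact ⟨D X, hD X⟩
  · intro i j hij
    have hne : i ≠ j := by rintro rfl; omega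
    have htb : ∀ (X : Type) [TopologicalSpace X] (x : TP k (Ch X)), tau sgn i j (bdA x) = bdA (tau sgn i j x) :=
      fun X _ x => LinearMap.congr_fun (tau_bd (s := sgn) (d := bd) sgn_sq bd_sgn hij) x
    obtain ⟨D, hD⟩ := (KA k).exists_homotopy (FB k) (cB k)
      (fun X _ => cmap (permMap (Equiv.swap i j)) ∘ₗ T X ∘ₗ tau sgn i j) T
      (fun X Y _ _ f x => by
        change cmap (pim f) (cmap (permMap (Equiv.swap i j)) (T X (tau sgn i j x))) =
          cmap (permMap (Equiv.swap i j)) (T Y (tau sgn i j (mapA f x)))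
        rw [cmap_cmap, permMap_pim, ← cmap_cmap]
        congr 1
        refine (T1 X Y (fun l => f ((Equiv.swap i j).symm l)) _).trans ?_
        congr 1
        have := LinearMap.congr_fun (tm_tau (s := sgn) (s' := sgn) (fun l => cmap (f ((Equiv.swap i j).symm l)))
          (fun l => LinearMap.ext fun x => (sgn_cmap _ x).symm) i j) x
        refine this.trans ?_
        simp [mapA]) T1
      (fun x => by
        change bd (cmap (permMap (Equiv.swap i j)) (T EE (tau sgn i j x))) =
          cmap (permMap (Equiv.swap i j)) (T EE (tau sgn i j (bdA x)))
        rw [bd_cmap, T2, htb]) (T2 EE)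
      (fun x => by
        change aug (cmap (permMap (Equiv.swap i j)) (T EE (tau sgn i j x))) = aug (T EE x)
        rw [aug_cmap, T3, T3, augA_tau hne])
    exact ⟨D X, hD X⟩

end BCT

namespace BCT
open Topology Filter
open scoped TensorProduct DirectSum
set_option linter.unusedVariables false
set_option linter.unusedSimpArgs false
set_option linter.unusedSectionVars false

section alg
variable (V : ℕ → Type) [∀ i, AddCommGroup (V i)] [∀ i, Module ℚ (V i)]

/-- sign operator -/
noncomputable def sW : Module.End ℚ (⨁ i, V i) :=
  DirectSum.toModule ℚ ℕ _ (fun j => (-1:ℚ)^j • DirectSum.lof ℚ ℕ V j)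

lemma sW_of (j : ℕ) (v : V j) : sW V (DirectSum.of V j v) = (-1:ℚ)^j • DirectSum.of V j v := by
  have := DirectSum.toModule_lof ℚ (φ := fun j => (-1:ℚ)^j • DirectSum.lof ℚ ℕ V j) j v
  exact this

lemma ds_ext {D : Type*} [AddCommGroup D] [Module ℚ D] {f g : (⨁ i, V i) →ₗ[ℚ] D}
    (h : ∀ j v, f (DirectSum.of V j v) = g (DirectSum.of V j v)) : f = g := by
  apply DirectSum.linearMap_ext
  intro j
  ext v
  exact h j v

/-- total degree n part -/
noncomputable def WS (k n : ℕ) : Submodule ℚ (TP k (⨁ i, V i)) :=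
  Submodule.span ℚ {y | ∃ (m : Fin k → ℕ) (v : ∀ l, V (m l)), ∑ l, m l = n ∧
    y = PiTensorProduct.tprod ℚ (fun l => DirectSum.of V (m l) (v l))}

end alg

section
variable {X : Type} [TopologicalSpace X]

lemma exists_split : ∃ h : Ch X →ₗ[ℚ] Ch X, (∀ x, bd (h (bd x)) = bd x) ∧
    (∀ n x, x ∈ S n (Set.univ : Set X) → h x ∈ S (n+1) (Set.univ : Set X)) := by
  obtain ⟨r, hr⟩ := LinearMap.exists_rightInverse_of_surjective
    (bd : Ch X →ₗ[ℚ] Ch X).rangeRestrict (LinearMap.range_rangeRestrict _)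
  obtain ⟨h0, hh0⟩ := LinearMap.exists_extend r
  have e0 : ∀ x, bd (h0 (bd x)) = bd x := by
    intro x
    have e1 : h0 (bd x) = r ⟨bd x, LinearMap.mem_range_self _ x⟩ :=
      LinearMap.congr_fun hh0 ⟨bd x, LinearMap.mem_range_self _ x⟩
    rw [e1]
    exact congrArg Subtype.val (LinearMap.congr_fun hr ⟨bd x, LinearMap.mem_range_self _ x⟩)
  let h : Ch X →ₗ[ℚ] Ch X := Finsupp.linearCombination ℚ (fun σ => dg (σ.1+1) (h0 (sg σ)))
  have hh : ∀ n x, x ∈ S n (Set.univ : Set X) → h x = dg (n+1) (h0 x) := by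
    intro n x hx
    exact S_congr h (dg (n+1) ∘ₗ h0) (fun σ _ => by
      rw [lift_sg]; rfl) hx
  refine ⟨h, fun x => ?_, fun n x hx => ?_⟩
  · have : bd ∘ₗ h ∘ₗ bd = (bd : Ch X →ₗ[ℚ] Ch X) := by
      apply Ch.hom_ext
      rintro ⟨n, σ⟩
      change bd (h (bd _)) = _
      cases n with
      | zero => rw [bd_zero, map_zero, map_zero]
      | succ n =>
        have hs : bd (sg ⟨n+1, σ⟩) ∈ S n (Set.univ : Set X) := bd_mem_S (sg_mem_S' ⟨n+1, σ⟩)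
        rw [hh _ _ hs, ← dg_bd, e0, dg_of_mem hs]
    exact LinearMap.congr_fun this x
  · rw [hh n x hx]; exact dg_mem _ _

/-- endomorphism anticommuting with sgn -/
lemma anti_sgn {h : Ch X →ₗ[ℚ] Ch X} (hd : ∀ n x, x ∈ S n (Set.univ : Set X) → h x ∈ S (n+1) (Set.univ : Set X))
    (x : Ch X) : h (sgn x) = - sgn (h x) := by
  have : h ∘ₗ sgn = - (sgn ∘ₗ h) := by
    apply Ch.hom_ext
    intro σ
    simp only [LinearMap.comp_apply, LinearMap.neg_apply]
    rw [sgn_of_mem (hd _ _ (sg_mem_S' σ)), sgn_sg, map_smul, pow_succ]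
    simp
  exact LinearMap.congr_fun this x

lemma comm_sgn {h : Ch X →ₗ[ℚ] Ch X} (hd : ∀ n x, x ∈ S n (Set.univ : Set X) → h x ∈ S n (Set.univ : Set X))
    (x : Ch X) : h (sgn x) = sgn (h x) := by
  have : h ∘ₗ sgn = (sgn ∘ₗ h) := by
    apply Ch.hom_ext
    intro σ
    simp only [LinearMap.comp_apply, LinearMap.neg_apply]
    rw [sgn_of_mem (hd _ _ (sg_mem_S' σ)), sgn_sg, map_smul]
  exact LinearMap.congr_fun this x

variable (X) in
/-- homology as a family -/
abbrev Vs (j : ℕ) : Type := SingularHomology ℚ j X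

theorem exists_sdr : ∃ (i : (⨁ j, Vs X j) →ₗ[ℚ] Ch X) (q : Ch X →ₗ[ℚ] ⨁ j, Vs X j) (H : Ch X →ₗ[ℚ] Ch X),
    (∀ v, bd (i v) = 0) ∧ (∀ x, q (bd x) = 0) ∧ (∀ v, q (i v) = v) ∧
    (∀ x, bd (H x) + H (bd x) = x - i (q x)) ∧
    (∀ j v, i (DirectSum.of (Vs X) j v) ∈ S j (Set.univ : Set X)) ∧
    (∀ n x, x ∈ S n (Set.univ : Set X) → ∃ v, q x = DirectSum.of (Vs X) n v) ∧
    (∀ n x, x ∈ S n (Set.univ : Set X) → H x ∈ S (n+1) (Set.univ : Set X)) := by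
  obtain ⟨h, h1, h2⟩ := exists_split (X := X)
  let p : Ch X →ₗ[ℚ] Ch X := LinearMap.id - bd ∘ₗ h - h ∘ₗ bd
  have pe : ∀ x, p x = x - bd (h x) - h (bd x) := fun x => rfl
  have bp : ∀ x, bd (p x) = 0 := by
    intro x; rw [pe, map_sub, map_sub, bd_bd, h1]; simp
  have pb : ∀ x, p (bd x) = 0 := by
    intro x; rw [pe, h1, bd_bd]; simp
  have pS : ∀ n x, x ∈ S n (Set.univ : Set X) → p x ∈ S n (Set.univ : Set X) := by
    intro n x hx
    rw [pe]
    refine Submodule.sub_mem _ (Submodule.sub_mem _ hx (bd_mem_S (h2 _ _ hx))) ?_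
    cases n with
    | zero => rw [bd_S_zero hx, map_zero]; exact Submodule.zero_mem _
    | succ n => exact h2 _ _ (bd_mem_S hx)
  have qmem : ∀ n x, dg n (p x) ∈ Zc X n := by
    intro n x
    refine ⟨dg_mem _ _, ?_⟩
    change bd _ = 0
    cases n with
    | zero => exact bd_S_zero (dg_mem 0 _)
    | succ n => rw [← dg_bd, bp, map_zero]
  let qn : ∀ n, Ch X →ₗ[ℚ] Vs X n := fun n => cls X n ∘ₗ LinearMap.codRestrict (Zc X n) (dg n ∘ₗ p) (qmem n)
  have qne : ∀ n x, qn n x = cls X n ⟨dg n (p x), qmem n x⟩ := fun _ _ => rfl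
  let q : Ch X →ₗ[ℚ] ⨁ j, Vs X j := Finsupp.linearCombination ℚ (fun σ => DirectSum.of (Vs X) σ.1 (qn σ.1 (sg σ)))
  have qe : ∀ n x, x ∈ S n (Set.univ : Set X) → q x = DirectSum.of (Vs X) n (qn n x) := by
    intro n x hx
    exact S_congr q (DirectSum.lof ℚ ℕ (Vs X) n ∘ₗ qn n) (fun σ _ => by
      rw [lift_sg]; rfl) hx
  have hr : ∀ n, ∃ r : Vs X n →ₗ[ℚ] Zc X n, cls X n ∘ₗ r = LinearMap.id := fun n =>
    LinearMap.exists_rightInverse_of_surjective (cls X n) (LinearMap.range_eq_top.2 (cls_surj n))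
  choose r hr using hr
  let i : (⨁ j, Vs X j) →ₗ[ℚ] Ch X := DirectSum.toModule ℚ ℕ _ (fun n => p ∘ₗ (Zc X n).subtype ∘ₗ r n)
  have ie : ∀ n v, i (DirectSum.of (Vs X) n v) = p (r n v : Ch X) := fun n v =>
    DirectSum.toModule_lof ℚ (φ := fun n => p ∘ₗ (Zc X n).subtype ∘ₗ r n) n v
  have rS : ∀ n v, (r n v : Ch X) ∈ S n (Set.univ : Set X) := fun n v => (r n v).2.1
  have rb : ∀ n v, bd (r n v : Ch X) = 0 := fun n v => (r n v).2.2
  have iqp : ∀ x, i (q x) = p (p x) := by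
    intro x
    have : i ∘ₗ q = p ∘ₗ p := by
      apply Ch.hom_ext
      intro σ
      have hσ := sg_mem_S' σ
      rw [LinearMap.comp_apply, qe _ _ hσ, ie, LinearMap.comp_apply]
      have e1 : cls X σ.1 (r σ.1 (qn σ.1 (sg σ)) - ⟨dg σ.1 (p (sg σ)), qmem _ _⟩) = 0 := by
        rw [map_sub, ← qne]
        have := LinearMap.congr_fun (hr σ.1) (qn σ.1 (sg σ))
        rw [LinearMap.comp_apply] at this
        rw [this]; simp
      rw [cls_eq_zero] at e1
      obtain ⟨b, _, hb⟩ := e1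
      have e2 : ((r σ.1 (qn σ.1 (sg σ)) : Zc X σ.1) : Ch X) = p (sg σ) + bd b := by
        rw [hb, AddSubgroupClass.coe_sub]
        simp only [dg_of_mem (pS _ _ hσ)]
        abel
      change p ((r σ.1 (qn σ.1 (sg σ)) : Zc X σ.1) : Ch X) = p (p (sg σ))
      rw [e2, map_add, pb, add_zero]
    exact LinearMap.congr_fun this x
  refine ⟨i, q, h + p ∘ₗ h, ?_, ?_, ?_, ?_, ?_, ?_, ?_⟩
  · intro v
    have : bd ∘ₗ i = 0 := by
      apply ds_ext
      intro j v
      rw [LinearMap.comp_apply, ie, bp]; rfl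
    exact LinearMap.congr_fun this v
  · intro x
    have : q ∘ₗ bd = 0 := by
      apply Ch.hom_ext
      rintro ⟨n, σ⟩
      rw [LinearMap.comp_apply]
      cases n with
      | zero => rw [bd_zero, map_zero]; rfl
      | succ n =>
        have e : qn n (bd (sg ⟨n+1, σ⟩)) = 0 := by
          rw [qne, cls_eq_zero]
          exact ⟨0, Submodule.zero_mem _, by simp [pb]⟩
        rw [qe _ _ (bd_mem_S (sg_mem_S' ⟨n+1, σ⟩)), e, map_zero]; rfl
    exact LinearMap.congr_fun this x
  · intro v
    have : q ∘ₗ i = LinearMap.id := by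
      apply ds_ext
      intro j v
      rw [LinearMap.comp_apply, ie, qe j _ (pS _ _ (rS j v)), LinearMap.id_apply]
      congr 1
      have e0 := LinearMap.congr_fun (hr j) v
      rw [LinearMap.comp_apply, LinearMap.id_apply] at e0
      conv_rhs => rw [← e0]
      rw [qne, ← sub_eq_zero, ← map_sub, cls_eq_zero]
      refine ⟨- (h (r j v : Ch X) + h (p (r j v : Ch X))), Submodule.neg_mem _ (Submodule.add_mem _ (h2 _ _ (rS j v)) (h2 _ _ (pS _ _ (rS j v)))), ?_⟩
      have e1 : p (p (r j v : Ch X)) = r j v - bd (h (r j v : Ch X)) - bd (h (p (r j v : Ch X))) := by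
        rw [pe (p _), bp, map_zero, sub_zero]
        congr 1
        rw [pe, rb, map_zero, sub_zero]
      simp only [AddSubgroupClass.coe_sub]
      rw [dg_of_mem (pS _ _ (pS _ _ (rS j v))), e1, map_neg, map_add]
      abel
    exact LinearMap.congr_fun this v
  · intro x
    rw [iqp]
    simp only [LinearMap.add_apply, LinearMap.comp_apply, map_add, bp]
    have e2 : p (p x) = p x - p (h (bd x)) := by
      have := congrArg p (pe x)
      rw [map_sub, map_sub, pb, sub_zero] at this
      exact this
    rw [e2, pe x]
    abel
  · intro j v
    rw [ie]; exact pS _ _ (rS j v)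
  · intro n x hx
    exact ⟨_, qe n x hx⟩
  · intro n x hx
    exact Submodule.add_mem _ (h2 _ _ hx) (pS _ _ (h2 _ _ hx))

end
end BCT

namespace BCT
open Topology Filter
open scoped TensorProduct DirectSum
set_option linter.unusedVariables false
set_option linter.unusedSimpArgs false
set_option linter.unusedSectionVars false

lemma tbd_zero {C : Type} [AddCommGroup C] [Module ℚ C] {k : ℕ} (s : Module.End ℚ C) :
    (tbd s 0 : Module.End ℚ (TP k C)) = 0 := by
  rw [tbd]
  refine Finset.sum_eq_zero fun j _ => ?_
  apply tp_ext
  intro x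
  rw [tm_tprod]
  apply (PiTensorProduct.tprod ℚ).map_coord_zero j
  simp [Wp]

theorem kunneth (k : ℕ) (X : Type) [TopologicalSpace X] :
    ∃ (I : TP k (⨁ j, Vs X j) →ₗ[ℚ] Ch (Fin k → X)) (J : Ch (Fin k → X) →ₗ[ℚ] TP k (⨁ j, Vs X j)),
    (∀ v, bd (I v) = 0) ∧ (∀ x, J (bd x) = 0) ∧ (∀ v, J (I v) = v) ∧
    (∀ z, bd z = 0 → ∃ b, z = I (J z) + bd b) ∧
    (∀ i j : Fin k, (i:ℕ) + 1 = j → ∀ v, ∃ b,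
      cmap (permMap (Equiv.swap i j)) (I (tau (sW (Vs X)) i j v)) = I v + bd b) ∧
    (∀ n v, v ∈ WS (Vs X) k n → I v ∈ S n (Set.univ : Set (Fin k → X))) ∧
    (∀ n x, x ∈ S n (Set.univ : Set (Fin k → X)) → J x ∈ WS (Vs X) k n) := by
  obtain ⟨i, q, H, hbi, hqb, hqi, hH, hiS, hqS, hHS⟩ := exists_sdr (X := X)
  obtain ⟨T, U, hT, hU, hTS, hUS, ⟨D1, hD1⟩, ⟨D2, hD2⟩, hsw⟩ := EZ k X
  have isg : i ∘ₗ sW (Vs X) = sgn ∘ₗ i := by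
    apply ds_ext
    intro j v
    rw [LinearMap.comp_apply, LinearMap.comp_apply, sW_of, map_smul, sgn_of_mem (hiS j v)]
  have qsg : q ∘ₗ sgn = sW (Vs X) ∘ₗ q := by
    apply Ch.hom_ext
    intro σ
    obtain ⟨v, hv⟩ := hqS _ _ (sg_mem_S' σ)
    rw [LinearMap.comp_apply, LinearMap.comp_apply, sgn_sg, map_smul, hv, sW_of]
  have tmi : ∀ v, bdA (tm (fun _ : Fin k => i) v) = 0 := by
    intro v
    have := LinearMap.congr_fun (tm_chain (k := k) (s := sW (Vs X)) (d := 0) (s' := sgn) (d' := bd) (fun _ => i)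
      (fun _ => isg) (fun _ => by
        refine LinearMap.ext fun v => ?_
        simp [hbi])) v
    rw [tbd_zero] at this
    simpa [bdA] using this.symm
  have tmq : ∀ x, tm (fun _ : Fin k => q) (bdA x) = 0 := by
    intro v
    have := LinearMap.congr_fun (tm_chain (k := k) (s := sgn) (d := bd) (s' := sW (Vs X)) (d' := 0) (fun _ => q)
      (fun _ => qsg) (fun _ => by
        refine LinearMap.ext fun v => ?_
        simp [hqb])) v
    rw [tbd_zero] at this
    simpa [bdA] using this
  have tmqi : ∀ v, tm (fun _ : Fin k => q) (tm (fun _ : Fin k => i) v) = v := by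
    intro v
    have := LinearMap.congr_fun (tm_comp (k := k) (fun _ => q) (fun _ => i)) v
    refine this.trans ?_
    have e : q ∘ₗ i = 1 := LinearMap.ext hqi
    rw [e]
    exact LinearMap.congr_fun tm_one v
  have iqS : ∀ n x, x ∈ S n (Set.univ : Set X) → (i ∘ₗ q) x ∈ S n (Set.univ : Set X) := by
    intro n x hx
    obtain ⟨v, hv⟩ := hqS _ _ hx
    rw [LinearMap.comp_apply, hv]; exact hiS _ _
  have hth : ∀ x : TP k (Ch X), bdA (thom sgn (i ∘ₗ q) H x) + thom sgn (i ∘ₗ q) H (bdA x) =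
      x - tm (fun _ : Fin k => i) (tm (fun _ : Fin k => q) x) := by
    intro x
    have := LinearMap.congr_fun (thom_bd (k := k) (s := sgn) (d := bd) (f := i ∘ₗ q) (h := H) sgn_sq bd_sgn
      (LinearMap.ext fun x => comm_sgn iqS x) (LinearMap.ext fun x => by
        change bd (i (q x)) = i (q (bd x))
        rw [hbi, hqb, map_zero])
      (LinearMap.ext fun x => anti_sgn hHS x) (LinearMap.ext fun x => hH x)) x
    refine this.trans ?_
    rw [← tm_comp (k := k) (fun _ => i) (fun _ => q)]; rfl
  refine ⟨T ∘ₗ tm (fun _ => i), tm (fun _ => q) ∘ₗ U, ?_, ?_, ?_, ?_, ?_, ?_, ?_⟩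
  · intro v
    rw [LinearMap.comp_apply, hT, tmi, map_zero]
  · intro x
    rw [LinearMap.comp_apply, ← hU, tmq]
  · intro v
    simp only [LinearMap.comp_apply]
    have h := hD1 (tm (fun _ : Fin k => i) v)
    rw [tmi, map_zero, add_zero] at h
    rw [← sub_eq_zero]
    conv_lhs => rw [← tmqi v]
    rw [← sub_eq_zero, sub_zero, tmqi]
    conv_lhs => rhs; rw [← tmqi v]
    rw [← map_sub, ← h, tmq]
  · intro z hz
    have h1 := hD2 z
    have h2 := hth (U z)
    rw [hU, hz, map_zero, map_zero, add_zero] at h2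
    rw [hz, map_zero, add_zero] at h1
    refine ⟨T (thom sgn (i ∘ₗ q) H (U z)) - D2 z, ?_⟩
    rw [map_sub, hT, h2, h1, map_sub]
    simp only [LinearMap.comp_apply]
    abel
  · intro a b hab v
    obtain ⟨D, hD⟩ := hsw a b hab
    have h := hD (tm (fun _ : Fin k => i) v)
    rw [tmi, map_zero, add_zero] at h
    refine ⟨D (tm (fun _ : Fin k => i) v), ?_⟩
    rw [h]
    have := LinearMap.congr_fun (tm_tau (k := k) (s := sW (Vs X)) (s' := sgn) (fun _ => i) (fun _ => isg) a b) v
    simp only [LinearMap.comp_apply] at this ⊢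
    rw [this]
    abel
  · intro n v hv
    rw [WS] at hv
    induction hv using Submodule.span_induction with
    | mem x hx =>
      obtain ⟨m, w, hm, rfl⟩ := hx
      rw [LinearMap.comp_apply, tm_tprod]
      exact hTS _ _ (tprod_mem_AS (fun l => hiS _ _) hm)
    | zero => rw [map_zero]; exact Submodule.zero_mem _
    | add x y _ _ hx hy => rw [map_add]; exact Submodule.add_mem _ hx hy
    | smul a x _ hx => rw [map_smul]; exact Submodule.smul_mem _ _ hx
  · intro n x hx
    have h := hUS n x hx
    rw [LinearMap.comp_apply]
    generalize U x = y at h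
    rw [AS] at h
    induction h using Submodule.span_induction with
    | mem x hx =>
      obtain ⟨m, w, hw, hm, rfl⟩ := hx
      rw [tm_tprod]
      choose v hv using fun l => hqS _ _ (hw l)
      exact Submodule.subset_span ⟨m, v, hm, by simp only [hv]⟩
    | zero => rw [map_zero]; exact Submodule.zero_mem _
    | add x y _ _ hx hy => rw [map_add]; exact Submodule.add_mem _ hx hy
    | smul a x _ hx => rw [map_smul]; exact Submodule.smul_mem _ _ hx

end BCT

namespace BCT
open Topology Filter
open scoped TensorProduct DirectSum
set_option linter.unusedVariables false
set_option linter.unusedSimpArgs false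
set_option linter.unusedSectionVars false

section
variable (V : ℕ → Type) [∀ i, AddCommGroup (V i)] [∀ i, Module ℚ (V i)]

/-- the quotient map -/
noncomputable def piA : TensorAlgebra ℚ (⨁ i, V i) →ₐ[ℚ] FreeGCAlg V := RingQuot.mkAlgHom ℚ (GradedCommRel V)

noncomputable def gA : (⨁ i, V i) →ₗ[ℚ] FreeGCAlg V := (piA V).toLinearMap ∘ₗ TensorAlgebra.ι ℚ

lemma gA_of (j : ℕ) (v : V j) : gA V (DirectSum.of V j v) = FreeGCAlg.gen V ⟨j, v⟩ := rfl

lemma gA_comm (i j : ℕ) (a : V i) (b : V j) : gA V (DirectSum.of V i a) * gA V (DirectSum.of V j b) =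
    (-1:ℚ)^(i*j) • (gA V (DirectSum.of V j b) * gA V (DirectSum.of V i a)) := by
  have h : piA V _ = piA V _ := RingQuot.mkAlgHom_rel ℚ (GradedCommRel.comm (V := V) i j a b)
  rw [map_mul, map_smul, map_mul] at h
  exact h

noncomputable def mkA (k : ℕ) : TP k (⨁ i, V i) →ₗ[ℚ] FreeGCAlg V :=
  PiTensorProduct.lift ((MultilinearMap.mkPiAlgebraFin ℚ k (FreeGCAlg V)).compLinearMap (fun _ => gA V))

lemma mkA_tprod (k : ℕ) (x : Fin k → ⨁ i, V i) :
    mkA V k (PiTensorProduct.tprod ℚ x) = (List.ofFn fun l => gA V (x l)).prod := by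
  rw [mkA, PiTensorProduct.lift.tprod]
  simp [MultilinearMap.mkPiAlgebraFin_apply]

/-- homogeneous elements -/
def Hom' (x : ⨁ i, V i) (m : ℕ) : Prop := ∃ v : V m, x = DirectSum.of V m v

lemma swap_succ {k : ℕ} (i j l : Fin k) : Equiv.swap i.succ j.succ l.succ = (Equiv.swap i j l).succ := by
  rw [Equiv.swap_apply_def, Equiv.swap_apply_def]
  split_ifs <;> simp_all

lemma swap_prod : ∀ (k : ℕ) (x : Fin k → ⨁ i, V i) (m : Fin k → ℕ) (hx : ∀ l, Hom' V (x l) (m l))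
    (i j : Fin k), (i:ℕ) + 1 = j →
    (List.ofFn fun l => gA V (x l)).prod =
      (-1:ℚ)^(m i * m j) • (List.ofFn fun l => gA V (x (Equiv.swap i j l))).prod := by
  intro k
  induction k with
  | zero => intro x m hx i; exact i.elim0
  | succ k ih =>
    intro x m hx i j hij
    rw [List.ofFn_succ, List.ofFn_succ, List.prod_cons, List.prod_cons]
    obtain ⟨j, rfl⟩ : ∃ j', j = Fin.succ j' := Fin.eq_succ_of_ne_zero (by
      rintro rfl
      simp at hij)
    induction i using Fin.cases with
    | zero =>
      obtain ⟨k, rfl⟩ : ∃ k', k = k' + 1 := ⟨k - 1, by have := j.2; omega⟩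
      have hj : j = 0 := by
        apply Fin.ext
        simp at hij ⊢
        omega
      subst hj
      rw [List.ofFn_succ, List.ofFn_succ, List.prod_cons, List.prod_cons]
      obtain ⟨a, ha⟩ := hx 0
      obtain ⟨b, hb⟩ := hx (Fin.succ 0)
      have e : ∀ l : Fin k, Equiv.swap (0 : Fin (k+2)) (Fin.succ 0) l.succ.succ = l.succ.succ := by
        intro l
        apply Equiv.swap_apply_of_ne_of_ne
        · exact Fin.succ_ne_zero _
        · intro h
          exact Fin.succ_ne_zero _ (Fin.succ_injective _ h)
      simp only [e, Equiv.swap_apply_left, Equiv.swap_apply_right]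
      rw [ha, hb, ← mul_assoc, gA_comm, smul_mul_assoc, mul_assoc]
    | succ i =>
      have := ih (fun l => x l.succ) (fun l => m l.succ) (fun l => hx _) i j (by simpa using hij)
      rw [this, mul_smul_comm]
      have e : Equiv.swap i.succ j.succ 0 = 0 := by
        apply Equiv.swap_apply_of_ne_of_ne
        · exact (Fin.succ_ne_zero _).symm
        · exact (Fin.succ_ne_zero _).symm
      simp only [swap_succ, e]

lemma hom_span (k : ℕ) : Submodule.span ℚ {y : TP k (⨁ i, V i) | ∃ (m : Fin k → ℕ) (x : Fin k → ⨁ i, V i),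
    (∀ l, Hom' V (x l) (m l)) ∧ y = PiTensorProduct.tprod ℚ x} = ⊤ := by
  classical
  rw [eq_top_iff, ← PiTensorProduct.span_tprod_eq_top, Submodule.span_le]
  rintro _ ⟨x, rfl⟩
  have hx : x = fun l => ∑ j ∈ DFinsupp.support (x l), DirectSum.of V j (x l j) := by
    funext l
    exact (DirectSum.sum_support_of (x l)).symm
  rw [hx, MultilinearMap.map_sum_finset]
  refine Submodule.sum_mem _ fun r _ => Submodule.subset_span ⟨r, _, fun l => ⟨_, rfl⟩, rfl⟩

lemma sW_hom {x : ⨁ i, V i} {m : ℕ} (h : Hom' V x m) : sW V x = (-1:ℚ)^m • x := by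
  obtain ⟨v, rfl⟩ := h
  exact sW_of V m v

lemma mkA_tau (k : ℕ) (i j : Fin k) (hij : (i:ℕ) + 1 = j) (v : TP k (⨁ i, V i)) :
    mkA V k (tau (sW V) i j v) = mkA V k v := by
  have hne : i ≠ j := by rintro rfl; omega
  have : mkA V k ∘ₗ tau (sW V) i j = mkA V k := by
    apply LinearMap.ext_on (hom_span V k)
    rintro _ ⟨m, x, hx, rfl⟩
    rw [LinearMap.comp_apply, tau_tprod hne (sW_hom V (hx i)) (sW_hom V (hx j)), map_smul, mkA_tprod, mkA_tprod]
    exact (swap_prod V k x m hx i j hij).symm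
  exact LinearMap.congr_fun this v

lemma mkA_WS (k n : ℕ) : (WS V k n).map (mkA V k) = SymComponent V k n := by
  rw [WS, SymComponent, Submodule.map_span]
  congr 1
  ext y
  constructor
  · rintro ⟨_, ⟨m, v, hm, rfl⟩, rfl⟩
    refine ⟨List.ofFn fun l => ⟨m l, v l⟩, by simp, ?_, ?_⟩
    · rw [List.map_ofFn, List.sum_ofFn, ← hm]; rfl
    · rw [mkA_tprod, List.map_ofFn]; rfl
  · rintro ⟨l, rfl, hi, rfl⟩
    refine ⟨_, ⟨fun a => (l.get a).1, fun a => (l.get a).2, ?_, rfl⟩, ?_⟩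
    · rw [← hi, ← List.sum_ofFn]
      congr 1
      apply List.ext_get <;> simp
    · rw [mkA_tprod]
      congr 1
      apply List.ext_get <;> simp [gA_of]

/-- relations -/
noncomputable def Rk (k : ℕ) : Submodule ℚ (TP k (⨁ i, V i)) :=
  Submodule.span ℚ {y | ∃ (m : Fin k → ℕ) (x : Fin k → ⨁ i, V i) (i j : Fin k), (∀ l, Hom' V (x l) (m l)) ∧
    (i:ℕ) + 1 = j ∧ y = PiTensorProduct.tprod ℚ x -
      (-1:ℚ)^(m i * m j) • PiTensorProduct.tprod ℚ (fun l => x (Equiv.swap i j l))}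

noncomputable def consL (k : ℕ) : (⨁ i, V i) →ₗ[ℚ] TP k (⨁ i, V i) →ₗ[ℚ] TP (k+1) (⨁ i, V i) :=
  (PiTensorProduct.lift).toLinearMap ∘ₗ
    (PiTensorProduct.tprod ℚ : MultilinearMap ℚ (fun _ : Fin (k+1) => ⨁ i, V i) _).curryLeft

lemma consL_tprod (k : ℕ) (w : ⨁ i, V i) (x : Fin k → ⨁ i, V i) :
    consL V k w (PiTensorProduct.tprod ℚ x) = PiTensorProduct.tprod ℚ (Fin.cons w x : Fin (k+1) → ⨁ i, V i) := by
  simp [consL]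

lemma consL_of_R (k : ℕ) (j : ℕ) (v : V j) : Rk V k ≤ (Rk V (k+1)).comap (consL V k (DirectSum.of V j v)) := by
  conv_lhs => rw [Rk]
  rw [Submodule.span_le]
  rintro _ ⟨m, x, a, b, hx, hab, rfl⟩
  rw [SetLike.mem_coe, Submodule.mem_comap, map_sub, map_smul, consL_tprod, consL_tprod]
  refine Submodule.subset_span ⟨Fin.cons j m, Fin.cons (DirectSum.of V j v) x, a.succ, b.succ, ?_, by simpa using hab, ?_⟩
  · intro l
    induction l using Fin.cases with
    | zero => exact ⟨v, rfl⟩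
    | succ l => simpa using hx l
  · congr 3
    funext l
    induction l using Fin.cases with
    | zero =>
      rw [Equiv.swap_apply_of_ne_of_ne (Fin.succ_ne_zero _).symm (Fin.succ_ne_zero _).symm]
      rfl
    | succ l => rw [swap_succ]; rfl

lemma consL_R (k : ℕ) (w : ⨁ i, V i) : Rk V k ≤ (Rk V (k+1)).comap (consL V k w) := by
  intro y hy
  rw [Submodule.mem_comap]
  induction w using DirectSum.induction_on with
  | zero => rw [map_zero]; exact Submodule.zero_mem _
  | of j v => exact consL_of_R V k j v hy
  | add a b ha hb => rw [map_add]; exact Submodule.add_mem _ ha hb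

abbrev Qk (k : ℕ) : Type := TP k (⨁ i, V i) ⧸ Rk V k

noncomputable def LQ (k : ℕ) : (⨁ i, V i) →ₗ[ℚ] Qk V k →ₗ[ℚ] Qk V (k+1) where
  toFun w := Submodule.mapQ _ _ (consL V k w) (consL_R V k w)
  map_add' a b := by
    apply Submodule.linearMap_qext
    refine LinearMap.ext fun x => ?_
    simp
  map_smul' c a := by
    apply Submodule.linearMap_qext
    refine LinearMap.ext fun x => ?_
    simp

lemma LQ_mk (k : ℕ) (w : ⨁ i, V i) (y : TP k (⨁ i, V i)) :
    LQ V k w ((Rk V k).mkQ y) = (Rk V (k+1)).mkQ (consL V k w y) := rfl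

/-- left multiplication on the product of all pieces -/
noncomputable def LN : (⨁ i, V i) →ₗ[ℚ] Module.End ℚ (∀ k, Qk V k) where
  toFun w := LinearMap.pi fun k => match k with
    | 0 => 0
    | k+1 => LQ V k w ∘ₗ LinearMap.proj k
  map_add' a b := by
    ext1 f
    funext k
    cases k <;> simp
  map_smul' c a := by
    ext1 f
    funext k
    cases k <;> simp

lemma LN_zero (w : ⨁ i, V i) (f : ∀ k, Qk V k) : LN V w f 0 = 0 := rfl
lemma LN_succ (w : ⨁ i, V i) (f : ∀ k, Qk V k) (k : ℕ) : LN V w f (k+1) = LQ V k w (f k) := rfl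

lemma LN_comm (i j : ℕ) (a : V i) (b : V j) : LN V (DirectSum.of V i a) * LN V (DirectSum.of V j b) =
    (-1:ℚ)^(i*j) • (LN V (DirectSum.of V j b) * LN V (DirectSum.of V i a)) := by
  ext1 f
  funext k
  rw [Module.End.mul_apply, LinearMap.smul_apply, Module.End.mul_apply, Pi.smul_apply]
  rcases k with _ | _ | k
  · simp [LN_zero]
  · rw [LN_succ, LN_succ, LN_zero, LN_zero]; simp
  · rw [LN_succ, LN_succ, LN_succ, LN_succ]
    obtain ⟨y, hy⟩ := Submodule.mkQ_surjective _ (f k)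
    rw [← hy, LQ_mk, LQ_mk, LQ_mk, LQ_mk, ← map_smul, ← sub_eq_zero, ← map_sub, ← LinearMap.mem_ker,
      Submodule.ker_mkQ]
    let F : TP k (⨁ i, V i) →ₗ[ℚ] TP (k+2) (⨁ i, V i) :=
      consL V (k+1) (DirectSum.of V i a) ∘ₗ consL V k (DirectSum.of V j b) -
        (-1:ℚ)^(i*j) • (consL V (k+1) (DirectSum.of V j b) ∘ₗ consL V k (DirectSum.of V i a))
    have hF : (⊤ : Submodule ℚ (TP k (⨁ i, V i))) ≤ (Rk V (k+2)).comap F := by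
      rw [← hom_span, Submodule.span_le]
      rintro _ ⟨m, x, hx, rfl⟩
      rw [SetLike.mem_coe, Submodule.mem_comap]
      simp only [F, LinearMap.sub_apply, LinearMap.smul_apply, LinearMap.comp_apply]
      rw [consL_tprod, consL_tprod, consL_tprod, consL_tprod]
      refine Submodule.subset_span ⟨Fin.cons i (Fin.cons j m),
        (Fin.cons (DirectSum.of V i a) (Fin.cons (DirectSum.of V j b) x : Fin (k+1) → ⨁ i, V i) : Fin (k+2) → ⨁ i, V i),
        0, Fin.succ 0, ?_, by simp, ?_⟩
      · intro l
        induction l using Fin.cases with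
        | zero => exact ⟨a, rfl⟩
        | succ l =>
          induction l using Fin.cases with
          | zero => exact ⟨b, rfl⟩
          | succ l => simpa using hx l
      · congr 3
        funext l
        induction l using Fin.cases with
        | zero => rw [Equiv.swap_apply_left]; rfl
        | succ l =>
          induction l using Fin.cases with
          | zero => rw [Equiv.swap_apply_right]; rfl
          | succ l =>
            rw [Equiv.swap_apply_of_ne_of_ne (Fin.succ_ne_zero _) (fun h => Fin.succ_ne_zero _ (Fin.succ_injective _ h))]
            rfl
    exact hF (x := y) trivial

/-- action on the product -/
noncomputable def PhiA : FreeGCAlg V →ₐ[ℚ] Module.End ℚ (∀ k, Qk V k) :=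
  RingQuot.liftAlgHom ℚ ⟨TensorAlgebra.lift ℚ (LN V), by
    rintro _ _ ⟨i, j, a, b⟩
    simp only [map_mul, map_smul, TensorAlgebra.lift_ι_apply]
    exact LN_comm V i j a b⟩

lemma PhiA_gA (w : ⨁ i, V i) : PhiA V (gA V w) = LN V w := by
  have : PhiA V (piA V (TensorAlgebra.ι ℚ w)) = TensorAlgebra.lift ℚ (LN V) (TensorAlgebra.ι ℚ w) := by
    apply RingQuot.liftAlgHom_mkAlgHom_apply
  rw [TensorAlgebra.lift_ι_apply] at this
  exact this

noncomputable def e0 : ∀ k, Qk V k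
  | 0 => (Rk V 0).mkQ (PiTensorProduct.tprod ℚ (fun l => l.elim0))
  | _+1 => 0

lemma PhiA_mk (k : ℕ) (x : Fin k → ⨁ i, V i) :
    PhiA V (List.ofFn fun l => gA V (x l)).prod (e0 V) k = (Rk V k).mkQ (PiTensorProduct.tprod ℚ x) := by
  induction k with
  | zero =>
    simp only [List.ofFn_zero, List.prod_nil, map_one, Module.End.one_apply, e0]
    congr 2
    funext l
    exact l.elim0
  | succ k ih =>
    rw [List.ofFn_succ, List.prod_cons, map_mul, Module.End.mul_apply, PhiA_gA, LN_succ, ih, LQ_mk, consL_tprod]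
    congr 2
    exact Fin.cons_self_tail x

theorem ker_mkA {k : ℕ} {v : TP k (⨁ i, V i)} (h : mkA V k v = 0) : v ∈ Rk V k := by
  have : ((LinearMap.proj k ∘ₗ LinearMap.applyₗ (e0 V)) ∘ₗ (PhiA V).toLinearMap) ∘ₗ mkA V k = (Rk V k).mkQ := by
    apply tp_ext
    intro x
    simp only [LinearMap.comp_apply]
    rw [mkA_tprod]
    exact PhiA_mk V k x
  have h2 := LinearMap.congr_fun this v
  rw [LinearMap.comp_apply, h, map_zero] at h2
  rw [← Submodule.ker_mkQ (Rk V k), LinearMap.mem_ker, ← h2]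

theorem Rk_le (k : ℕ) : Rk V k ≤ Submodule.span ℚ {y | ∃ (x : TP k (⨁ i, V i)) (i j : Fin k),
    (i:ℕ) + 1 = j ∧ y = x - tau (sW V) i j x} := by
  rw [Rk, Submodule.span_le]
  rintro _ ⟨m, x, i, j, hx, hij, rfl⟩
  have hne : i ≠ j := by rintro rfl; omega
  refine Submodule.subset_span ⟨PiTensorProduct.tprod ℚ x, i, j, hij, ?_⟩
  rw [tau_tprod hne (sW_hom V (hx i)) (sW_hom V (hx j))]

end
end BCT

namespace BCT
open Topology Filter
open scoped TensorProduct DirectSum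
set_option linter.unusedVariables false
set_option linter.unusedSimpArgs false
set_option linter.unusedSectionVars false

section
variable (V : ℕ → Type) [∀ i, AddCommGroup (V i)] [∀ i, Module ℚ (V i)]

lemma A_ext {B : Type*} [Ring B] [Algebra ℚ B] {f g : FreeGCAlg V →ₐ[ℚ] B} (h : ∀ w, f (gA V w) = g (gA V w)) :
    f = g := by
  refine RingQuot.ringQuot_ext' ℚ (s := GradedCommRel V) f g ?_
  apply TensorAlgebra.hom_ext
  refine LinearMap.ext fun w => h w

variable {V} in
noncomputable def lamW (l0 : V 0 →ₗ[ℚ] ℚ) : (⨁ i, V i) →ₗ[ℚ] ℚ := l0 ∘ₗ DirectSum.component ℚ ℕ V 0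

variable {V} in
lemma lamW_zero (l0 : V 0 →ₗ[ℚ] ℚ) (v : V 0) : lamW l0 (DirectSum.of V 0 v) = l0 v := by
  rw [lamW, LinearMap.comp_apply]
  congr 1

variable {V} in
lemma lamW_ne (l0 : V 0 →ₗ[ℚ] ℚ) {j : ℕ} (hj : j ≠ 0) (v : V j) : lamW l0 (DirectSum.of V j v) = 0 := by
  rw [lamW, LinearMap.comp_apply, ← map_zero l0]
  congr 1
  exact DirectSum.of_eq_of_ne _ _ _ hj.symm

variable {V} in
noncomputable def shW (l0 : V 0 →ₗ[ℚ] ℚ) : (⨁ i, V i) →ₗ[ℚ] Polynomial (FreeGCAlg V) :=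
  (Polynomial.CAlgHom (R := ℚ) (A := FreeGCAlg V)).toLinearMap ∘ₗ gA V +
    (lamW l0).smulRight (Polynomial.X : Polynomial (FreeGCAlg V))

variable {V} in
lemma shW_apply (l0 : V 0 →ₗ[ℚ] ℚ) (w : ⨁ i, V i) :
    shW l0 w = Polynomial.C (gA V w) + lamW l0 w • (Polynomial.X : Polynomial (FreeGCAlg V)) := rfl

variable {V} in
lemma shW_comm (l0 : V 0 →ₗ[ℚ] ℚ) (i j : ℕ) (a : V i) (b : V j) :
    shW l0 (DirectSum.of V i a) * shW l0 (DirectSum.of V j b) =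
    (-1:ℚ)^(i*j) • (shW l0 (DirectSum.of V j b) * shW l0 (DirectSum.of V i a)) := by
  have hc := congrArg (Polynomial.CAlgHom (R := ℚ) (A := FreeGCAlg V)) (gA_comm V i j a b)
  rw [map_mul, map_smul, map_mul] at hc
  simp only [Polynomial.CAlgHom_apply] at hc
  simp only [shW_apply, add_mul, mul_add, hc, smul_add]
  simp only [smul_mul_assoc, mul_smul_comm, Polynomial.X_mul_C]
  by_cases h : i * j = 0
  · rw [h, pow_zero, one_smul, one_smul, one_smul, one_smul, smul_comm (lamW l0 (DirectSum.of V i a))]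
    abel
  · rw [lamW_ne l0 (left_ne_zero_of_mul h), lamW_ne l0 (right_ne_zero_of_mul h)]
    simp

variable {V} in
noncomputable def shA (l0 : V 0 →ₗ[ℚ] ℚ) : FreeGCAlg V →ₐ[ℚ] Polynomial (FreeGCAlg V) :=
  RingQuot.liftAlgHom ℚ ⟨TensorAlgebra.lift ℚ (shW l0), by
    rintro _ _ ⟨i, j, a, b⟩
    simp only [map_mul, map_smul, TensorAlgebra.lift_ι_apply]
    exact shW_comm l0 i j a b⟩

variable {V} in
lemma shA_gA (l0 : V 0 →ₗ[ℚ] ℚ) (w : ⨁ i, V i) : shA l0 (gA V w) = shW l0 w := by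
  have : shA l0 (piA V (TensorAlgebra.ι ℚ w)) = TensorAlgebra.lift ℚ (shW l0) (TensorAlgebra.ι ℚ w) := by
    apply RingQuot.liftAlgHom_mkAlgHom_apply
  rw [TensorAlgebra.lift_ι_apply] at this
  exact this

noncomputable def ccA : Polynomial (FreeGCAlg V) →ₐ[ℚ] FreeGCAlg V :=
  { Polynomial.constantCoeff with
    commutes' := fun r => by
      change Polynomial.coeff _ 0 = _
      exact Polynomial.coeff_C_zero }

lemma ccA_apply (p : Polynomial (FreeGCAlg V)) : ccA V p = p.coeff 0 := rfl

lemma gen_mul_inj {v₀ : V 0} (hv : v₀ ≠ 0) {x : FreeGCAlg V} (hx : FreeGCAlg.gen V ⟨0, v₀⟩ * x = 0) : x = 0 := by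
  obtain ⟨l0, hl⟩ := LinearMap.exists_leftInverse_of_injective (LinearMap.toSpanSingleton ℚ _ v₀)
    (LinearMap.ker_toSpanSingleton ℚ hv)
  have hl1 : l0 v₀ = 1 := by
    have := LinearMap.congr_fun hl 1
    simpa using this
  have h2 : ∀ y, ccA V (shA l0 y) = y := by
    intro y
    have : (ccA V).comp (shA l0) = AlgHom.id ℚ _ := by
      apply A_ext
      intro w
      rw [AlgHom.comp_apply, shA_gA, shW_apply, ccA_apply]
      simp
    exact AlgHom.congr_fun this y
  have h3 := congrArg (shA l0) hx
  rw [map_mul, map_zero, ← gA_of, shA_gA, shW_apply, lamW_zero, hl1, one_smul, add_comm,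
    (Polynomial.monic_X_add_C _).mul_right_eq_zero_iff] at h3
  rw [← h2 x, h3, map_zero]

lemma gen_mul_mem {k i : ℕ} (v₀ : V 0) {x : FreeGCAlg V} (hx : x ∈ SymComponent V k i) :
    FreeGCAlg.gen V ⟨0, v₀⟩ * x ∈ SymComponent V (k+1) i := by
  have : SymComponent V k i ≤ (SymComponent V (k+1) i).comap (LinearMap.mulLeft ℚ (FreeGCAlg.gen V ⟨0, v₀⟩)) := by
    conv_lhs => rw [SymComponent]
    rw [Submodule.span_le]
    rintro _ ⟨l, hl, hi, rfl⟩
    refine Submodule.subset_span ⟨⟨0, v₀⟩ :: l, by simp [hl], by simp [hi], by simp⟩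
  exact this hx

theorem sym_split {k i : ℕ} {v₀ : V 0} (hv : v₀ ≠ 0) :
    (∃ f : SymComponent V k i →ₗ[ℚ] SymComponent V (k+1) i, Function.Injective f) ∧
    Nonempty (SymComponent V (k+1) i ≃ₗ[ℚ] SymComponent V k i × (↥(SymComponent V (k+1) i) ⧸
      (Submodule.span ℚ {y | ∃ x ∈ SymComponent V k i, y = FreeGCAlg.gen V ⟨0, v₀⟩ * x}).comap
        (SymComponent V (k+1) i).subtype)) := by
  let f : SymComponent V k i →ₗ[ℚ] SymComponent V (k+1) i :=
    (LinearMap.mulLeft ℚ (FreeGCAlg.gen V ⟨0, v₀⟩)).restrict (fun x hx => gen_mul_mem V v₀ hx)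
  have hf : Function.Injective f := by
    rw [injective_iff_map_eq_zero]
    intro x hx
    apply Subtype.ext
    exact gen_mul_inj V hv (congrArg Subtype.val hx)
  refine ⟨⟨f, hf⟩, ?_⟩
  have hr : (Submodule.span ℚ {y | ∃ x ∈ SymComponent V k i, y = FreeGCAlg.gen V ⟨0, v₀⟩ * x}).comap
        (SymComponent V (k+1) i).subtype = LinearMap.range f := by
    have e : {y | ∃ x ∈ SymComponent V k i, y = FreeGCAlg.gen V ⟨0, v₀⟩ * x} =
        ((SymComponent V k i).map (LinearMap.mulLeft ℚ (FreeGCAlg.gen V ⟨0, v₀⟩)) : Set (FreeGCAlg V)) := by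
      ext y
      constructor
      · rintro ⟨x, hx, rfl⟩; exact ⟨x, hx, rfl⟩
      · rintro ⟨x, hx, rfl⟩; exact ⟨x, hx, rfl⟩
    rw [e, Submodule.span_eq]
    ext y
    constructor
    · rintro ⟨x, hx, h⟩
      exact ⟨⟨x, hx⟩, Subtype.ext h⟩
    · rintro ⟨x, rfl⟩
      exact ⟨x.1, x.2, rfl⟩
  rw [hr]
  obtain ⟨Q, hQ⟩ := Submodule.exists_isCompl (LinearMap.range f)
  exact ⟨(Submodule.prodEquivOfIsCompl _ _ hQ).symm.trans
    ((LinearEquiv.ofInjective f hf).symm.prodCongr (Submodule.quotientEquivOfIsCompl _ _ hQ).symm)⟩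

end
end BCT

namespace BCT
open Topology Filter
open scoped TensorProduct DirectSum
set_option linter.unusedVariables false
set_option linter.unusedSimpArgs false
set_option linter.unusedSectionVars false

lemma equiv_of_surj {Z A B : Type*} [AddCommGroup Z] [Module ℚ Z] [AddCommGroup A] [Module ℚ A]
    [AddCommGroup B] [Module ℚ B] (f : Z →ₗ[ℚ] A) (g : Z →ₗ[ℚ] B) (hf : Function.Surjective f)
    (hg : Function.Surjective g) (h : ∀ z, f z = 0 ↔ g z = 0) : Nonempty (A ≃ₗ[ℚ] B) := by
  have hk : LinearMap.ker f = LinearMap.ker g := by ext z; simpa using h z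
  exact ⟨(f.quotKerEquivOfSurjective hf).symm.trans
    ((Submodule.quotEquivOfEq _ _ hk).trans (g.quotKerEquivOfSurjective hg))⟩

lemma perm_induct {k : ℕ} (p : Equiv.Perm (Fin k) → Prop) (h1 : p 1)
    (hm : ∀ g h, p g → p h → p (g * h))
    (hs : ∀ i j : Fin k, (i:ℕ)+1 = j → p (Equiv.swap i j)) (g : Equiv.Perm (Fin k)) : p g := by
  cases k with
  | zero => rw [Subsingleton.elim g 1]; exact h1
  | succ n =>
    have hg : g ∈ Submonoid.closure (Set.range fun i : Fin n ↦ Equiv.swap i.castSucc i.succ) := by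
      rw [Equiv.Perm.mclosure_swap_castSucc_succ]; trivial
    induction hg using Submonoid.closure_induction with
    | mem x hx => obtain ⟨i, rfl⟩ := hx; exact hs _ _ (by simp)
    | one => exact h1
    | mul x y _ _ hx hy => exact hm _ _ hx hy

section
variable {M : Type} [TopologicalSpace M] {k : ℕ}
  {K : TP k (⨁ j, Vs M j) →ₗ[ℚ] Ch (Fin k → M)} {J : Ch (Fin k → M) →ₗ[ℚ] TP k (⨁ j, Vs M j)}

lemma mkA_perm (h1 : ∀ v, bd (K v) = 0) (h2 : ∀ x, J (bd x) = 0) (h3 : ∀ v, J (K v) = v)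
    (h4 : ∀ z, bd z = 0 → ∃ b, z = K (J z) + bd b)
    (h5 : ∀ i j : Fin k, (i:ℕ)+1 = j → ∀ v, ∃ b, cmap (permMap (Equiv.swap i j)) (K (tau (sW (Vs M)) i j v)) = K v + bd b)
    (g : Equiv.Perm (Fin k)) : ∀ v, mkA (Vs M) k (J (cmap (permMap g) (K v))) = mkA (Vs M) k v := by
  refine perm_induct (fun g => ∀ v, mkA (Vs M) k (J (cmap (permMap g) (K v))) = mkA (Vs M) k v) ?_ ?_ ?_ g
  · intro v
    rw [permMap_one, cmap_id, LinearMap.id_apply, h3]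
  · intro g h hg hh v
    rw [← permMap_comp, ← cmap_cmap]
    obtain ⟨b, hb⟩ := h4 (cmap (permMap g) (K v)) (by rw [bd_cmap, h1, map_zero])
    rw [hb, map_add, map_add, ← bd_cmap, h2, add_zero, hh, hg]
  · intro i j hij v
    obtain ⟨b, hb⟩ := h5 i j hij v
    have := congrArg (cmap (permMap (Equiv.swap i j))) hb
    rw [cmap_cmap, permMap_comp, Equiv.swap_mul_self, permMap_one, cmap_id, LinearMap.id_apply, map_add,
      ← bd_cmap] at this
    have h6 := congrArg J this
    rw [h3, map_add, h2, add_zero] at h6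
    rw [← h6, mkA_tau _ _ i j hij]

lemma mkA_Nm (h1 : ∀ v, bd (K v) = 0) (h2 : ∀ x, J (bd x) = 0) (h3 : ∀ v, J (K v) = v)
    (h4 : ∀ z, bd z = 0 → ∃ b, z = K (J z) + bd b)
    (h5 : ∀ i j : Fin k, (i:ℕ)+1 = j → ∀ v, ∃ b, cmap (permMap (Equiv.swap i j)) (K (tau (sW (Vs M)) i j v)) = K v + bd b)
    (v) : mkA (Vs M) k (J (Nm M k (K v))) = (k.factorial : ℚ) • mkA (Vs M) k v := by
  rw [Nm_apply, map_sum, map_sum, Finset.sum_congr rfl fun g _ => mkA_perm h1 h2 h3 h4 h5 g v,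
    Finset.sum_const, Finset.card_univ, Fintype.card_perm, Fintype.card_fin, Nat.cast_smul_eq_nsmul]

lemma Nm_bd (x : Ch (Fin k → M)) : bd (Nm M k x) = Nm M k (bd x) := (ND M k).Nbd x

lemma Nm_Nm (x : Ch (Fin k → M)) : Nm M k (Nm M k x) = (k.factorial : ℚ) • Nm M k x := (ND M k).NN x

lemma Nm_rel
    (h5 : ∀ i j : Fin k, (i:ℕ)+1 = j → ∀ v, ∃ b, cmap (permMap (Equiv.swap i j)) (K (tau (sW (Vs M)) i j v)) = K v + bd b)
    {v} (hv : mkA (Vs M) k v = 0) : ∃ b, Nm M k (K v) = bd b := by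
  have h := Rk_le _ _ (ker_mkA _ hv)
  have : Submodule.span ℚ {y | ∃ x, ∃ i j : Fin k, (i:ℕ)+1 = j ∧ y = x - tau (sW (Vs M)) i j x} ≤
      (LinearMap.range (bd : Ch (Fin k → M) →ₗ[ℚ] _)).comap (Nm M k ∘ₗ K) := by
    rw [Submodule.span_le]
    rintro _ ⟨x, i, j, hij, rfl⟩
    obtain ⟨b, hb⟩ := h5 i j hij x
    have := congrArg (Nm M k) hb
    rw [Nm_perm, map_add, ← Nm_bd] at this
    refine ⟨- Nm M k b, ?_⟩
    rw [LinearMap.comp_apply, map_sub, map_sub, this, map_neg]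
    abel
  obtain ⟨b, hb⟩ := this h
  exact ⟨b, hb.symm⟩
end

section
variable {d : ℕ} {M : Type} [TopologicalSpace M] {H' : Type} [TopologicalSpace H']
  (I : ModelWithCorners ℝ (VV d) H')
  [ChartedSpace H' M] [T2Space M]

include I in
theorem bct (hd : Odd d) (k n : ℕ) :
    Nonempty (SingularHomology ℚ n (UnordConfigSpace M k) ≃ₗ[ℚ] SymComponent (Vs M) k n) := by
  obtain ⟨K, J, h1, h2, h3, h4, h5, h6, h7⟩ := kunneth k M
  obtain ⟨t, t1, t2, t3, t4⟩ := exists_transfer (M := M) (k := k)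
  have hQ := Q_main (M := M) (k := k) I hd
  have hk : (k.factorial : ℚ) ≠ 0 := by exact_mod_cast k.factorial_ne_zero
  let φ0 : Ch (UnordConfigSpace M k) →ₗ[ℚ] FreeGCAlg (Vs M) := mkA (Vs M) k ∘ₗ J ∘ₗ cmap fcInc ∘ₗ t
  have hφ0 : ∀ w, φ0 w = mkA (Vs M) k (J (cmap fcInc (t w))) := fun w => rfl
  have hφ : ∀ w ∈ Zc (UnordConfigSpace M k) n, φ0 w ∈ SymComponent (Vs M) k n := by
    intro w hw
    rw [← mkA_WS]
    refine ⟨_, h7 n _ (cmap_mem_S (W' := Set.univ) _ (fun _ _ => trivial) (t2 n w hw.1)), rfl⟩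
  let φ : Zc (UnordConfigSpace M k) n →ₗ[ℚ] SymComponent (Vs M) k n := φ0.restrict hφ
  have hinc : ∀ w, Nm M k (cmap fcInc (t w)) = (k.factorial : ℚ) • cmap fcInc (t w) := by
    intro w
    rw [← inc_NF, ← t4, t3, map_smul, map_smul]
  refine equiv_of_surj (cls (UnordConfigSpace M k) n) φ (cls_surj n) ?_ ?_
  · rintro ⟨y, hy⟩
    have hy' := hy
    rw [← mkA_WS] at hy'
    obtain ⟨v, hv, rfl⟩ := hy'
    obtain ⟨b, hb, hb'⟩ := hQ n (K v) (h6 n v hv) (by rw [h1]; exact Submodule.zero_mem _)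
    change Nm M k (K v) - bd b ∈ _ at hb'
    obtain ⟨f, hf, hf'⟩ := inc_surj hb'
    have hbf : bd f = 0 := by
      apply inc_inj
      rw [← bd_cmap, hf', map_sub, bd_bd, Nm_bd, h1, map_zero, map_zero, sub_zero]
    have hw : cmap fcPi f ∈ Zc (UnordConfigSpace M k) n :=
      ⟨cmap_mem_S (W' := Set.univ) _ (fun _ _ => trivial) hf, by
        change bd _ = 0
        rw [bd_cmap, hbf, map_zero]⟩
    have he : φ0 (cmap fcPi f) = ((k.factorial : ℚ) * (k.factorial : ℚ)) • mkA (Vs M) k v := by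
      rw [hφ0, t4, inc_NF, hf', map_sub, Nm_Nm, ← Nm_bd, map_sub, h2, sub_zero, map_smul, map_smul,
        mkA_Nm h1 h2 h3 h4 h5, smul_smul]
    refine ⟨((k.factorial : ℚ) * (k.factorial : ℚ))⁻¹ • ⟨_, hw⟩, ?_⟩
    rw [map_smul]
    apply Subtype.ext
    change _ • φ0 (cmap fcPi f) = _
    rw [he, inv_smul_smul₀ (mul_ne_zero hk hk)]
  · rintro ⟨w, hw⟩
    rw [cls_eq_zero]
    constructor
    · rintro ⟨b, hb, hb'⟩
      apply Subtype.ext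
      change φ0 w = 0
      change bd b = w at hb'
      rw [hφ0, ← hb', ← t1, ← bd_cmap, h2, map_zero]
    · intro h
      have h0 : mkA (Vs M) k (J (cmap fcInc (t w))) = 0 := congrArg Subtype.val h
      have hbw : bd w = 0 := hw.2
      obtain ⟨b1, hb1⟩ := h4 (cmap fcInc (t w)) (by rw [bd_cmap, t1, hbw, map_zero, map_zero])
      obtain ⟨b2, hb2⟩ := Nm_rel h5 h0
      have hN := congrArg (Nm M k) hb1
      rw [hinc, map_add, hb2, ← Nm_bd, ← map_add] at hN
      have hzS : cmap fcInc (t w) ∈ S n (Set.univ : Set (Fin k → M)) :=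
        cmap_mem_S (W' := Set.univ) _ (fun _ _ => trivial) (t2 n w hw.1)
      have hzI : cmap fcInc (t w) ∈ S n {x : Fin k → M | Function.Injective x} :=
        cmap_mem_S _ (fun x _ => x.2) (t2 n w hw.1)
      have hN2 := congrArg (dg n) hN
      rw [map_smul, dg_of_mem hzS, dg_bd] at hN2
      obtain ⟨e, he, he'⟩ := hQ (n+1) (dg (n+1) (b2 + Nm M k b1)) (dg_mem _ _)
        (by rw [Sd_succ, ← hN2]; exact Submodule.smul_mem _ _ hzI)
      change Nm M k _ - bd e ∈ _ at he'
      obtain ⟨f, hf, hf'⟩ := inc_surj he'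
      have hbf : bd f = ((k.factorial : ℚ) * (k.factorial : ℚ)) • t w := by
        apply inc_inj
        rw [← bd_cmap, hf', map_sub, bd_bd, Nm_bd, ← hN2, map_smul, hinc, sub_zero, smul_smul, map_smul]
      let c : ℚ := (k.factorial : ℚ) * (k.factorial : ℚ) * (k.factorial : ℚ)
      refine ⟨c⁻¹ • cmap fcPi f, Submodule.smul_mem _ _ (cmap_mem_S (W' := Set.univ) _ (fun _ _ => trivial) hf), ?_⟩
      change _ = w
      rw [map_smul, bd_cmap, hbf, map_smul, t3, smul_smul, smul_smul, mul_assoc c⁻¹]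
      rw [show c⁻¹ * ((k.factorial : ℚ) * (k.factorial : ℚ) * (k.factorial : ℚ)) = 1 from
        inv_mul_cancel₀ (mul_ne_zero (mul_ne_zero hk hk) hk), one_smul]

end

lemma H0_ne {M : Type} [TopologicalSpace M] [Nonempty M] {v₀ : SingularHomology ℚ 0 M}
    (hv₀ : Submodule.span ℚ {v₀} = ⊤) : v₀ ≠ 0 := by
  rintro rfl
  obtain ⟨x⟩ := ‹Nonempty M›
  have hm : sg ⟨0, pt M x⟩ ∈ S 0 (Set.univ : Set M) := sg_mem_S _ fun _ => trivial
  have h : cls M 0 ⟨sg ⟨0, pt M x⟩, hm, bd_S_zero hm⟩ ∈ Submodule.span ℚ {(0 : SingularHomology ℚ 0 M)} := by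
    rw [hv₀]; trivial
  rw [Submodule.span_zero_singleton, Submodule.mem_bot, cls_eq_zero] at h
  obtain ⟨b, _, hb⟩ := h
  have := congrArg aug hb
  rw [aug_bd, aug_sg] at this
  simp at this

end BCT

/-- Let `M` be a connected manifold of finite type of odd dimension `d`, let
`V = H_*(M; ℚ)` and let `v₀ ∈ H_0(M; ℚ)` be the class of a point (a generator of
`H_0(M; ℚ)`).  For every `k ≥ 1` there is an isomorphism of graded `ℚ`-vector spaces
`H_*(C_k(M); ℚ) ≅ H_*(C_{k-1}(M); ℚ) ⊕ Sym^k(V)/⟨v₀⟩`, where `⟨v₀⟩` is the subspace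
`v₀ · Sym^{k-1}(V)`; in particular `dim_ℚ H_i(C_{k-1}(M); ℚ) ≤ dim_ℚ H_i(C_k(M); ℚ)`
for every `i`. -/
theorem homology_of_configuration_spaces_odd_dim_splitting
    (d : ℕ) (hd : Odd d) {H' : Type} [TopologicalSpace H']
    (I : ModelWithCorners ℝ (EuclideanSpace ℝ (Fin d)) H')
    (M : Type) [TopologicalSpace M] [ChartedSpace H' M]
    [T2Space M] [SecondCountableTopology M] [ConnectedSpace M]
    (hfin : ∀ i : ℕ, Module.Finite ℚ (SingularHomology ℚ i M))
    (v₀ : SingularHomology ℚ 0 M) (hv₀ : Submodule.span ℚ {v₀} = ⊤)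
    (k : ℕ) (hk : 1 ≤ k) :
    (∀ i : ℕ, Nonempty
      ((SingularHomology ℚ i (UnordConfigSpace M k)) ≃ₗ[ℚ]
        (SingularHomology ℚ i (UnordConfigSpace M (k - 1))) ×
        (↥(SymComponent (fun j => SingularHomology ℚ j M) k i) ⧸
          (Submodule.span ℚ { y | ∃ x ∈ SymComponent (fun j => SingularHomology ℚ j M) (k - 1) i,
              y = FreeGCAlg.gen (fun j => SingularHomology ℚ j M) ⟨0, v₀⟩ * x }).comap
            (SymComponent (fun j => SingularHomology ℚ j M) k i).subtype))) ∧
    (∀ i : ℕ,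
      Module.rank ℚ (SingularHomology ℚ i (UnordConfigSpace M (k - 1))) ≤
      Module.rank ℚ (SingularHomology ℚ i (UnordConfigSpace M k))) := by
  obtain ⟨k, rfl⟩ : ∃ m, k = m + 1 := ⟨k - 1, by omega⟩
  have hv := BCT.H0_ne hv₀
  rw [Nat.add_sub_cancel]
  refine ⟨fun i => ?_, fun i => ?_⟩
  · obtain ⟨e1⟩ := BCT.bct (M := M) I hd (k+1) i
    obtain ⟨e0⟩ := BCT.bct (M := M) I hd k i
    obtain ⟨_, ⟨e⟩⟩ := BCT.sym_split (BCT.Vs M) (k := k) (i := i) (v₀ := v₀) hv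
    exact ⟨e1.trans (e.trans (e0.symm.prodCongr (LinearEquiv.refl ℚ _)))⟩
  · obtain ⟨e1⟩ := BCT.bct (M := M) I hd (k+1) i
    obtain ⟨e0⟩ := BCT.bct (M := M) I hd k i
    obtain ⟨⟨f, hf⟩, _⟩ := BCT.sym_split (BCT.Vs M) (k := k) (i := i) (v₀ := v₀) hv
    refine LinearMap.rank_le_of_injective (e1.symm.toLinearMap ∘ₗ f ∘ₗ e0.toLinearMap) ?_
    exact e1.symm.injective.comp (hf.comp e0.injective)
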